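/- arXiv:1002.0823 — 5 statements merged into one kernel-verified Lean document; each statement's English description precedes it below -/
import Mathlib

section
/- Let (a_n)_{n≥0} be a bounded sequence of complex numbers. Suppose there exists a strictly increasing sequence of natural numbers n_j → ∞ such that for every integer k < 0, lim_{j→∞} a_{n_j+k} = 0, while liminf_{j→∞} |a_{n_j}| > 0. Then f(z) = Σ_{n=0}^∞ a_n z^n has a strong natural boundary on ∂𝔻. -/
open Filter Metric Set MeasureTheory

/-- `b : ℤ → ℂ` is a right limit of `a : ℕ → ℂ`. -/
def IsRightLimit (a : ℕ → ℂ) (b : ℤ → ℂ) : Prop :=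
  ∃ n : ℕ → ℕ, StrictMono n ∧
    ∀ k : ℤ, Tendsto (fun j => a (k + n j).toNat) atTop (nhds (b k))

/-- `f_+` for a two-sided sequence. -/
noncomputable def fPlus (b : ℤ → ℂ) (z : ℂ) : ℂ := ∑' n : ℕ, b n * z ^ n

/-- `f_-` for a two-sided sequence. -/
noncomputable def fMinus (b : ℤ → ℂ) (z : ℂ) : ℂ :=
  ∑' n : ℕ, b (-(n : ℤ) - 1) * z ^ (-(n : ℤ) - 1)

/-- The open arc `{e^{iθ} : α < θ < β}` of the unit circle. -/
def arc (α β : ℝ) : Set ℂ := {z | ∃ θ ∈ Set.Ioo α β, z = Complex.exp (θ * Complex.I)}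

/-- The two-sided sequence `b` is reflectionless on the arc `I`. -/
def Reflectionless (b : ℤ → ℂ) (I : Set ℂ) : Prop :=
  ∃ g : ℂ → ℂ,
    DifferentiableOn ℂ g ((Metric.sphere (0 : ℂ) 1 \ I)ᶜ) ∧
    (∀ z ∈ Metric.ball (0 : ℂ) 1, g z = fPlus b z) ∧
    (∀ z : ℂ, 1 < ‖z‖ → g z = - fMinus b z)

/-- `f` has a strong natural boundary on the unit circle. -/
def StrongNaturalBoundary (f : ℂ → ℂ) : Prop :=
  ∀ α β : ℝ, α < β →
    ¬ ∃ M : ℝ, ∀ r : ℝ, 0 < r → r < 1 →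
      (∫ θ in α..β, ‖f (r * Complex.exp (θ * Complex.I))‖) / (2 * Real.pi) ≤ M

/-- `f` has a (classical) natural boundary on the unit circle. -/
def NaturalBoundary (f : ℂ → ℂ) : Prop :=
  ¬ ∃ z₀ : ℂ, ‖z₀‖ = 1 ∧ ∃ δ > (0 : ℝ), ∃ g : ℂ → ℂ,
    DifferentiableOn ℂ g (Metric.ball (0 : ℂ) 1 ∪ Metric.ball z₀ δ) ∧
    ∀ z ∈ Metric.ball (0 : ℂ) 1, g z = f z

def TT (α β : ℝ) (ψ : ℝ → ℂ) : Prop :=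
  ContDiff ℝ (⊤ : ℕ∞) ψ ∧ ∀ x, x ∉ Set.Icc α β → ψ x = 0

lemma TT.mul_right {α β : ℝ} {ψ g : ℝ → ℂ} (h : TT α β ψ) (hg : ContDiff ℝ (⊤ : ℕ∞) g) :
    TT α β (fun x => ψ x * g x) :=
  ⟨h.1.mul hg, fun x hx => by simp [h.2 x hx]⟩

lemma TT.add {α β : ℝ} {ψ g : ℝ → ℂ} (h : TT α β ψ) (hg : TT α β g) :
    TT α β (fun x => ψ x + g x) :=
  ⟨h.1.add hg.1, fun x hx => by simp [h.2 x hx, hg.2 x hx]⟩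

lemma contDiff_conj {g : ℝ → ℂ} (hg : ContDiff ℝ (⊤ : ℕ∞) g) :
    ContDiff ℝ (⊤ : ℕ∞) (fun x => (starRingEnd ℂ) (g x)) :=
  Complex.conjCLE.contDiff.comp hg

lemma contDiff_re' {g : ℝ → ℂ} (hg : ContDiff ℝ (⊤ : ℕ∞) g) :
    ContDiff ℝ (⊤ : ℕ∞) (fun x => (((g x).re : ℝ) : ℂ)) :=
  Complex.ofRealCLM.contDiff.comp (Complex.reCLM.contDiff.comp hg)

lemma contDiff_im' {g : ℝ → ℂ} (hg : ContDiff ℝ (⊤ : ℕ∞) g) :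
    ContDiff ℝ (⊤ : ℕ∞) (fun x => (((g x).im : ℝ) : ℂ)) :=
  Complex.ofRealCLM.contDiff.comp (Complex.imCLM.contDiff.comp hg)

lemma contDiff_ee (s : ℝ) : ContDiff ℝ (⊤ : ℕ∞) (fun x : ℝ => Complex.exp ((s * x : ℝ) * Complex.I)) := by
  apply ContDiff.cexp
  apply ContDiff.mul _ contDiff_const
  exact Complex.ofRealCLM.contDiff.comp (contDiff_const.mul contDiff_id)

lemma TT.bounded {α β : ℝ} {ψ : ℝ → ℂ} (h : TT α β ψ) : ∃ B : ℝ, 0 < B ∧ ∀ x, ‖ψ x‖ ≤ B := by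
  obtain ⟨B, hB⟩ := (isCompact_Icc (a := α) (b := β)).exists_bound_of_continuousOn
    h.1.continuous.continuousOn
  refine ⟨max B 1, by positivity, fun x => ?_⟩
  by_cases hx : x ∈ Set.Icc α β
  · exact (hB x hx).trans (le_max_left _ _)
  · simp [h.2 x hx]

/-- near-extremal functional: values on real multiples are almost real -/
lemma almost_real {α β : ℝ} (Λ : (ℝ → ℂ) → ℂ) (N : ℝ)
    (hadd : ∀ ψ φ, TT α β ψ → TT α β φ → Λ (fun x => ψ x + φ x) = Λ ψ + Λ φ)
    (hsmul : ∀ (c : ℂ) ψ, TT α β ψ → Λ (fun x => ψ x * c) = Λ ψ * c)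
    (hN : ∀ ψ, TT α β ψ → (∀ x, ‖ψ x‖ ≤ 1) → (Λ ψ).re ≤ N)
    (t : ℝ) (ht : 0 < t) (u : ℝ → ℂ) (hu : TT α β u) (hu1 : ∀ x, ‖u x‖ ≤ 1)
    (hut : N - t ^ 2 ≤ (Λ u).re) (ξ : ℝ → ℝ) (hξ : ContDiff ℝ (⊤ : ℕ∞) (fun x => (ξ x : ℂ)))
    (hξ1 : ∀ x, |ξ x| ≤ 1) :
    |(Λ (fun x => u x * (ξ x : ℂ))).im| ≤ t * (1 + N / 2) := by
  have hT : TT α β (fun x => u x * (ξ x : ℂ)) := hu.mul_right hξ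
  have key : ∀ s : ℝ, s ^ 2 = t ^ 2 → 
      (Λ u).re - s * (Λ (fun x => u x * (ξ x : ℂ))).im ≤ N * (1 + t ^ 2 / 2) := by
    intro s hs
    have hT2 : TT α β (fun x => (u x * (ξ x : ℂ)) * (s * Complex.I)) := hT.mul_right contDiff_const
    have hT3 := hu.add hT2
    have hD : (0:ℝ) < 1 + t ^ 2 / 2 := by positivity
    have hT4 : TT α β (fun x => (u x + (u x * (ξ x : ℂ)) * (s * Complex.I)) * (((1 + t ^ 2 / 2)⁻¹ : ℝ) : ℂ)) :=
      hT3.mul_right contDiff_const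
    have h := hN _ hT4 ?_
    · rw [hsmul _ _ hT3, hadd _ _ hu hT2, hsmul _ _ hT, Complex.re_mul_ofReal,
        ← div_eq_mul_inv, div_le_iff₀ hD] at h
      simpa [mul_comm, sub_eq_add_neg] using h
    · intro x
      rw [norm_mul, Complex.norm_real, Real.norm_of_nonneg (by positivity), ← div_eq_mul_inv,
        div_le_one hD]
      have : u x + (u x * (ξ x : ℂ)) * (s * Complex.I) = u x * (1 + (s * ξ x : ℝ) * Complex.I) := by
        push_cast; ring
      rw [this, norm_mul]
      have h1 : ‖(1 + (s * ξ x : ℝ) * Complex.I : ℂ)‖ ≤ 1 + t ^ 2 / 2 := by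
        have h2 : ‖(1 + (s * ξ x : ℝ) * Complex.I : ℂ)‖ ^ 2 = 1 + (s * ξ x) ^ 2 := by
          rw [← Complex.normSq_eq_norm_sq, Complex.normSq_apply]
          simp; ring
        have h3 : (ξ x) ^ 2 ≤ 1 := by
          rw [← sq_abs]; nlinarith [hξ1 x, abs_nonneg (ξ x)]
        apply le_of_sq_le_sq _ hD.le
        rw [h2, mul_pow, hs]
        nlinarith [sq_nonneg t, sq_nonneg (t^2)]
      calc _ ≤ 1 * (1 + t ^ 2 / 2) := mul_le_mul (hu1 x) h1 (norm_nonneg _) zero_le_one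
        _ = _ := one_mul _
  have k1 := key t rfl
  have k2 := key (-t) (by ring)
  rw [abs_le]
  constructor
  · by_contra hc
    push Not at hc
    nlinarith
  · by_contra hc
    push Not at hc
    nlinarith

lemma near_conj {α β : ℝ} (Λ : (ℝ → ℂ) → ℂ) (N : ℝ)
    (hadd : ∀ ψ φ, TT α β ψ → TT α β φ → Λ (fun x => ψ x + φ x) = Λ ψ + Λ φ)
    (hsmul : ∀ (c : ℂ) ψ, TT α β ψ → Λ (fun x => ψ x * c) = Λ ψ * c)
    (hN : ∀ ψ, TT α β ψ → (∀ x, ‖ψ x‖ ≤ 1) → (Λ ψ).re ≤ N)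
    (t : ℝ) (ht : 0 < t) (u : ℝ → ℂ) (hu : TT α β u) (hu1 : ∀ x, ‖u x‖ ≤ 1)
    (hut : N - t ^ 2 ≤ (Λ u).re) (χ : ℝ → ℂ) (hχ : TT α β χ) (hχ1 : ∀ x, ‖χ x‖ ≤ 1) :
    ‖Λ χ‖ ≤ ‖Λ (fun x => (starRingEnd ℂ) (χ x) * (u x * u x))‖ + (2 * t ^ 2 + 4 * (t * (1 + N / 2))) := by
  -- defect part
  set d : ℝ → ℂ := fun x => χ x * (1 - u x * (starRingEnd ℂ) (u x)) with hd
  have hdT : TT α β d := hχ.mul_right (contDiff_const.sub (hu.1.mul (contDiff_conj hu.1)))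
  have hd1 : ‖Λ d‖ ≤ 2 * t ^ 2 := by
    obtain ⟨c, hc, hcd⟩ : ∃ c : ℂ, ‖c‖ ≤ 1 ∧ Λ d * c = (‖Λ d‖ : ℂ) := by
      by_cases h0 : Λ d = 0
      · exact ⟨0, by simp, by simp [h0]⟩
      · refine ⟨(‖Λ d‖ : ℂ) / Λ d, ?_, by field_simp⟩
        simp [h0]
    have hdT2 : TT α β (fun x => d x * (c / 2)) := hdT.mul_right contDiff_const
    have h := hN _ (hu.add hdT2) ?_
    · rw [hadd _ _ hu hdT2, hsmul _ _ hdT, mul_div_assoc', hcd] at h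
      have : ((‖Λ d‖ : ℂ) / 2).re = ‖Λ d‖ / 2 := by
        rw [← Complex.ofReal_ofNat, ← Complex.ofReal_div, Complex.ofReal_re]
      rw [Complex.add_re, this] at h
      linarith
    · intro x
      have e1 : (1 - u x * (starRingEnd ℂ) (u x)) = ((1 - ‖u x‖ ^ 2 : ℝ) : ℂ) := by
        rw [Complex.mul_conj, Complex.normSq_eq_norm_sq]; push_cast; rfl
      have e2 : ‖d x * (c / 2)‖ ≤ (1 - ‖u x‖ ^ 2) / 2 := by
        have hn : 0 ≤ 1 - ‖u x‖ ^ 2 := by nlinarith [hu1 x, norm_nonneg (u x)]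
        rw [hd]
        simp only [norm_mul, norm_div, e1, Complex.norm_real, Real.norm_of_nonneg hn]
        have : ‖χ x‖ * ‖c‖ ≤ 1 := mul_le_one₀ (hχ1 x) (norm_nonneg _) hc
        have h2 : ‖(2:ℂ)‖ = 2 := by simp
        rw [h2]
        nlinarith
      calc _ ≤ ‖u x‖ + ‖d x * (c / 2)‖ := norm_add_le _ _
        _ ≤ 1 := by nlinarith [sq_nonneg (1 - ‖u x‖)]
  set v : ℝ → ℂ := fun x => (starRingEnd ℂ) (u x) * χ x with hv
  have hvC : ContDiff ℝ (⊤ : ℕ∞) v := (contDiff_conj hu.1).mul hχ.1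
  have hv1 : ∀ x, ‖v x‖ ≤ 1 := fun x => by
    simp only [hv, norm_mul, RCLike.norm_conj]
    exact mul_le_one₀ (hu1 x) (norm_nonneg _) (hχ1 x)
  have hp := almost_real Λ N hadd hsmul hN t ht u hu hu1 hut (fun x => (v x).re) (contDiff_re' hvC)
    (fun x => (Complex.abs_re_le_norm _).trans (hv1 x))
  have hq := almost_real Λ N hadd hsmul hN t ht u hu hu1 hut (fun x => (v x).im) (contDiff_im' hvC)
    (fun x => (Complex.abs_im_le_norm _).trans (hv1 x))
  have hpT : TT α β (fun x => u x * ((v x).re : ℂ)) := hu.mul_right (contDiff_re' hvC)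
  have hqT : TT α β (fun x => u x * ((v x).im : ℂ)) := hu.mul_right (contDiff_im' hvC)
  set P := Λ (fun x => u x * ((v x).re : ℂ))
  set Q := Λ (fun x => u x * ((v x).im : ℂ))
  have E1 : Λ χ = Λ d + (P + Q * Complex.I) := by
    rw [← hsmul _ _ hqT, ← hadd _ _ hpT (hqT.mul_right contDiff_const),
      ← hadd _ _ hdT (hpT.add (hqT.mul_right contDiff_const))]
    congr 1
    ext x
    have : u x * ((v x).re : ℂ) + u x * ((v x).im : ℂ) * Complex.I = u x * v x := by
      conv_rhs => rw [← Complex.re_add_im (v x)]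
      ring
    rw [this, hd, hv]
    ring
  have E2 : Λ (fun x => (starRingEnd ℂ) (χ x) * (u x * u x)) = P + Q * (-Complex.I) := by
    rw [← hsmul _ _ hqT, ← hadd _ _ hpT (hqT.mul_right contDiff_const)]
    congr 1
    ext x
    have : u x * ((v x).re : ℂ) + u x * ((v x).im : ℂ) * (-Complex.I) = u x * (starRingEnd ℂ) (v x) := by
      have hcv : (starRingEnd ℂ) (v x) = ((v x).re : ℂ) - ((v x).im : ℂ) * Complex.I := by
        apply Complex.ext <;> simp
      rw [hcv]
      ring
    rw [this, hv]
    simp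
    ring
  have E3 : (starRingEnd ℂ) (P + Q * Complex.I) = (P + Q * (-Complex.I)) + 
      ((-2 * P.im : ℝ) * Complex.I + (-2 * Q.im : ℝ)) := by
    apply Complex.ext <;> simp <;> ring
  have E4 : ‖P + Q * Complex.I‖ ≤ ‖P + Q * (-Complex.I)‖ + (2 * |P.im| + 2 * |Q.im|) := by
    rw [← RCLike.norm_conj, E3]
    refine (norm_add_le _ _).trans ?_
    gcongr
    refine (norm_add_le _ _).trans ?_
    rw [norm_mul, Complex.norm_real, Complex.norm_real]
    simp
  rw [E1, E2]
  refine (norm_add_le _ _).trans ?_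
  linarith

lemma rajchman {α β : ℝ} (Λ : (ℝ → ℂ) → ℂ) (M : ℝ)
    (hadd : ∀ ψ φ, TT α β ψ → TT α β φ → Λ (fun x => ψ x + φ x) = Λ ψ + Λ φ)
    (hsmul : ∀ (c : ℂ) ψ, TT α β ψ → Λ (fun x => ψ x * c) = Λ ψ * c)
    (hM : ∀ ψ, TT α β ψ → (∀ x, ‖ψ x‖ ≤ 1) → ‖Λ ψ‖ ≤ M)
    (hneg : ∀ ψ, TT α β ψ → Tendsto (fun m : ℕ => 
      Λ (fun x => ψ x * Complex.exp (((m : ℝ) * x : ℝ) * Complex.I))) atTop (nhds 0))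
    (ψ : ℝ → ℂ) (hψ : TT α β ψ) :
    Tendsto (fun m : ℕ => 
      Λ (fun x => ψ x * Complex.exp (((-(m : ℝ)) * x : ℝ) * Complex.I))) atTop (nhds 0) := by
  wlog hψ1 : ∀ x, ‖ψ x‖ ≤ 1 generalizing ψ
  · obtain ⟨B, hB, hψB⟩ := hψ.bounded
    have h := this (fun x => ψ x * ((B⁻¹ : ℝ) : ℂ)) (hψ.mul_right contDiff_const) (fun x => by
      rw [norm_mul, Complex.norm_real, Real.norm_of_nonneg (by positivity), ← div_eq_mul_inv,
        div_le_one hB]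
      exact hψB x)
    have h2 := h.mul_const (B : ℂ)
    rw [zero_mul] at h2
    refine h2.congr fun m => ?_
    rw [← hsmul _ _ ((hψ.mul_right contDiff_const).mul_right (contDiff_ee _))]
    congr 1
    ext x
    have : (B : ℂ) ≠ 0 := by exact_mod_cast hB.ne'
    push_cast
    field_simp
  set S : Set ℝ := {s | ∃ φ, TT α β φ ∧ (∀ x, ‖φ x‖ ≤ 1) ∧ (Λ φ).re = s}
  have hSb : BddAbove S := ⟨M, by
    rintro _ ⟨φ, h1, h2, rfl⟩
    exact (Complex.re_le_norm _).trans (hM φ h1 h2)⟩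
  have hz : TT α β (fun _ => 0) := ⟨contDiff_const, fun _ _ => rfl⟩
  have hL0 : Λ (fun _ => 0) = 0 := by
    have := hsmul 0 _ hz
    simpa using this
  have hS0 : (0:ℝ) ∈ S := ⟨fun _ => 0, hz, by simp, by simp [hL0]⟩
  have hN : ∀ φ, TT α β φ → (∀ x, ‖φ x‖ ≤ 1) → (Λ φ).re ≤ sSup S := fun φ h1 h2 =>
    le_csSup hSb ⟨φ, h1, h2, rfl⟩
  set N := sSup S
  rw [Metric.tendsto_atTop]
  intro ε hε
  obtain ⟨t, ht, hte⟩ : ∃ t : ℝ, 0 < t ∧ 2 * t ^ 2 + 4 * (t * (1 + N / 2)) < ε / 2 := by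
    have : Tendsto (fun t : ℝ => 2 * t ^ 2 + 4 * (t * (1 + N / 2))) (nhdsWithin 0 (Ioi 0)) (nhds 0) := by
      apply tendsto_nhdsWithin_of_tendsto_nhds
      have : Continuous (fun t : ℝ => 2 * t ^ 2 + 4 * (t * (1 + N / 2))) := by fun_prop
      simpa using this.tendsto 0
    obtain ⟨t, h1, h2⟩ := ((this.eventually_lt_const (half_pos hε)).and self_mem_nhdsWithin).exists
    exact ⟨t, h2, h1⟩
  obtain ⟨_, ⟨u, hu, hu1, rfl⟩, hut⟩ := exists_lt_of_lt_csSup ⟨0, hS0⟩ 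
    (show N - t ^ 2 < sSup S by have := pow_pos ht 2; simp only [N]; linarith)
  have hT2 : TT α β (fun x => (starRingEnd ℂ) (ψ x) * (u x * u x)) := by
    have := hu.mul_right (hu.1.mul (contDiff_conj hψ.1))
    convert this using 2
    ring
  have h3 := hneg _ hT2
  rw [Metric.tendsto_atTop] at h3
  obtain ⟨m0, hm0⟩ := h3 (ε / 2) (half_pos hε)
  refine ⟨m0, fun m hm => ?_⟩
  have h4 := hm0 m hm
  rw [dist_zero_right] at h4 ⊢
  have h5 := near_conj Λ N hadd hsmul hN t ht u hu hu1 hut.le _ 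
    (hψ.mul_right (contDiff_ee (-(m:ℝ)))) (fun x => by
      rw [norm_mul, Complex.norm_exp_ofReal_mul_I, mul_one]; exact hψ1 x)
  have e : (fun x => (starRingEnd ℂ) (ψ x * Complex.exp (((-(m : ℝ)) * x : ℝ) * Complex.I)) * (u x * u x))
    = (fun x => (starRingEnd ℂ) (ψ x) * (u x * u x) * Complex.exp (((m : ℝ) * x : ℝ) * Complex.I)) := by
    ext x
    rw [map_mul, ← Complex.exp_conj]
    simp only [map_mul, Complex.conj_ofReal, Complex.conj_I]
    push_cast
    ring_nf
  rw [e] at h5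
  linarith

noncomputable def ft (ψ : ℝ → ℂ) (s : ℝ) : ℂ := ∫ x : ℝ, ψ x * Complex.exp ((s * x : ℝ) * Complex.I)

lemma TT.compact {α β : ℝ} {ψ : ℝ → ℂ} (h : TT α β ψ) : HasCompactSupport ψ :=
  HasCompactSupport.intro isCompact_Icc h.2

lemma TT.integrable {α β : ℝ} {ψ : ℝ → ℂ} (h : TT α β ψ) : Integrable ψ :=
  h.1.continuous.integrable_of_hasCompactSupport h.compact

open FourierTransform in
lemma ft_decay {α β : ℝ} {ψ : ℝ → ℂ} (h : TT α β ψ) :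
    ∃ K : ℝ, 0 ≤ K ∧ ∀ s : ℝ, ‖ft ψ s‖ ≤ K / (1 + s ^ 2) := by
  set S : SchwartzMap ℝ ℂ := h.compact.toSchwartzMap h.1 with hS
  have hSψ : ∀ x, S x = ψ x := fun x => rfl
  have hft : ∀ s, ft ψ s = (𝓕 S) (-(s / (2 * Real.pi))) := by
    intro s
    rw [SchwartzMap.fourier_coe, Real.fourier_real_eq_integral_exp_smul, ft]
    congr 1
    ext x
    rw [smul_eq_mul, mul_comm, hSψ]
    congr 4
    field_simp [Real.pi_ne_zero]
  obtain ⟨C0, h0, hC0⟩ := (𝓕 S).decay 0 0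
  obtain ⟨C2, h2, hC2⟩ := (𝓕 S).decay 2 0
  refine ⟨C0 + (2 * Real.pi) ^ 2 * C2, by positivity, fun s => ?_⟩
  have a0 := hC0 (-(s / (2 * Real.pi)))
  have a2 := hC2 (-(s / (2 * Real.pi)))
  rw [norm_iteratedFDeriv_zero, ← hft] at a0 a2
  rw [le_div_iff₀ (by positivity)]
  rw [norm_neg, norm_div, div_pow, Real.norm_eq_abs, sq_abs, Real.norm_of_nonneg (by positivity), 
    div_mul_eq_mul_div, div_le_iff₀ (by positivity)] at a2
  simp only [pow_zero, one_mul] at a0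
  nlinarith

lemma ft_shift (ψ : ℝ → ℂ) (s m : ℝ) :
    ft (fun x => ψ x * Complex.exp ((m * x : ℝ) * Complex.I)) s = ft ψ (s + m) := by
  unfold ft
  congr 1
  ext x
  rw [mul_assoc, ← Complex.exp_add]
  congr 2
  push_cast; ring

lemma ft_translate (ψ : ℝ → ℂ) (s t : ℝ) :
    ft (fun x => ψ (x - t)) s = ft ψ s * Complex.exp ((s * t : ℝ) * Complex.I) := by
  unfold ft
  rw [← integral_mul_const, ← integral_sub_right_eq_self
    (fun x : ℝ => ψ x * Complex.exp ((s * x : ℝ) * Complex.I) * Complex.exp ((s * t : ℝ) * Complex.I)) t]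
  congr 1
  ext x
  rw [mul_assoc, ← Complex.exp_add]
  congr 2
  push_cast; ring

lemma integrable_mul_ee {α β : ℝ} {ψ : ℝ → ℂ} (h : TT α β ψ) (s : ℝ) :
    Integrable (fun x : ℝ => ψ x * Complex.exp ((s * x : ℝ) * Complex.I)) :=
  (h.mul_right (contDiff_ee s)).integrable

lemma ft_add {α β : ℝ} {ψ φ : ℝ → ℂ} (h : TT α β ψ) (h' : TT α β φ) (s : ℝ) :
    ft (fun x => ψ x + φ x) s = ft ψ s + ft φ s := by
  unfold ft
  rw [← integral_add (integrable_mul_ee h s) (integrable_mul_ee h' s)]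
  congr 1; ext x; ring

lemma ft_smul (ψ : ℝ → ℂ) (c : ℂ) (s : ℝ) :
    ft (fun x => ψ x * c) s = ft ψ s * c := by
  unfold ft
  rw [← integral_mul_const]
  congr 1; ext x; ring

lemma summable_K (K : ℝ) : Summable (fun k : ℤ => K / (1 + (k:ℝ) ^ 2)) := by
  simp_rw [div_eq_mul_inv]
  apply Summable.mul_left
  have h := (Real.summable_one_div_int_pow (p := 2)).mpr (by norm_num)
  refine Summable.of_norm_bounded_eventually (g := fun k : ℤ => 1 / (k:ℝ) ^ 2) h ?_
  rw [Filter.eventually_cofinite]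
  refine (Set.finite_singleton (0:ℤ)).subset fun k hk => ?_
  by_contra hk0
  apply hk
  have : (k:ℝ) ≠ 0 := by exact_mod_cast hk0
  have h2 : 0 < (k:ℝ)^2 := by positivity
  rw [Real.norm_of_nonneg (by positivity), one_div]
  gcongr; linarith

lemma summable_KN (K : ℝ) : Summable (fun k : ℕ => K / (1 + (k:ℝ) ^ 2)) := by
  have := (summable_K K).comp_injective Nat.cast_injective
  simpa [Function.comp_def] using this

noncomputable def LL (a : ℕ → ℂ) (ψ : ℝ → ℂ) : ℂ := ∑' k : ℕ, a k * ft ψ k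

lemma coef_bound {a : ℕ → ℂ} {C K : ℝ} (hC : ∀ n, ‖a n‖ ≤ C) {x : ℂ} {D : ℝ} (n : ℕ) 
    (hx : ‖x‖ ≤ K / D) : ‖a n * x‖ ≤ (C * K) / D := by
  rw [norm_mul, mul_div_assoc]
  exact mul_le_mul (hC n) hx (norm_nonneg _) ((norm_nonneg _).trans (hC n))

lemma LL_summable {α β : ℝ} {a : ℕ → ℂ} {C : ℝ} (hC : ∀ n, ‖a n‖ ≤ C) {ψ : ℝ → ℂ} (h : TT α β ψ) :
    Summable (fun k : ℕ => a k * ft ψ k) := by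
  obtain ⟨K, hK, hb⟩ := ft_decay h
  exact Summable.of_norm_bounded (summable_KN (C * K)) fun k => coef_bound hC k (hb k)

lemma LL_neg {α β : ℝ} {a : ℕ → ℂ} {C : ℝ} (hC : ∀ n, ‖a n‖ ≤ C) {ψ : ℝ → ℂ} (h : TT α β ψ) :
    Tendsto (fun m : ℕ => 
      LL a (fun x => ψ x * Complex.exp (((m : ℝ) * x : ℝ) * Complex.I))) atTop (nhds 0) := by
  obtain ⟨K, hK, hb⟩ := ft_decay h
  have hC0 : 0 ≤ C := (norm_nonneg _).trans (hC 0)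
  unfold LL
  simp_rw [ft_shift]
  have := tendsto_tsum_of_dominated_convergence (𝓕 := atTop) 
    (f := fun (m : ℕ) (k : ℕ) => a k * ft ψ (k + m)) (g := fun _ => 0) (summable_KN (C * K)) ?_ ?_
  · simpa using this
  · intro k
    have hz : Tendsto (fun m : ℕ => (C * K) / (1 + (m:ℝ) ^ 2)) atTop (nhds 0) := 
      (summable_KN (C * K)).tendsto_atTop_zero
    refine squeeze_zero_norm (fun m => ?_) hz
    refine (coef_bound hC k (hb (k + m))).trans ?_
    have := mul_nonneg hC0 hK
    gcongr
    have : (0:ℝ) ≤ k := by positivity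
    linarith
  · refine Eventually.of_forall fun m k => ?_
    refine (coef_bound hC k (hb (k + m))).trans ?_
    have := mul_nonneg hC0 hK
    gcongr
    have : (0:ℝ) ≤ m := by positivity
    linarith

lemma LL_bound {α β : ℝ} (hαβ : α < β) {a : ℕ → ℂ} {C : ℝ} (hC : ∀ n, ‖a n‖ ≤ C) (f : ℂ → ℂ)
    (hf : ∀ z ∈ Metric.ball (0 : ℂ) 1, f z = ∑' m : ℕ, a m * z ^ m) (M : ℝ)
    (hM : ∀ r : ℝ, 0 < r → r < 1 → 
      (∫ θ in α..β, ‖f (r * Complex.exp (θ * Complex.I))‖) ≤ M)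
    (ψ : ℝ → ℂ) (h : TT α β ψ) (h1 : ∀ x, ‖ψ x‖ ≤ 1) : ‖LL a ψ‖ ≤ M := by
  obtain ⟨K, hK, hb⟩ := ft_decay h
  have hC0 : 0 ≤ C := (norm_nonneg _).trans (hC 0)
  have lim : Tendsto (fun r : ℝ => ∑' k : ℕ, a k * ((r:ℂ) ^ k * ft ψ k)) (nhdsWithin 1 (Iio 1)) (nhds (LL a ψ)) := by
    refine tendsto_tsum_of_dominated_convergence (summable_KN (C * K)) ?_ ?_
    · intro k
      apply tendsto_nhdsWithin_of_tendsto_nhds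
      have : Continuous (fun r : ℝ => a k * ((r:ℂ) ^ k * ft ψ k)) := by fun_prop
      simpa using this.tendsto 1
    · have : ∀ᶠ r : ℝ in nhdsWithin 1 (Iio 1), r ∈ Ioo (0:ℝ) 1 := Ioo_mem_nhdsLT one_pos
      filter_upwards [this] with r hr k
      apply coef_bound hC
      refine le_trans ?_ (hb k)
      rw [norm_mul, norm_pow, Complex.norm_real, Real.norm_of_nonneg hr.1.le]
      exact mul_le_of_le_one_left (norm_nonneg _) (pow_le_one₀ hr.1.le hr.2.le)
  refine le_of_tendsto lim.norm ?_
  have : ∀ᶠ r : ℝ in nhdsWithin 1 (Iio 1), r ∈ Ioo (0:ℝ) 1 := Ioo_mem_nhdsLT one_pos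
  filter_upwards [this] with r hr
  refine le_trans ?_ (hM r hr.1 hr.2)
  have hzb : ∀ θ : ℝ, (r : ℂ) * Complex.exp (θ * Complex.I) ∈ Metric.ball (0:ℂ) 1 := by
    intro θ
    rw [mem_ball_zero_iff, norm_mul, Complex.norm_exp_ofReal_mul_I, Complex.norm_real, 
      Real.norm_of_nonneg hr.1.le, mul_one]
    exact hr.2
  have hsr : Summable (fun k : ℕ => C * r ^ k) := (summable_geometric_of_lt_one hr.1.le hr.2).mul_left C
  have hterm : ∀ (k : ℕ) (θ : ℝ), ‖a k * ((r : ℂ) * Complex.exp (θ * Complex.I)) ^ k‖ ≤ C * r ^ k := by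
    intro k θ
    rw [norm_mul, norm_pow, norm_mul, Complex.norm_exp_ofReal_mul_I, Complex.norm_real, 
      Real.norm_of_nonneg hr.1.le, mul_one]
    exact mul_le_mul_of_nonneg_right (hC k) (pow_nonneg hr.1.le k)
  have hcont : Continuous (fun θ : ℝ => f ((r : ℂ) * Complex.exp (θ * Complex.I))) := by
    simp_rw [fun θ : ℝ => hf _ (hzb θ)]
    exact continuous_tsum (fun k => by fun_prop) hsr hterm
  have hIntegral : ∑' k : ℕ, a k * ((r:ℂ) ^ k * ft ψ k) = ∫ θ : ℝ, ψ θ * f ((r : ℂ) * Complex.exp (θ * Complex.I)) := by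
    have e : ∀ k : ℕ, a k * ((r:ℂ) ^ k * ft ψ k) = 
        ∫ θ : ℝ, ψ θ * (a k * ((r : ℂ) * Complex.exp (θ * Complex.I)) ^ k) := by
      intro k
      unfold ft
      rw [← mul_assoc, ← integral_const_mul]
      congr 1; ext θ
      rw [mul_pow, ← Complex.exp_nat_mul]
      push_cast
      ring_nf
    simp_rw [e]
    have hi : ∀ k : ℕ, Integrable (fun θ : ℝ => ψ θ * (a k * ((r : ℂ) * Complex.exp (θ * Complex.I)) ^ k)) := by
      intro k
      refine (h.1.continuous.mul (by fun_prop)).integrable_of_hasCompactSupport h.compact.mul_right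
    rw [integral_tsum_of_summable_integral_norm hi]
    · congr 1; ext θ
      rw [tsum_mul_left, hf _ (hzb θ)]
    · refine Summable.of_nonneg_of_le (fun k => integral_nonneg fun _ => norm_nonneg _) (fun k => ?_) 
        (hsr.mul_left (∫ θ, ‖ψ θ‖))
      rw [← integral_mul_const]
      refine integral_mono (hi k).norm (h.integrable.norm.mul_const _) fun θ => ?_
      simp only [norm_mul (ψ θ)]
      exact mul_le_mul_of_nonneg_left (hterm k θ) (norm_nonneg _)
  rw [hIntegral, intervalIntegral.integral_of_le hαβ.le, ← integral_Icc_eq_integral_Ioc]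
  have e2 : ∫ θ : ℝ, ψ θ * f ((r : ℂ) * Complex.exp (θ * Complex.I)) = 
      ∫ θ in Icc α β, ψ θ * f ((r : ℂ) * Complex.exp (θ * Complex.I)) := by
    rw [setIntegral_eq_integral_of_forall_compl_eq_zero]
    intro x hx
    rw [h.2 x hx, zero_mul]
  rw [e2]
  refine norm_integral_le_of_norm_le hcont.norm.continuousOn.integrableOn_Icc (ae_of_all _ fun θ => ?_)
  rw [norm_mul]
  exact mul_le_of_le_one_left (norm_nonneg _) (h1 θ)

lemma LL_limit {α β : ℝ} {a : ℕ → ℂ} {C : ℝ} (hC : ∀ n, ‖a n‖ ≤ C) {ψ : ℝ → ℂ} (h : TT α β ψ)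
    (n : ℕ → ℕ) (L : Filter ℕ) (b : ℤ → ℂ) (hn : Tendsto n L atTop)
    (hb : ∀ k, Tendsto (fun j => a ((n j : ℤ) + k).toNat) L (nhds (b k)))
    (hb0 : ∀ k < 0, b k = 0) :
    Tendsto (fun j => LL a (fun x => ψ x * Complex.exp (((-(n j : ℝ)) * x : ℝ) * Complex.I))) L
      (nhds (∑' k : ℕ, b k * ft ψ k)) := by
  obtain ⟨K, hK, hbd⟩ := ft_decay h
  have hC0 : 0 ≤ C := (norm_nonneg _).trans (hC 0)
  have e1 : ∑' k : ℕ, b k * ft ψ k = ∑' k : ℤ, b k * ft ψ k := by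
    have := Function.Injective.tsum_eq (g := fun k : ℕ => (k : ℤ)) Nat.cast_injective 
      (f := fun k : ℤ => b k * ft ψ k) ?_
    · simpa using this
    · intro k hk
      by_contra hk2
      apply hk
      have : k < 0 := by
        by_contra h3
        exact hk2 ⟨k.toNat, by simpa using h3⟩
      simp [hb0 k this]
  have e2 : ∀ j, LL a (fun x => ψ x * Complex.exp (((-(n j : ℝ)) * x : ℝ) * Complex.I)) = 
      ∑' k : ℤ, (if 0 ≤ (n j : ℤ) + k then a ((n j : ℤ) + k).toNat * ft ψ k else 0) := by
    intro j
    unfold LL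
    simp_rw [ft_shift]
    have := Function.Injective.tsum_eq (g := fun k : ℕ => (k : ℤ) - n j) 
      (fun x y hxy => by simpa using hxy)
      (f := fun k : ℤ => if 0 ≤ (n j : ℤ) + k then a ((n j : ℤ) + k).toNat * ft ψ k else 0) ?_
    · rw [← this]
      congr 1
      ext k
      rw [if_pos (by omega)]
      congr 2
      · congr 1
        omega
      · push_cast; ring
    · intro k hk
      have : 0 ≤ (n j : ℤ) + k := by
        by_contra h3
        exact hk (if_neg h3)
      exact ⟨((n j : ℤ) + k).toNat, by simp only; omega⟩
  rw [e1]
  simp_rw [e2]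
  refine tendsto_tsum_of_dominated_convergence (summable_K (C * K)) ?_ ?_
  · intro k
    refine ((hb k).mul_const (ft ψ k)).congr' ?_
    filter_upwards [hn.eventually_ge_atTop (-k).toNat] with j hj
    rw [if_pos (by omega)]
  · refine Eventually.of_forall fun j k => ?_
    split_ifs
    · exact coef_bound hC _ (hbd k)
    · simp only [norm_zero]
      have := mul_nonneg hC0 hK
      positivity

lemma final_zero (c : ℕ → ℂ) (hc : Summable (fun k => ‖c k‖)) (δ : ℝ) (hδ : 0 < δ)
    (hz : ∀ t : ℝ, |t| ≤ δ → ∑' k : ℕ, c k * Complex.exp ((k * t : ℝ) * Complex.I) = 0) : c 0 = 0 := by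
  set G : ℂ → ℂ := fun z => ∑' k : ℕ, c k * z ^ k with hG
  have hGbd : ∀ (k : ℕ) (z : ℂ), z ∈ closedBall (0:ℂ) 1 → ‖c k * z ^ k‖ ≤ ‖c k‖ := by
    intro k z hz
    rw [norm_mul, norm_pow]
    exact mul_le_of_le_one_right (norm_nonneg _) (pow_le_one₀ (norm_nonneg _) (by simpa using hz))
  have hGc : ContinuousOn G (closedBall 0 1) :=
    continuousOn_tsum (fun k => by fun_prop) hc hGbd
  have hGd : DifferentiableOn ℂ G (ball 0 1) :=
    Complex.differentiableOn_tsum_of_summable_norm hc (fun k => by fun_prop) isOpen_ball 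
      (fun k z hz => hGbd k z (ball_subset_closedBall hz))
  have hG0 : G 0 = c 0 := by
    simp only [hG]
    rw [tsum_eq_single 0]
    · simp
    · intro k hk; simp [hk]
  have hGz : ∀ t : ℝ, |t| ≤ δ → G (Complex.exp (t * Complex.I)) = 0 := by
    intro t ht
    rw [← hz t ht]
    simp only [hG]
    congr 1; ext k
    rw [← Complex.exp_nat_mul]
    congr 2
    push_cast; ring
  obtain ⟨J, hJ⟩ := exists_nat_gt (2 * Real.pi / δ)
  set ω : ℕ → ℂ := fun j => -Complex.exp ((-(j * δ) : ℝ) * Complex.I) with hω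
  have hω1 : ∀ j, ‖ω j‖ = 1 := fun j => by
    simp only [hω]
    rw [norm_neg, Complex.norm_exp_ofReal_mul_I]
  set P : ℂ → ℂ := fun z => ∏ j ∈ Finset.range J, G (ω j * z) with hP
  have hPd : DiffContOnCl ℂ P (ball 0 1) := by
    constructor
    · simp only [hP]
      apply DifferentiableOn.fun_finsetProd
      intro j _
      refine hGd.comp (by fun_prop) ?_
      intro z hz
      simpa [hω1] using hz
    · rw [closure_ball _ one_ne_zero]
      apply continuousOn_finsetProd
      intro j _
      refine hGc.comp (by fun_prop) ?_
      intro z hz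
      simpa [hω1] using hz
  have hfr : ∀ z ∈ frontier (ball (0:ℂ) 1), ‖P z‖ ≤ 0 := by
    intro z hz
    rw [frontier_ball _ one_ne_zero, mem_sphere_zero_iff_norm] at hz
    rw [norm_le_zero_iff]
    set θ := z.arg + Real.pi
    have hθ0 : 0 ≤ θ := by have := Complex.neg_pi_lt_arg z; simp only [θ]; linarith
    have hθ2 : θ ≤ 2 * Real.pi := by have := Complex.arg_le_pi z; simp only [θ]; linarith
    have hzθ : z = -Complex.exp (θ * Complex.I) := by
      have h1 := Complex.norm_mul_exp_arg_mul_I z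
      rw [hz] at h1
      simp only [θ]
      push_cast
      rw [add_mul, Complex.exp_add, Complex.exp_pi_mul_I]
      simpa using h1.symm
    apply Finset.prod_eq_zero (i := ⌊θ / δ⌋₊)
    · rw [Finset.mem_range, Nat.floor_lt (by positivity)]
      refine lt_of_le_of_lt ?_ hJ
      gcongr
    · have : ω ⌊θ / δ⌋₊ * z = Complex.exp ((θ - ⌊θ / δ⌋₊ * δ : ℝ) * Complex.I) := by
        rw [hzθ]
        simp only [hω]
        rw [neg_mul_neg, ← Complex.exp_add]
        congr 1
        push_cast; ring
      rw [this]
      apply hGz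
      have h1 := Nat.floor_le (show 0 ≤ θ / δ by positivity)
      have h2 := Nat.lt_floor_add_one (θ / δ)
      rw [le_div_iff₀ hδ] at h1
      rw [div_lt_iff₀ hδ] at h2
      rw [abs_le]
      constructor <;> linarith
  have h0 := Complex.norm_le_of_forall_mem_frontier_norm_le isBounded_ball hPd hfr 
    (subset_closure (mem_ball_self one_pos))
  rw [norm_le_zero_iff] at h0
  simp only [hP, mul_zero, Finset.prod_const, hG0] at h0
  exact eq_zero_of_pow_eq_zero h0

theorem stmt3 (a : ℕ → ℂ) (C : ℝ) (hC : ∀ n, ‖a n‖ ≤ C)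
    (n : ℕ → ℕ) (hn : StrictMono n)
    (hzero : ∀ k : ℤ, k < 0 →
      Tendsto (fun j => a ((n j : ℤ) + k).toNat) atTop (nhds 0))
    (hpos : 0 < Filter.liminf (fun j => ‖a (n j)‖) atTop)
    (f : ℂ → ℂ) (hf : ∀ z ∈ Metric.ball (0 : ℂ) 1, f z = ∑' m : ℕ, a m * z ^ m) :
    StrongNaturalBoundary f := by
  rintro α β hαβ ⟨M, hM⟩
  have hC0 : 0 ≤ C := (norm_nonneg _).trans (hC 0)
  have hM' : ∀ r : ℝ, 0 < r → r < 1 → 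
      (∫ θ in α..β, ‖f (r * Complex.exp (θ * Complex.I))‖) ≤ M * (2 * Real.pi) := fun r h0 h1 =>
    (div_le_iff₀ (by positivity)).mp (hM r h0 h1)
  have raj := rajchman (α := α) (β := β) (LL a) (M * (2 * Real.pi)) (fun ψ φ hψ hφ => by
      unfold LL
      rw [← (LL_summable hC hψ).tsum_add (LL_summable hC hφ)]
      simp_rw [ft_add hψ hφ, mul_add]) (fun c ψ _ => by
      unfold LL
      rw [← tsum_mul_right]
      simp_rw [ft_smul, mul_assoc]) (LL_bound hαβ hC f hf _ hM') (fun ψ hψ => LL_neg hC hψ)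
  -- limits along an ultrafilter
  set L : Ultrafilter ℕ := Filter.hyperfilter ℕ
  have hL : (L : Filter ℕ) ≤ atTop := by
    rw [← Nat.cofinite_eq_atTop]; exact Filter.hyperfilter_le_cofinite
  have hex : ∀ k : ℤ, ∃ bk : ℂ, ‖bk‖ ≤ C ∧ Tendsto (fun j => a ((n j : ℤ) + k).toNat) L (nhds bk) := by
    intro k
    obtain ⟨x, hx, hx2⟩ := isCompact_iff_ultrafilter_le_nhds.mp (isCompact_closedBall (0:ℂ) C)
      (L.map (fun j => a ((n j : ℤ) + k).toNat)) (by
        rw [le_principal_iff]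
        exact Filter.Eventually.of_forall (f := (L : Filter ℕ)) fun j => by simpa using hC _)
    exact ⟨x, by simpa using hx, hx2⟩
  choose b hbC hb using hex
  have hb0 : ∀ k < 0, b k = 0 := fun k hk => tendsto_nhds_unique (hb k) ((hzero k hk).mono_left hL)
  have hnt : Tendsto n L atTop := hn.tendsto_atTop.mono_left hL
  have hzeroψ : ∀ ψ, TT α β ψ → ∑' k : ℕ, b k * ft ψ k = 0 := fun ψ hψ =>
    tendsto_nhds_unique (LL_limit hC hψ n L b hnt hb hb0) ((raj ψ hψ).comp hnt)
  have hbpos : b 0 ≠ 0 := by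
    intro h0
    obtain ⟨c, hc0, hc⟩ := exists_between hpos
    have hev := Filter.eventually_lt_of_lt_liminf hc
      (Filter.isBoundedUnder_of ⟨0, fun j => norm_nonneg _⟩)
    have h1 := (hb 0).norm
    simp only [add_zero, Int.toNat_natCast, h0, norm_zero] at h1
    have := ge_of_tendsto h1 ((hev.filter_mono hL).mono fun _ h => h.le)
    linarith
  -- the bump function
  set δ := (β - α) / 4 with hδ
  have hδ0 : 0 < δ := by simp only [hδ]; linarith
  let B : ContDiffBump ((α + β) / 2) := ⟨δ / 2, δ, by linarith, by linarith⟩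
  have hT : ∀ t : ℝ, |t| ≤ δ → TT α β (fun x => ((B (x - t) : ℝ) : ℂ)) := by
    intro t ht
    refine ⟨Complex.ofRealCLM.contDiff.comp (B.contDiff.comp (contDiff_id.sub contDiff_const)), fun x hx => ?_⟩
    rw [abs_le] at ht
    simp only
    rw [B.zero_of_le_dist, Complex.ofReal_zero]
    show δ ≤ _
    rw [Real.dist_eq]
    by_contra hcon
    push Not at hcon
    rw [abs_lt] at hcon
    apply hx
    constructor <;> linarith [hcon.1, hcon.2, ht.1, ht.2]
  have hT0 : TT α β (fun x => ((B x : ℝ) : ℂ)) := by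
    simpa using hT 0 (by simpa using hδ0.le)
  obtain ⟨K, hK, hbd⟩ := ft_decay hT0
  have hfin := final_zero (fun k : ℕ => b k * ft (fun x => ((B x : ℝ) : ℂ)) k) 
    (Summable.of_nonneg_of_le (fun _ => norm_nonneg _) 
      (fun k => coef_bound (a := fun k : ℕ => b k) (fun k => hbC k) k (hbd k)) (summable_KN (C * K))) δ hδ0 
    (fun t ht => by
      rw [← hzeroψ _ (hT t ht)]
      congr 1; ext k
      rw [ft_translate (fun x => ((B x : ℝ) : ℂ)), mul_assoc])
  have hIntegral : ft (fun x => ((B x : ℝ) : ℂ)) ((0 : ℕ) : ℝ) ≠ 0 := by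
    unfold ft
    simp only [Nat.cast_zero, zero_mul, Complex.ofReal_zero, Complex.exp_zero, mul_one]
    rw [integral_complex_ofReal]
    exact_mod_cast (B.integral_pos (μ := volume)).ne'
  rcases mul_eq_zero.mp hfin with h | h
  · exact hbpos h
  · exact hIntegral h
end

section
/- Let μ be a probability measure on the space of two-sided complex sequences (a_n)_{n∈ℤ} that is invariant and ergodic under the left shift, with sup_{n∈ℤ} |a_n| ≤ K for μ-almost every sequence and some constant K < ∞. Assume the process is nondeterministic: there is no measurable function g from sequences indexed by {n ∈ ℤ : n < 0} to ℂ such that a_0 = g((a_n)_{n<0}) for μ-almost every sequence. Then for μ-almost every sequence (a_n), the function f(z) = Σ_{n=0}^∞ a_n z^n has a strong natural boundary on ∂𝔻. -/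
open Filter Metric Set MeasureTheory

/-- The left shift on two-sided sequences. -/
def leftShift (a : ℤ → ℂ) : ℤ → ℂ := fun n => a (n + 1)



theorem aux_unique (m : ℕ → ℂ) (hm : Summable (fun k => ‖m k‖)) (α β : ℝ) (hαβ : α < β)
    (h : ∀ θ ∈ Ioo α β, ∑' k : ℕ, m k * Complex.exp (k * θ * Complex.I) = 0) : m 0 = 0 := by
  set M : ℂ → ℂ := fun z => ∑' k : ℕ, m k * z ^ k with hM
  have hb : ∀ k, ∀ z ∈ closedBall (0:ℂ) 1, ‖m k * z ^ k‖ ≤ ‖m k‖ := by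
    intro k z hz
    rw [norm_mul, norm_pow]
    have : ‖z‖ ≤ 1 := by simpa using hz
    exact mul_le_of_le_one_right (norm_nonneg _) (pow_le_one₀ (norm_nonneg _) this)
  have hcont : ContinuousOn M (closedBall 0 1) := by
    apply continuousOn_tsum (u := fun k => ‖m k‖) _ hm hb
    intro k; fun_prop
  have hdiff : DifferentiableOn ℂ M (ball 0 1) := by
    apply Complex.differentiableOn_tsum_of_summable_norm hm _ isOpen_ball
      (fun k z hz => hb k z (ball_subset_closedBall hz))
    intro k; fun_prop
  obtain ⟨N, hN⟩ := exists_nat_gt (2 * Real.pi / (β - α))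
  have hba : 0 < β - α := sub_pos.2 hαβ
  have hNpos : (0:ℝ) < N := lt_trans (by positivity) hN
  have hNba : 2 * Real.pi / N < β - α := by
    rw [div_lt_iff₀ hba] at hN
    rw [div_lt_iff₀ hNpos]; linarith
  set ω : ℕ → ℂ := fun j => Complex.exp ((2 * Real.pi * j / N : ℝ) * Complex.I) with hω
  have hωn : ∀ j, ‖ω j‖ = 1 := fun j => Complex.norm_exp_ofReal_mul_I _
  set P : ℂ → ℂ := fun z => ∏ j ∈ Finset.range N, M (ω j * z) with hP
  have hmap : ∀ j, MapsTo (fun z => ω j * z) (closedBall (0:ℂ) 1) (closedBall 0 1) := by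
    intro j z hz
    simpa [hωn] using hz
  have hmap' : ∀ j, MapsTo (fun z => ω j * z) (ball (0:ℂ) 1) (ball 0 1) := by
    intro j z hz
    simpa [hωn] using hz
  have hPc : ContinuousOn P (closedBall 0 1) := by
    apply continuousOn_finsetProd
    intro j _
    exact hcont.comp (by fun_prop) (hmap j)
  have hPd : DifferentiableOn ℂ P (ball 0 1) := by
    apply DifferentiableOn.fun_finsetProd
    intro j _
    exact hdiff.comp (by fun_prop) (hmap' j)
  have hP0 : ∀ z ∈ sphere (0:ℂ) 1, P z = 0 := by
    intro z hz
    have hz1 : ‖z‖ = 1 := by simpa using hz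
    have hzarg : z = Complex.exp (Complex.arg z * Complex.I) := by
      have := Complex.norm_mul_exp_arg_mul_I z
      rw [hz1] at this; simpa using this.symm
    -- find integer l
    set t := Complex.arg z
    set s := 2 * Real.pi / N with hs
    have hspos : 0 < s := by positivity
    set l : ℤ := ⌊(α - t) / s⌋ + 1 with hl
    have h1 : α < t + l * s := by
      have := Int.lt_floor_add_one ((α - t) / s)
      rw [div_lt_iff₀ hspos] at this
      push_cast [hl]; linarith
    have h2 : t + l * s < β := by
      have := Int.floor_le ((α - t) / s)
      rw [le_div_iff₀ hspos] at this
      push_cast [hl]; linarith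
    have hNz : (0:ℤ) < N := by exact_mod_cast hNpos
    have hmod := Int.emod_nonneg l hNz.ne'
    have hmod2 := Int.emod_lt_of_pos l hNz
    apply Finset.prod_eq_zero (i := (l % N).toNat)
    · simp; omega
    · have := h (t + l * s) ⟨h1, h2⟩
      rw [← this, hM]
      have key : ω (l % N).toNat * z = Complex.exp ((t + l * s : ℝ) * Complex.I) := by
        rw [hzarg, hω]
        simp only
        rw [← Complex.exp_add, Complex.exp_eq_exp_iff_exists_int]
        refine ⟨-(l / N), ?_⟩
        have e1 : (((l % N).toNat : ℕ) : ℂ) = (l:ℂ) - N * ((l / N : ℤ) : ℂ) := by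
          have : (((l % N).toNat : ℕ) : ℤ) = l - N * (l / N) := by
            rw [Int.toNat_of_nonneg hmod]; have := Int.emod_add_mul_ediv l N; linarith
          exact_mod_cast this
        have hNc : (N:ℂ) ≠ 0 := by exact_mod_cast hNpos.ne'
        push_cast
        rw [e1]
        push_cast [hs]
        field_simp
        ring
      simp only [key]
      apply tsum_congr
      intro k
      rw [← Complex.exp_nat_mul, mul_assoc]
  have hPz : P 0 = 0 := by
    have hd : DiffContOnCl ℂ P (ball 0 1) :=
      ⟨hPd, by rw [closure_ball _ one_ne_zero]; exact hPc⟩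
    have := Complex.norm_le_of_forall_mem_frontier_norm_le (C := 0) isBounded_ball hd
      (fun z hz => by
        rw [frontier_ball _ one_ne_zero] at hz; simp [hP0 z hz]) (z := 0)
        (subset_closure (by simp))
    simpa using this
  have hM0 : M 0 = m 0 := by
    simp only [hM]
    rw [tsum_eq_single 0]
    · simp
    · intro k hk; simp [hk]
  simp only [hP, mul_zero, hM0, Finset.prod_const] at hPz
  by_contra hne
  exact pow_ne_zero _ hne hPz

theorem aux_bump (δ : ℝ) (hδ : 0 < δ) :
    ∃ τ : ℤ → ℂ, Summable (fun k => ‖τ k‖) ∧ τ 0 ≠ 0 ∧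
      ∀ θ : ℝ, δ ≤ θ → θ ≤ 2 * Real.pi - δ →
        ∑' k : ℤ, τ k * Complex.exp (k * θ * Complex.I) = 0 := by
  have hpi := Real.pi_pos
  have hB : ∀ x ∈ Icc (0:ℝ) 1, HasSum (fun n : ℕ => 1 / (n : ℝ) ^ 2 * Real.cos (2 * Real.pi * n * x))
      (Real.pi ^ 2 * (x ^ 2 - x + 1/6)) := by
    intro x hx
    convert! hasSum_one_div_nat_pow_mul_cos one_ne_zero hx using 1
    have : (Polynomial.map (algebraMap ℚ ℝ) (Polynomial.bernoulli (2 * 1))).eval x = x ^ 2 - x + 1/6 := by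
      simp [Polynomial.bernoulli, Finset.sum_range_succ, bernoulli_eq_bernoulli'_of_ne_one, bernoulli_one,
        bernoulli'_two, Polynomial.eval_add]
      ring
    rw [this]
    simp [Nat.factorial]
    left
    ring
  set ε := δ / (2 * Real.pi) with hε
  have hεpos : 0 < ε := by positivity
  set τ : ℤ → ℝ := fun k => if k = 0 then 2 * Real.pi ^ 2 * ε ^ 2 else
    (1 - Real.cos (2 * Real.pi * k * ε)) / (k:ℝ) ^ 2 with hτ
  have hsum : Summable (fun k => ‖τ k‖) := by
    have h2 : Summable (fun k : ℤ => 2 * (1 / |(k:ℝ)| ^ 2) + if k = 0 then 2 * Real.pi ^ 2 * ε ^ 2 else 0) := by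
      apply Summable.add
      · apply Summable.mul_left
        have := (Real.summable_one_div_int_pow (p := 2)).2 (by norm_num)
        simpa using this
      · apply summable_of_ne_finset_zero (s := {0})
        intro b hb; simp at hb; simp [hb]
    refine Summable.of_nonneg_of_le (fun _ => norm_nonneg _) (fun k => ?_) h2
    by_cases hk : k = 0
    · simp [hτ, hk, abs_of_nonneg (show 0 ≤ ε from hεpos.le)]
      
    · simp only [hτ, hk, if_false, norm_div, norm_pow, Real.norm_eq_abs, add_zero]
      rw [mul_one_div]
      gcongr
      rw [abs_le]
      constructor <;> linarith [Real.cos_le_one (2 * Real.pi * k * ε), Real.neg_one_le_cos (2 * Real.pi * k * ε)]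
  refine ⟨fun k => (τ k : ℂ), by simpa using hsum, ?_, ?_⟩
  · simp [hτ, hεpos.ne', hpi.ne']
  intro θ h1 h2
  set x := θ / (2 * Real.pi) with hx
  have hθ : θ = 2 * Real.pi * x := by rw [hx]; field_simp
  have hδx : δ = 2 * Real.pi * ε := by rw [hε]; field_simp
  have hx1 : ε ≤ x := by rw [hε, hx]; gcongr
  have hx2 : x ≤ 1 - ε := by
    have : x * (2 * Real.pi) ≤ (1 - ε) * (2 * Real.pi) := by
      rw [hθ, hδx] at h2; linarith
    exact le_of_mul_le_mul_right this (by positivity)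
  set f : ℤ → ℂ := fun k => (τ k : ℂ) * Complex.exp (k * θ * Complex.I) with hf
  have hfs : Summable f := by
    apply Summable.of_norm
    convert! hsum using 2 with k
    rw [hf]
    simp only [norm_mul]
    have : ‖Complex.exp (k * θ * Complex.I)‖ = 1 := by
      have := Complex.norm_exp_ofReal_mul_I (k * θ)
      push_cast at this; exact this
    rw [this]; simp
  have hs1 := hfs.hasSum.nat_add_neg
  have hc : ∀ n : ℕ, f n + f (-n) = ((2 * (1 / (n : ℝ) ^ 2 * Real.cos (2 * Real.pi * n * x))
      - (1 / (n : ℝ) ^ 2 * Real.cos (2 * Real.pi * n * (x + ε)))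
      - (1 / (n : ℝ) ^ 2 * Real.cos (2 * Real.pi * n * (x - ε)))
      + if n = 0 then 4 * Real.pi ^ 2 * ε ^ 2 else 0 : ℝ) : ℂ) := by
    intro n
    have hev : τ (-n) = τ n := by simp [hτ]
    have : f n + f (-n) = ((2 * τ n * Real.cos (2 * Real.pi * n * x) : ℝ) : ℂ) := by
      simp only [hf, hev]
      push_cast
      rw [Complex.cos, hθ]
      push_cast
      rw [← mul_add]
      ring_nf
    rw [this]
    congr 1
    by_cases hn : n = 0
    · simp [hn, hτ]; ring
    · simp only [hτ, hn, Nat.cast_eq_zero, if_false]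
      rw [mul_add, mul_sub, Real.cos_add, Real.cos_sub]
      push_cast
      ring
  simp only [hc] at hs1
  have hs2 : HasSum (fun n : ℕ => (2 * (1 / (n : ℝ) ^ 2 * Real.cos (2 * Real.pi * n * x))
      - (1 / (n : ℝ) ^ 2 * Real.cos (2 * Real.pi * n * (x + ε)))
      - (1 / (n : ℝ) ^ 2 * Real.cos (2 * Real.pi * n * (x - ε)))
      + if n = 0 then 4 * Real.pi ^ 2 * ε ^ 2 else 0 : ℝ))
      (2 * (Real.pi ^ 2 * (x ^ 2 - x + 1/6)) - (Real.pi ^ 2 * ((x+ε) ^ 2 - (x+ε) + 1/6))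
        - (Real.pi ^ 2 * ((x-ε) ^ 2 - (x-ε) + 1/6)) + 4 * Real.pi ^ 2 * ε ^ 2) := by
    refine ((((hB x ⟨by linarith, by linarith⟩).mul_left 2).sub (hB (x+ε) ⟨by linarith, by linarith⟩)).sub
      (hB (x-ε) ⟨by linarith, by linarith⟩)).add ?_
    exact hasSum_ite_eq 0 _
  have hs3 := (Complex.hasSum_ofReal.2 hs2).unique hs1
  have hf0 : f 0 = ((2 * Real.pi ^ 2 * ε ^ 2 : ℝ) : ℂ) := by simp [hf, hτ]
  have : ∑' k, f k = (((2 * (Real.pi ^ 2 * (x ^ 2 - x + 1/6)) - (Real.pi ^ 2 * ((x+ε) ^ 2 - (x+ε) + 1/6))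
        - (Real.pi ^ 2 * ((x-ε) ^ 2 - (x-ε) + 1/6)) + 4 * Real.pi ^ 2 * ε ^ 2) : ℝ) : ℂ) - f 0 := by
    rw [hs3]; ring
  rw [this, hf0, ← Complex.ofReal_sub]
  norm_cast
  ring

theorem aux_real {X : Type*} [TopologicalSpace X] [CompactSpace X]
    (Λ : C(X, ℂ) →L[ℂ] ℂ) (p : C(X, ℂ)) (hp : ‖p‖ ≤ 1) (ε t : ℝ) (ht : 0 < t)
    (hΛ : ‖Λ‖ - ε ≤ (Λ p).re) (q : C(X, ℂ)) (hq : ‖q‖ ≤ 1) (hqr : ∀ x, (q x).im = 0) :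
    -(Λ (p * q)).im ≤ ε / t + ‖Λ‖ * t / 2 := by
  have h1 : ‖p + (Complex.I * t) • (p * q)‖ ≤ 1 + t ^ 2 / 2 := by
    rw [ContinuousMap.norm_le _ (by positivity)]
    intro x
    have hpx : ‖p x‖ ≤ 1 := (p.norm_coe_le_norm x).trans hp
    have hqx : ‖q x‖ ≤ 1 := (q.norm_coe_le_norm x).trans hq
    have hqre : q x = ((q x).re : ℂ) := by
      apply Complex.ext <;> simp [hqr]
    have e : (p + (Complex.I * t) • (p * q)) x = p x * (1 + ((t * (q x).re : ℝ) : ℂ) * Complex.I) := by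
      simp only [ContinuousMap.add_apply, ContinuousMap.smul_apply, ContinuousMap.mul_apply, smul_eq_mul]
      rw [hqre]; push_cast; simp; ring
    rw [e, norm_mul]
    have h2 : ‖(1 + ((t * (q x).re : ℝ) : ℂ) * Complex.I)‖ ≤ 1 + t ^ 2 / 2 := by
      rw [← Complex.ofReal_one, Complex.norm_add_mul_I]
      rw [Real.sqrt_le_left (by positivity)]
      have : (q x).re ^ 2 ≤ 1 := by
        rw [sq_le_one_iff_abs_le_one]
        exact (Complex.abs_re_le_norm _).trans hqx
      nlinarith [mul_le_mul_of_nonneg_left this (sq_nonneg t), sq_nonneg (t^2)]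
    calc ‖p x‖ * _ ≤ 1 * (1 + t ^ 2 / 2) := by gcongr
      _ = _ := one_mul _
  have h2 : (Λ (p + (Complex.I * t) • (p * q))).re ≤ ‖Λ‖ * (1 + t ^ 2 / 2) :=
    (Complex.re_le_norm _).trans (Λ.le_opNorm_of_le h1)
  simp only [map_add, map_smul, smul_eq_mul, Complex.add_re, Complex.mul_re, Complex.mul_im, Complex.I_re,
    Complex.I_im, Complex.ofReal_re, Complex.ofReal_im] at h2
  have h3 : t * (-(Λ (p * q)).im) ≤ ε + ‖Λ‖ * t ^ 2 / 2 := by nlinarith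
  have h4 : ε / t + ‖Λ‖ * t / 2 = (ε + ‖Λ‖ * t ^ 2 / 2) / t := by field_simp
  rw [h4, le_div_iff₀ ht]; linarith

theorem aux_herm {X : Type*} [TopologicalSpace X] [CompactSpace X]
    (Λ : C(X, ℂ) →L[ℂ] ℂ) (p : C(X, ℂ)) (hp : ‖p‖ ≤ 1) (ε t : ℝ) (ht : 0 < t)
    (hΛ : ‖Λ‖ - ε ≤ (Λ p).re) (q : C(X, ℂ)) (hq : ‖q‖ ≤ 1) :
    ‖Λ (p * star q)‖ ≤ ‖Λ (p * q)‖ + 4 * (ε / t + ‖Λ‖ * t / 2) := by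
  set η := ε / t + ‖Λ‖ * t / 2
  have hr : ∀ u : C(X, ℂ), ‖u‖ ≤ 1 → (∀ x, (u x).im = 0) → |(Λ (p * u)).im| ≤ η := by
    intro u hu hur
    have h1 := aux_real Λ p hp ε t ht hΛ u hu hur
    have h2 := aux_real Λ p hp ε t ht hΛ (-u) (by simpa using hu) (by simpa using hur)
    rw [abs_le]
    simp only [mul_neg, map_neg, Complex.neg_im, neg_neg] at h2
    change _ ≤ η at h1
    change _ ≤ η at h2
    constructor <;> linarith
  set u : C(X, ℂ) := ⟨fun x => ((q x).re : ℂ), by fun_prop⟩ with hu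
  set v : C(X, ℂ) := ⟨fun x => ((q x).im : ℂ), by fun_prop⟩ with hv
  have hqx : ∀ x, ‖q x‖ ≤ 1 := fun x => (q.norm_coe_le_norm x).trans hq
  have hun : ‖u‖ ≤ 1 := by
    rw [ContinuousMap.norm_le _ zero_le_one]
    intro x; simp only [hu, ContinuousMap.coe_mk, Complex.norm_real]
    exact (Complex.abs_re_le_norm _).trans (hqx x)
  have hvn : ‖v‖ ≤ 1 := by
    rw [ContinuousMap.norm_le _ zero_le_one]
    intro x; simp only [hv, ContinuousMap.coe_mk, Complex.norm_real]
    exact (Complex.abs_im_le_norm _).trans (hqx x)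
  have e1 : p * q = p * u + Complex.I • (p * v) := by
    ext x
    simp only [ContinuousMap.add_apply, ContinuousMap.smul_apply, ContinuousMap.mul_apply, smul_eq_mul, hu, hv,
      ContinuousMap.coe_mk]
    conv_lhs => rw [← Complex.re_add_im (q x)]
    ring
  have e2 : p * star q = p * u - Complex.I • (p * v) := by
    ext x
    simp only [ContinuousMap.sub_apply, ContinuousMap.smul_apply, ContinuousMap.mul_apply, smul_eq_mul, hu, hv,
      ContinuousMap.coe_mk, ContinuousMap.star_apply]
    conv_lhs => rw [← Complex.re_add_im (q x)]
    rw [RCLike.star_def]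
    simp only [map_add, map_mul, Complex.conj_ofReal, Complex.conj_I]
    ring
  have e3 : Λ (p * star q) = (starRingEnd ℂ) (Λ (p * q)) + (2 * ((Λ (p * u)).im : ℂ) * Complex.I
      + 2 * ((Λ (p * v)).im : ℂ)) := by
    rw [e1, e2]
    apply Complex.ext <;> simp <;> ring
  rw [e3]
  refine (norm_add_le _ _).trans ?_
  rw [Complex.norm_conj]
  have h1 := hr u hun (by simp [hu])
  have h2 := hr v hvn (by simp [hv])
  have : ‖2 * ((Λ (p * u)).im : ℂ) * Complex.I + 2 * ((Λ (p * v)).im : ℂ)‖ ≤ 4 * η := by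
    refine (norm_add_le _ _).trans ?_
    simp only [norm_mul, Complex.norm_I, Complex.norm_real, Real.norm_eq_abs, Complex.norm_ofNat]
    linarith
  linarith

theorem aux_abs {X : Type*} [TopologicalSpace X] [CompactSpace X]
    (Λ : C(X, ℂ) →L[ℂ] ℂ) (p : C(X, ℂ)) (hp : ‖p‖ ≤ 1) (ε : ℝ)
    (hΛ : ‖Λ‖ - ε ≤ (Λ p).re) (q : C(X, ℂ)) (hq : ‖q‖ ≤ 1) :
    ‖Λ q‖ ≤ ‖Λ (p * (star p * q))‖ + 2 * ε := by
  have key : ∀ c : ℂ, ‖c‖ = 1 → (c * Λ (q - p * (star p * q))).re ≤ 2 * ε := by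
    intro c hc
    have h1 : ‖p + (c / 2) • (q - p * (star p * q))‖ ≤ 1 := by
      rw [ContinuousMap.norm_le _ zero_le_one]
      intro x
      have hpx : ‖p x‖ ≤ 1 := (p.norm_coe_le_norm x).trans hp
      have hqx : ‖q x‖ ≤ 1 := (q.norm_coe_le_norm x).trans hq
      have e : (p + (c / 2) • (q - p * (star p * q))) x =
          p x + (c / 2) * (((1 - ‖p x‖ ^ 2 : ℝ) : ℂ) * q x) := by
        simp only [ContinuousMap.add_apply, ContinuousMap.smul_apply, ContinuousMap.mul_apply,
          ContinuousMap.sub_apply, ContinuousMap.star_apply, smul_eq_mul]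
        have := Complex.mul_conj' (p x)
        push_cast
        rw [← this, RCLike.star_def]
        ring
      rw [e]
      refine (norm_add_le _ _).trans ?_
      have hnn : 0 ≤ 1 - ‖p x‖ ^ 2 := by nlinarith [norm_nonneg (p x)]
      rw [norm_mul, norm_mul, norm_div, hc, Complex.norm_real, Real.norm_of_nonneg hnn]
      simp only [Complex.norm_ofNat]
      nlinarith [mul_le_mul_of_nonneg_left hqx hnn, norm_nonneg (p x)]
    have h2 : (Λ (p + (c / 2) • (q - p * (star p * q)))).re ≤ ‖Λ‖ * 1 :=
      (Complex.re_le_norm _).trans (Λ.le_opNorm_of_le h1)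
    rw [map_add, map_smul, Complex.add_re, smul_eq_mul] at h2
    have h3 : (c / 2 * Λ (q - p * (star p * q))).re = (c * Λ (q - p * (star p * q))).re / 2 := by
      rw [div_mul_eq_mul_div]; simp
    rw [h3] at h2
    linarith
  have h4 : ‖Λ (q - p * (star p * q))‖ ≤ 2 * ε := by
    set w := Λ (q - p * (star p * q))
    by_cases hw : w = 0
    · have := key 1 (by simp)
      simpa [hw] using this
    · have hwn : (‖w‖:ℂ) ≠ 0 := by simpa using hw
      have := key ((starRingEnd ℂ) w / ‖w‖) (by
        rw [norm_div, Complex.norm_conj]; simp [hw])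
      rw [div_mul_eq_mul_div, Complex.conj_mul', sq, mul_div_assoc, div_self hwn, mul_one,
        Complex.ofReal_re] at this
      exact this
  have h5 : Λ q = Λ (p * (star p * q)) + Λ (q - p * (star p * q)) := by
    rw [← map_add]; congr 1; abel
  rw [h5]
  exact (norm_add_le _ _).trans (by linarith)

theorem aux_near {X : Type*} [TopologicalSpace X] [CompactSpace X]
    (Λ : C(X, ℂ) →L[ℂ] ℂ) (ε : ℝ) (hε : 0 < ε) :
    ∃ p : C(X, ℂ), ‖p‖ ≤ 1 ∧ ‖Λ‖ - ε ≤ (Λ p).re := by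
  by_cases h0 : ‖Λ‖ - ε < 0
  · exact ⟨0, by simp, by simpa using h0.le⟩
  push Not at h0
  obtain ⟨x, hx1, hx⟩ := Λ.exists_lt_apply_of_lt_opNorm (r := ‖Λ‖ - ε) (by linarith)
  set w := Λ x
  have hw : w ≠ 0 := by
    intro h; rw [h, norm_zero] at hx; linarith
  have hwn : (‖w‖:ℂ) ≠ 0 := by simpa using hw
  refine ⟨((starRingEnd ℂ) w / ‖w‖) • x, ?_, ?_⟩
  · rw [norm_smul, norm_div, Complex.norm_conj]; simp [hw, hx1.le]
  · rw [map_smul, smul_eq_mul, div_mul_eq_mul_div, Complex.conj_mul', sq, mul_div_assoc, div_self hwn, mul_one,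
        Complex.ofReal_re]
    exact hx.le

theorem aux_mul_tendsto {T : ℝ} [Fact (0 < T)] (Λ : C(AddCircle T, ℂ) →L[ℂ] ℂ)
    (h : Tendsto (fun n : ℕ => Λ (fourier (n:ℤ))) atTop (nhds 0)) (P : C(AddCircle T, ℂ)) :
    Tendsto (fun n : ℕ => Λ (P * fourier (n:ℤ))) atTop (nhds 0) := by
  have hspan : ∀ Q ∈ Submodule.span ℂ (range (@fourier T)),
      Tendsto (fun n : ℕ => Λ (Q * fourier (n:ℤ))) atTop (nhds 0) := by
    intro Q hQ
    induction hQ using Submodule.span_induction with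
    | mem x hx =>
      obtain ⟨m, rfl⟩ := hx
      have h1 : ∀ᶠ n : ℕ in atTop, Λ (fourier ((((n:ℤ) + m).toNat : ℕ) : ℤ)) = Λ (fourier m * fourier (n:ℤ)) := by
        filter_upwards [eventually_ge_atTop m.natAbs] with n hn
        congr 1
        rw [Int.toNat_of_nonneg (by omega)]
        ext x
        rw [ContinuousMap.mul_apply, add_comm, fourier_add]
      refine Tendsto.congr' h1 (h.comp (f := fun n : ℕ => ((n:ℤ) + m).toNat) ?_)
      rw [Filter.tendsto_atTop]
      intro b
      filter_upwards [eventually_ge_atTop (b + m.natAbs)] with n hn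
      omega
    | zero => simp
    | add x y _ _ hx hy =>
      simpa [add_mul] using hx.add hy
    | smul c x _ hx =>
      simpa using hx.const_mul c
  have hP : P ∈ closure (Submodule.span ℂ (range (@fourier T)) : Set C(AddCircle T, ℂ)) := by
    rw [← Submodule.topologicalClosure_coe, span_fourier_closure_eq_top]; trivial
  rw [Metric.tendsto_atTop]
  intro e he
  obtain ⟨Q, hQ, hPQ⟩ := Metric.mem_closure_iff.1 hP (e / (2 * (‖Λ‖ + 1))) (by positivity)
  obtain ⟨N, hN⟩ := Metric.tendsto_atTop.1 (hspan Q hQ) (e/2) (by positivity)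
  refine ⟨N, fun n hn => ?_⟩
  have h1 := hN n hn
  rw [dist_zero_right] at h1 ⊢
  have h2 : Λ (P * fourier (n:ℤ)) = Λ ((P - Q) * fourier (n:ℤ)) + Λ (Q * fourier (n:ℤ)) := by
    rw [← map_add]; congr 1; ring
  rw [h2]
  have h3 : ‖(P - Q) * fourier (n:ℤ)‖ ≤ e / (2 * (‖Λ‖ + 1)) := by
    refine (norm_mul_le _ _).trans ?_
    rw [fourier_norm, mul_one, ← dist_eq_norm]; exact hPQ.le
  have h4 := Λ.le_opNorm_of_le h3
  have h5 : ‖Λ‖ * (e / (2 * (‖Λ‖ + 1))) ≤ e / 2 := by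
    have : ‖Λ‖ * (e / (2 * (‖Λ‖ + 1))) = (e / 2) * (‖Λ‖ / (‖Λ‖ + 1)) := by field_simp
    rw [this]
    have : ‖Λ‖ / (‖Λ‖ + 1) ≤ 1 := by
      rw [div_le_one (by positivity)]; linarith
    nlinarith
  exact lt_of_le_of_lt (norm_add_le _ _) (by linarith)

theorem aux_rajchman {T : ℝ} [Fact (0 < T)] (Λ : C(AddCircle T, ℂ) →L[ℂ] ℂ)
    (h : Tendsto (fun n : ℕ => Λ (fourier (n:ℤ))) atTop (nhds 0)) :
    Tendsto (fun n : ℕ => Λ (fourier (-(n:ℤ)))) atTop (nhds 0) := by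
  rw [Metric.tendsto_atTop]
  intro e he
  set t := e / (8 * (‖Λ‖ + 1)) with ht
  have htpos : 0 < t := by positivity
  set ε := min (e * t / 16) (e / 16) with hε
  have hεpos : 0 < ε := by positivity
  obtain ⟨p, hp, hpΛ⟩ := aux_near Λ ε hεpos
  obtain ⟨N, hN⟩ := Metric.tendsto_atTop.1 (aux_mul_tendsto Λ h (p * p)) (e/4) (by positivity)
  refine ⟨N, fun n hn => ?_⟩
  have h0 := hN n hn
  rw [dist_zero_right] at h0 ⊢
  have h1 := aux_abs Λ p hp ε hpΛ (fourier (-(n:ℤ))) (fourier_norm _).le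
  have h2 := aux_herm Λ p hp ε t htpos hpΛ (p * fourier (n:ℤ)) (by
    refine (norm_mul_le _ _).trans ?_
    rw [fourier_norm, mul_one]; exact hp)
  have h3 : p * star (p * fourier (n:ℤ)) = p * (star p * fourier (-(n:ℤ))) := by
    ext x
    simp only [ContinuousMap.mul_apply, ContinuousMap.star_apply, fourier_neg, star_mul']
    rfl
  rw [h3, ← mul_assoc] at h2
  have h4 : ε / t ≤ e / 16 := by
    rw [div_le_iff₀ htpos]
    refine (min_le_left _ _).trans (by linarith)
  have h5 : ‖Λ‖ * t / 2 ≤ e / 16 := by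
    have : ‖Λ‖ * t / 2 = (e / 16) * (‖Λ‖ / (‖Λ‖ + 1)) := by rw [ht]; field_simp; ring
    rw [this]
    have : ‖Λ‖ / (‖Λ‖ + 1) ≤ 1 := by
      rw [div_le_one (by positivity)]; linarith
    nlinarith
  have h6 : ε ≤ e / 16 := min_le_right _ _
  rw [← mul_assoc] at h1 h2
  linarith

theorem aux_norm_exp (k : ℤ) (θ : ℝ) : ‖Complex.exp (k * θ * Complex.I)‖ = 1 := by
  have := Complex.norm_exp_ofReal_mul_I (k * θ)
  push_cast at this; exact this

theorem aux_orth (c : ℝ) (l : ℤ) :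
    ∫ θ in (c - Real.pi)..(c + Real.pi), Complex.exp (l * θ * Complex.I) =
      if l = 0 then 2 * (Real.pi : ℂ) else 0 := by
  split_ifs with h
  · subst h; simp; ring
  · have hl : (l : ℂ) * Complex.I ≠ 0 := by simp [h]
    have := integral_exp_mul_complex (a := c - Real.pi) (b := c + Real.pi) hl
    have e : ∀ θ : ℝ, Complex.exp (l * θ * Complex.I) = Complex.exp (l * Complex.I * θ) := by
      intro θ; ring_nf
    simp only [e]
    rw [this, div_eq_zero_iff]
    left
    rw [sub_eq_zero, Complex.exp_eq_exp_iff_exists_int]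
    exact ⟨l, by push_cast; ring⟩

theorem aux_hasSum_integral {ι : Type*} [Countable ι] (F : ι → ℝ → ℂ) (u : ι → ℝ) (hu : Summable u)
    (hF : ∀ i, Continuous (F i)) (hb : ∀ i t, ‖F i t‖ ≤ u i) (a b : ℝ) :
    HasSum (fun i => ∫ t in a..b, F i t) (∫ t in a..b, ∑' i, F i t) := by
  apply intervalIntegral.hasSum_integral_of_dominated_convergence (fun i _ => u i)
  · intro i; exact (hF i).aestronglyMeasurable
  · intro i; exact Eventually.of_forall (fun t _ => hb i t)
  · exact Eventually.of_forall (fun t _ => hu)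
  · simp
  · refine Eventually.of_forall (fun t _ => ?_)
    exact (Summable.of_norm_bounded hu (fun i => hb i t)).hasSum

theorem aux_coef (w : ℤ → ℂ) (hw : Summable (fun k => ‖w k‖)) (c : ℝ) (j : ℤ) :
    ∫ θ in (c - Real.pi)..(c + Real.pi),
      (∑' k : ℤ, w k * Complex.exp (-(k * θ * Complex.I))) * Complex.exp (j * θ * Complex.I) =
      2 * Real.pi * w j := by
  have e : ∀ (k : ℤ) (θ : ℝ), w k * Complex.exp (-(k * θ * Complex.I)) * Complex.exp (j * θ * Complex.I)
      = w k * Complex.exp (((j - k : ℤ) : ℂ) * θ * Complex.I) := by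
    intro k θ
    rw [mul_assoc, ← Complex.exp_add]; congr 2; push_cast; ring
  simp only [← tsum_mul_right, e]
  have := aux_hasSum_integral (fun (k : ℤ) (θ : ℝ) => w k * Complex.exp (((j - k : ℤ) : ℂ) * θ * Complex.I))
    (fun k => ‖w k‖) hw (fun k => by fun_prop) (fun k t => by rw [norm_mul, aux_norm_exp, mul_one])
    (c - Real.pi) (c + Real.pi)
  rw [← this.tsum_eq]
  simp only [intervalIntegral.integral_const_mul, aux_orth]
  rw [tsum_eq_single j]
  · simp; ring
  · intro k hk
    rw [if_neg (by omega)]; simp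

theorem aux_core (a : ℕ → ℂ) (K : ℝ) (ha : ∀ n, ‖a n‖ ≤ K) (w : ℤ → ℂ)
    (hw : Summable (fun k => ‖w k‖)) (α β c M : ℝ) (h1 : c - Real.pi ≤ α) (h2 : α ≤ β)
    (h3 : β ≤ c + Real.pi)
    (hψ : ∀ θ : ℝ, (c - Real.pi ≤ θ ∧ θ ≤ α) ∨ (β ≤ θ ∧ θ ≤ c + Real.pi) →
      ∑' k : ℤ, w k * Complex.exp (-(k * θ * Complex.I)) = 0)
    (hM : ∀ r : ℝ, 0 < r → r < 1 →
      ∫ θ in α..β, ‖∑' m : ℕ, a m * (r * Complex.exp (θ * Complex.I)) ^ m‖ ≤ M) :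
    Tendsto (fun N : ℕ => ∑' n : ℕ, a n * w (n - N)) atTop (nhds 0) := by
  have : Fact (0 < 2 * Real.pi) := ⟨Real.two_pi_pos⟩
  have hK : 0 ≤ K := (norm_nonneg _).trans (ha 0)
  have hwn : ∀ m : ℤ, Summable (fun n : ℕ => ‖w (n + m)‖) := fun m =>
    hw.comp_injective (i := fun n : ℕ => (n:ℤ) + m) (fun x y h => by simpa using h)
  set ψ : ℝ → ℂ := fun θ => ∑' k : ℤ, w k * Complex.exp (-(k * θ * Complex.I)) with hψdef
  have hnb : ∀ (k : ℤ) (θ : ℝ), ‖w k * Complex.exp (-(k * θ * Complex.I))‖ = ‖w k‖ := by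
    intro k θ
    have := aux_norm_exp (-k) θ
    rw [norm_mul]
    push_cast at this
    rw [neg_mul, neg_mul] at this
    rw [this, mul_one]
  have hψc : Continuous ψ := by
    apply continuous_tsum _ hw (fun k θ => (hnb k θ).le)
    intro k; fun_prop
  set B := ∑' k, ‖w k‖ with hB
  have hψB : ∀ θ, ‖ψ θ‖ ≤ B := by
    intro θ
    have := norm_tsum_le_tsum_norm (f := fun k : ℤ => w k * Complex.exp (-(k * θ * Complex.I)))
      (by simpa only [hnb] using hw)
    simpa only [hnb] using this
  have hB0 : 0 ≤ B := (norm_nonneg _).trans (hψB 0)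
  set F : ℝ → ℝ → ℂ := fun r θ => ∑' m : ℕ, a m * (r * Complex.exp (θ * Complex.I)) ^ m with hF
  have hFb : ∀ r : ℝ, 0 < r → ∀ (m : ℕ) (θ : ℝ), ‖a m * (r * Complex.exp (θ * Complex.I)) ^ m‖ ≤ K * r ^ m := by
    intro r hr m θ
    rw [norm_mul, norm_pow, norm_mul, Complex.norm_exp_ofReal_mul_I, mul_one, Complex.norm_real,
      Real.norm_of_nonneg hr.le]
    gcongr; exact ha m
  have hgeo : ∀ r : ℝ, 0 < r → r < 1 → Summable (fun m : ℕ => K * r ^ m) := fun r hr hr1 =>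
    (summable_geometric_of_lt_one hr.le hr1).mul_left K
  have hFc : ∀ r : ℝ, 0 < r → r < 1 → Continuous (F r) := by
    intro r hr hr1
    apply continuous_tsum _ (hgeo r hr hr1) (hFb r hr)
    intro k; fun_prop
  -- reduction of the integral to the arc
  have hred : ∀ r : ℝ, 0 < r → r < 1 → ∀ p : C(AddCircle (2 * Real.pi), ℂ),
      ‖∫ θ in (c - Real.pi)..(c + Real.pi), ψ θ * p θ * F r θ‖ ≤ B * M * ‖p‖ := by
    intro r hr hr1 p
    have hcont : Continuous (fun θ : ℝ => ψ θ * p θ * F r θ) :=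
      (hψc.mul (p.continuous.comp (AddCircle.continuous_mk' _))).mul (hFc r hr hr1)
    have hz1 : ∫ θ in (c - Real.pi)..α, ψ θ * p θ * F r θ = 0 := by
      rw [intervalIntegral.integral_congr (g := fun _ => 0), intervalIntegral.integral_zero]
      intro θ hθ
      rw [uIcc_of_le h1] at hθ
      simp only
      have h0 : ψ θ = 0 := hψ θ (Or.inl hθ)
      rw [h0]; simp
    have hz2 : ∫ θ in β..(c + Real.pi), ψ θ * p θ * F r θ = 0 := by
      rw [intervalIntegral.integral_congr (g := fun _ => 0), intervalIntegral.integral_zero]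
      intro θ hθ
      rw [uIcc_of_le h3] at hθ
      simp only
      have h0 : ψ θ = 0 := hψ θ (Or.inr hθ)
      rw [h0]; simp
    rw [← intervalIntegral.integral_add_adjacent_intervals (b := α) (hcont.intervalIntegrable _ _)
      (hcont.intervalIntegrable _ _), hz1, zero_add,
      ← intervalIntegral.integral_add_adjacent_intervals (b := β) (hcont.intervalIntegrable _ _)
      (hcont.intervalIntegrable _ _), hz2, add_zero]
    calc ‖∫ θ in α..β, ψ θ * p θ * F r θ‖ ≤ ∫ θ in α..β, (B * ‖p‖) * ‖F r θ‖ := by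
          refine (intervalIntegral.norm_integral_le_integral_norm h2).trans ?_
          apply intervalIntegral.integral_mono_on h2 (hcont.norm.intervalIntegrable _ _)
            ((continuous_const.mul (hFc r hr hr1).norm).intervalIntegrable _ _)
          intro θ _
          change ‖ψ θ * p θ * F r θ‖ ≤ (B * ‖p‖) * ‖F r θ‖
          rw [norm_mul, norm_mul]
          exact mul_le_mul_of_nonneg_right (mul_le_mul (hψB θ) (p.norm_coe_le_norm _)
            (norm_nonneg _) hB0) (norm_nonneg _)
      _ = (B * ‖p‖) * ∫ θ in α..β, ‖F r θ‖ := by rw [intervalIntegral.integral_const_mul]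
      _ ≤ (B * ‖p‖) * M := by gcongr; exact hM r hr hr1
      _ = _ := by ring
  -- Fourier coefficients
  have hfour : ∀ r : ℝ, 0 < r → r < 1 → ∀ m : ℤ,
      ∫ θ in (c - Real.pi)..(c + Real.pi), ψ θ * (fourier m : C(AddCircle (2 * Real.pi), ℂ)) θ * F r θ =
        ∑' n : ℕ, a n * r ^ n * (2 * Real.pi * w (n + m)) := by
    intro r hr hr1 m
    have hfo : ∀ θ : ℝ, (fourier m : C(AddCircle (2 * Real.pi), ℂ)) θ = Complex.exp (m * θ * Complex.I) := by
      intro θ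
      rw [fourier_coe_apply]
      congr 1
      have : (Real.pi : ℂ) ≠ 0 := by exact_mod_cast Real.pi_ne_zero
      push_cast
      field_simp
    have e : ∀ θ : ℝ, ψ θ * (fourier m : C(AddCircle (2 * Real.pi), ℂ)) θ * F r θ =
        ∑' n : ℕ, (a n * r ^ n) * (ψ θ * Complex.exp (((n + m : ℤ) : ℂ) * θ * Complex.I)) := by
      intro θ
      rw [hF, hfo]
      simp only
      rw [← tsum_mul_left]
      apply tsum_congr
      intro n
      rw [mul_pow, ← Complex.exp_nat_mul]
      have : Complex.exp (((n + m : ℤ) : ℂ) * θ * Complex.I) =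
          Complex.exp (m * θ * Complex.I) * Complex.exp (n * (θ * Complex.I)) := by
        rw [← Complex.exp_add]; congr 1; push_cast; ring
      rw [this]; ring
    simp only [e]
    have := aux_hasSum_integral (fun (n : ℕ) (θ : ℝ) =>
        (a n * r ^ n) * (ψ θ * Complex.exp (((n + m : ℤ) : ℂ) * θ * Complex.I)))
      (fun n => K * r ^ n * B) ((hgeo r hr hr1).mul_right B) (fun n => by fun_prop)
      (fun n θ => by
        rw [norm_mul, norm_mul, norm_mul, aux_norm_exp, mul_one, norm_pow, Complex.norm_real,
          Real.norm_of_nonneg hr.le]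
        gcongr
        · exact ha n
        · exact hψB θ) (c - Real.pi) (c + Real.pi)
    rw [← this.tsum_eq]
    apply tsum_congr
    intro n
    rw [intervalIntegral.integral_const_mul, aux_coef w hw c]
  -- the functionals
  have hex : ∀ r : ℝ, 0 < r → r < 1 → ∃ L : C(AddCircle (2 * Real.pi), ℂ) →L[ℂ] ℂ, ‖L‖ ≤ |B * M| ∧
      ∀ m : ℤ, L (fourier m) = ∑' n : ℕ, a n * r ^ n * (2 * Real.pi * w (n + m)) := by
    intro r hr hr1
    have hcont : ∀ p : C(AddCircle (2 * Real.pi), ℂ), Continuous (fun θ : ℝ => ψ θ * p θ * F r θ) := fun p =>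
      (hψc.mul (p.continuous.comp (AddCircle.continuous_mk' _))).mul (hFc r hr hr1)
    let L0 : C(AddCircle (2 * Real.pi), ℂ) →ₗ[ℂ] ℂ :=
      { toFun := fun p => ∫ θ in (c - Real.pi)..(c + Real.pi), ψ θ * p θ * F r θ
        map_add' := by
          intro p q
          rw [← intervalIntegral.integral_add ((hcont p).intervalIntegrable _ _)
            ((hcont q).intervalIntegrable _ _)]
          congr 1; ext θ; simp only [ContinuousMap.add_apply]; ring
        map_smul' := by
          intro z p
          rw [RingHom.id_apply, smul_eq_mul, ← intervalIntegral.integral_const_mul]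
          congr 1; ext θ; simp only [ContinuousMap.smul_apply, smul_eq_mul]; ring }
    refine ⟨L0.mkContinuous |B * M| (fun p => (hred r hr hr1 p).trans (by gcongr; exact le_abs_self _)),
      LinearMap.mkContinuous_norm_le _ (abs_nonneg _) _, fun m => ?_⟩
    exact hfour r hr hr1 m
  set ρ : ℕ → ℝ := fun j => 1 - 1 / ((j:ℝ) + 2) with hρ
  have hρ0 : ∀ j, 0 < ρ j := by
    intro j
    simp only [hρ, sub_pos]
    rw [div_lt_one (by positivity)]
    have : (0:ℝ) ≤ j := by positivity
    linarith
  have hρ1 : ∀ j, ρ j < 1 := by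
    intro j
    have : 0 < 1 / ((j:ℝ) + 2) := by positivity
    simp only [hρ]; linarith
  have hρt : Tendsto ρ atTop (nhds 1) := by
    have h := (tendsto_one_div_add_atTop_nhds_zero_nat (𝕜 := ℝ)).comp (tendsto_add_atTop_nat 1)
    have h' := h.const_sub 1
    rw [sub_zero] at h'
    refine h'.congr (fun j => ?_)
    simp only [hρ, Function.comp]
    push_cast; ring
  choose L hLn hLf using fun j => hex (ρ j) (hρ0 j) (hρ1 j)
  obtain ⟨Λ, -, hΛ⟩ := (WeakDual.isCompact_closedBall (𝕜 := ℂ) (E := C(AddCircle (2 * Real.pi), ℂ)) 0 |B * M|).exists_mapClusterPt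
    (f := atTop) (u := fun j => StrongDual.toWeakDual (L j)) (by
      rw [le_principal_iff, mem_map]
      refine Filter.univ_mem' fun j => ?_
      simpa using hLn j)
  have hΛf : ∀ m : ℤ, Λ (fourier m) = ∑' n : ℕ, a n * (2 * Real.pi * w (n + m)) := by
    intro m
    have hlim : Tendsto (fun j => L j (fourier m)) atTop (nhds (∑' n : ℕ, a n * (2 * Real.pi * w (n + m)))) := by
      simp only [hLf]
      apply tendsto_tsum_of_dominated_convergence (bound := fun n : ℕ => K * (2 * Real.pi * ‖w (n + m)‖))
      · exact ((hwn m).mul_left _).mul_left _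
      · intro n
        have : Tendsto (fun j => a n * ((ρ j : ℝ) : ℂ) ^ n * (2 * Real.pi * w (n + m))) atTop
            (nhds (a n * ((1 : ℝ) : ℂ) ^ n * (2 * Real.pi * w (n + m)))) := by
          apply Tendsto.mul_const
          apply Tendsto.const_mul
          exact ((Complex.continuous_ofReal.tendsto 1).comp hρt).pow n
        simpa using this
      · refine Eventually.of_forall fun j n => ?_
        rw [norm_mul, norm_mul, norm_mul, norm_mul, norm_pow, Complex.norm_real, Complex.norm_real,
          Real.norm_of_nonneg (hρ0 j).le, Real.norm_of_nonneg Real.pi_pos.le, Complex.norm_ofNat]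
        have := pow_le_one₀ (n := n) (hρ0 j).le (hρ1 j).le
        have h5 : ‖a n‖ * ρ j ^ n ≤ K * 1 := by
          apply mul_le_mul (ha n) this (pow_nonneg (hρ0 j).le _) hK
        rw [mul_one] at h5
        exact mul_le_mul_of_nonneg_right h5 (mul_nonneg (by positivity) (norm_nonneg _))
    have hcl : MapClusterPt (Λ (fourier m)) atTop (fun j => L j (fourier m)) :=
      hΛ.continuousAt_comp (f := fun x : WeakDual ℂ C(AddCircle (2 * Real.pi), ℂ) => x (fourier m))
        (WeakDual.eval_continuous _).continuousAt
    have : NeBot (nhds (Λ (fourier m)) ⊓ map (fun j => L j (fourier m)) atTop) := hcl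
    exact eq_of_nhds_neBot (neBot_of_le (f := nhds (Λ (fourier m)) ⊓ map (fun j => L j (fourier m)) atTop)
      (inf_le_inf_left _ hlim))
  have hpos : Tendsto (fun n : ℕ => WeakDual.toStrongDual Λ (fourier (n:ℤ))) atTop (nhds 0) := by
    change Tendsto (fun n : ℕ => Λ (fourier (n:ℤ))) atTop (nhds 0)
    simp only [hΛf]
    have ht := (tendsto_sum_nat_add (fun n : ℕ => ‖w n‖)).const_mul (K * (2 * Real.pi))
    rw [mul_zero] at ht
    refine squeeze_zero_norm (fun m => ?_) ht
    have hs : Summable (fun n : ℕ => K * (2 * Real.pi) * ‖w (n + m)‖) := (hwn m).mul_left _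
    have := tsum_of_norm_bounded hs.hasSum (f := fun n : ℕ => a n * (2 * Real.pi * w (n + m))) (fun n => by
      rw [norm_mul, norm_mul, norm_mul, Complex.norm_real, Real.norm_of_nonneg Real.pi_pos.le, Complex.norm_ofNat,
        ← mul_assoc]
      gcongr; exact ha n)
    rw [tsum_mul_left] at this
    simpa using this
  have hneg := aux_rajchman (WeakDual.toStrongDual Λ) hpos
  change Tendsto (fun n : ℕ => Λ (fourier (-(n:ℤ)))) atTop (nhds 0) at hneg
  simp only [hΛf] at hneg
  have := hneg.const_mul ((2 * Real.pi : ℂ)⁻¹)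
  rw [mul_zero] at this
  refine this.congr fun N => ?_
  rw [← tsum_mul_left]
  apply tsum_congr
  intro n
  have : (Real.pi : ℂ) ≠ 0 := by exact_mod_cast Real.pi_ne_zero
  rw [← sub_eq_add_neg]
  field_simp

theorem aux_core2 (a : ℤ → ℂ) (K : ℝ) (ha : ∀ n, ‖a n‖ ≤ K) (w : ℤ → ℂ)
    (hw : Summable (fun k => ‖w k‖)) 
    (h : Tendsto (fun N : ℕ => ∑' n : ℕ, a n * w (n - N)) atTop (nhds 0)) :
    Tendsto (fun N : ℕ => ∑' k : ℤ, a (k + N) * w k) atTop (nhds 0) := by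
  have hK : 0 ≤ K := (norm_nonneg _).trans (ha 0)
  have hsh : ∀ N : ℕ, Summable (fun n : ℤ => a n * w (n - N)) := by
    intro N
    apply Summable.of_norm_bounded (g := fun n : ℤ => K * ‖w (n - N)‖)
    · exact (hw.comp_injective (i := fun n : ℤ => n - N) (fun x y h => by simpa using h)).mul_left _
    · intro n; rw [norm_mul]; gcongr; exact ha n
  have h2 : ∀ N : ℕ, ∑' k : ℤ, a (k + N) * w k = ∑' n : ℕ, a n * w (n - N) +
      ∑' n : ℕ, a (-(n + 1)) * w (-(n + 1) - N) := by
    intro N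
    have := (Equiv.addRight (N : ℤ)).tsum_eq (fun n : ℤ => a n * w (n - N))
    simp only [Equiv.coe_addRight, add_sub_cancel_right] at this
    rw [this]
    apply tsum_of_nat_of_neg_add_one
    · exact (hsh N).comp_injective (i := fun n : ℕ => (n:ℤ)) Nat.cast_injective
    · exact (hsh N).comp_injective (i := fun n : ℕ => -((n:ℤ) + 1)) (fun x y h => by simpa using h)
  have h3 : Tendsto (fun N : ℕ => ∑' n : ℕ, a (-(n + 1)) * w (-(n + 1) - N)) atTop (nhds 0) := by
    have ht := (tendsto_sum_nat_add (fun n : ℕ => ‖w (-(n + 1))‖)).const_mul K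
    rw [mul_zero] at ht
    refine squeeze_zero_norm (fun N => ?_) ht
    have hs : Summable (fun n : ℕ => K * ‖w (-((n + N : ℕ) + 1))‖) :=
      (hw.comp_injective (i := fun n : ℕ => -(((n + N : ℕ) : ℤ) + 1)) (fun x y h => by simpa using h)).mul_left _
    have := tsum_of_norm_bounded hs.hasSum (f := fun n : ℕ => a (-(n + 1)) * w (-(n + 1) - N)) (fun n => by
      rw [norm_mul]
      have : -((n:ℤ) + 1) - N = -((n + N : ℕ) + 1) := by push_cast; ring
      rw [this]
      gcongr; exact ha _)
    rw [tsum_mul_left] at this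
    exact this
  have := h.add h3
  rw [add_zero] at this
  exact this.congr fun N => (h2 N).symm

theorem aux_zero (a : ℤ → ℂ) (K : ℝ) (ha : ∀ n, ‖a n‖ ≤ K) (α β M : ℝ)
    (hM : ∀ r : ℝ, 0 < r → r < 1 →
      ∫ θ in α..β, ‖∑' m : ℕ, a m * (r * Complex.exp (θ * Complex.I)) ^ m‖ ≤ M)
    (δ : ℝ) (hδpos : 0 < δ) (hδ1 : δ ≤ 1) (τ : ℤ → ℂ)
    (hτs : Summable (fun k => ‖τ k‖))
    (hτ : ∀ θ : ℝ, δ ≤ θ → θ ≤ 2 * Real.pi - δ →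
        ∑' k : ℤ, τ k * Complex.exp (k * θ * Complex.I) = 0)
    (c : ℝ) (hc : c ∈ Ioo (α + δ) (β - δ)) (d : ℤ → ℂ)
    (hd : MapClusterPt d atTop (fun N : ℕ => leftShift^[N] a)) :
    ∑' k : ℤ, d k * (τ k * Complex.exp (k * c * Complex.I)) = 0 := by
  have hK : 0 ≤ K := (norm_nonneg _).trans (ha 0)
  have hpi := Real.pi_gt_three
  have hiter : ∀ (N : ℕ) (x : ℤ → ℂ) (k : ℤ), leftShift^[N] x k = x (k + N) := by
    intro N
    induction N with
    | zero => intro x k; simp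
    | succ N ih =>
      intro x k
      rw [Function.iterate_succ_apply, ih, leftShift]
      congr 1; push_cast; ring
  have hws : Summable (fun k : ℤ => ‖τ k * Complex.exp (k * c * Complex.I)‖) := by
    simpa only [norm_mul, aux_norm_exp, mul_one] using hτs
  have hps : ∀ θ : ℝ, ∑' k : ℤ, τ k * Complex.exp (k * c * Complex.I) * Complex.exp (-(k * θ * Complex.I)) =
      ∑' k : ℤ, τ k * Complex.exp (k * ((c - θ : ℝ) : ℂ) * Complex.I) := by
    intro θ
    apply tsum_congr
    intro k
    rw [mul_assoc, ← Complex.exp_add]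
    congr 2; push_cast; ring
  have hper : ∀ θ : ℝ, ∑' k : ℤ, τ k * Complex.exp (k * ((θ : ℝ) : ℂ) * Complex.I) =
      ∑' k : ℤ, τ k * Complex.exp (k * ((θ + 2 * Real.pi : ℝ) : ℂ) * Complex.I) := by
    intro θ
    apply tsum_congr
    intro k
    congr 1
    rw [Complex.exp_eq_exp_iff_exists_int]
    exact ⟨-k, by push_cast; ring⟩
  have h1 := aux_core (fun n => a n) K (fun n => ha n) (fun k : ℤ => τ k * Complex.exp (k * c * Complex.I)) hws (c - δ) (c + δ) c M
    (by linarith) (by linarith) (by linarith)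
    (by
      intro θ hθ
      rw [hps]
      rcases hθ with ⟨h1, h2⟩ | ⟨h1, h2⟩
      · exact hτ _ (by linarith) (by linarith)
      · rw [hper]
        exact hτ _ (by linarith) (by linarith))
    (by
      intro r hr hr1
      refine le_trans ?_ (hM r hr hr1)
      have hcont : Continuous (fun θ : ℝ => ∑' m : ℕ, a m * (r * Complex.exp (θ * Complex.I)) ^ m) := by
        apply continuous_tsum (u := fun m : ℕ => K * r ^ m) _
          ((summable_geometric_of_lt_one hr.le hr1).mul_left K)
        · intro m θ
          rw [norm_mul, norm_pow, norm_mul, Complex.norm_exp_ofReal_mul_I, mul_one, Complex.norm_real,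
            Real.norm_of_nonneg hr.le]
          gcongr; exact ha m
        · intro k; fun_prop
      apply intervalIntegral.integral_mono_interval (by linarith [hc.1]) (by linarith) (by linarith [hc.2])
      · exact Eventually.of_forall fun θ => norm_nonneg _
      · exact hcont.norm.intervalIntegrable _ _)
  have h2 := aux_core2 a K ha (fun k : ℤ => τ k * Complex.exp (k * c * Complex.I)) hws h1
  obtain ⟨φ, hφ, hlim⟩ := hd.tendsto_subseq
  have h3 := h2.comp hφ.tendsto_atTop
  have h4 : Tendsto ((fun N : ℕ => ∑' k : ℤ, a (k + N) * (τ k * Complex.exp (k * c * Complex.I))) ∘ φ) atTop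
      (nhds (∑' k : ℤ, d k * (τ k * Complex.exp (k * c * Complex.I)))) := by
    apply tendsto_tsum_of_dominated_convergence (hws.mul_left K)
    · intro k
      apply Tendsto.mul_const
      have := (tendsto_pi_nhds.1 hlim) k
      simpa only [Function.comp, hiter] using this
    · refine Eventually.of_forall fun j k => ?_
      rw [norm_mul]
      gcongr
      exact ha _
  exact tendsto_nhds_unique h4 h3


theorem aux_det (a : ℤ → ℂ) (K : ℝ) (ha : ∀ n, ‖a n‖ ≤ K) (α β M : ℝ) (hαβ : α < β)
    (hM : ∀ r : ℝ, 0 < r → r < 1 →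
      ∫ θ in α..β, ‖∑' m : ℕ, a m * (r * Complex.exp (θ * Complex.I)) ^ m‖ ≤ M)
    (b b' : ℤ → ℂ) (hbK : ∀ n, ‖b n‖ ≤ K) (hbK' : ∀ n, ‖b' n‖ ≤ K)
    (hb : MapClusterPt b atTop (fun N : ℕ => leftShift^[N] a))
    (hb' : MapClusterPt b' atTop (fun N : ℕ => leftShift^[N] a))
    (hbb : ∀ n < 0, b n = b' n) : b 0 = b' 0 := by
  have hK : 0 ≤ K := (norm_nonneg _).trans (ha 0)
  have hpi := Real.pi_gt_three
  obtain ⟨δ, hδpos, hδ1, hδ2⟩ : ∃ δ : ℝ, 0 < δ ∧ δ ≤ 1 ∧ δ ≤ (β - α) / 4 :=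
    ⟨min ((β - α) / 4) 1, lt_min (by linarith) one_pos, min_le_right _ _, min_le_left _ _⟩
  obtain ⟨τ, hτs, hτ0, hτ⟩ := aux_bump δ hδpos
  have hzero : ∀ c ∈ Ioo (α + δ) (β - δ), ∀ d : ℤ → ℂ, (∀ n, ‖d n‖ ≤ K) →
      MapClusterPt d atTop (fun N : ℕ => leftShift^[N] a) →
      ∑' k : ℤ, d k * (τ k * Complex.exp (k * c * Complex.I)) = 0  := fun c hc d _ hd =>
    aux_zero a K ha α β M hM δ hδpos hδ1 τ hτs hτ c hc d hd
  have hm : Summable (fun n : ℕ => ‖(b n - b' n) * τ n‖) := by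
    have := (hτs.comp_injective (i := fun n : ℕ => (n:ℤ)) Nat.cast_injective).mul_left (K + K)
    refine Summable.of_nonneg_of_le (fun _ => norm_nonneg _) (fun n => ?_) this
    rw [norm_mul]
    simp only [Function.comp]
    gcongr
    exact (norm_sub_le _ _).trans (add_le_add (hbK _) (hbK' _))
  have huniq : ∀ c ∈ Ioo (α + δ) (β - δ),
      ∑' n : ℕ, (b n - b' n) * τ n * Complex.exp (n * c * Complex.I) = 0 := by
    intro c hc
    have h1 := hzero c hc b hbK hb
    have h2 := hzero c hc b' hbK' hb'
    have hws : Summable (fun k : ℤ => ‖τ k * Complex.exp (k * c * Complex.I)‖) := by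
      simpa only [norm_mul, aux_norm_exp, mul_one] using hτs
    have hsd : ∀ d : ℤ → ℂ, (∀ n, ‖d n‖ ≤ K) →
        Summable (fun k : ℤ => d k * (τ k * Complex.exp (k * c * Complex.I))) := by
      intro d hd
      apply Summable.of_norm_bounded (hws.mul_left K)
      intro k; rw [norm_mul]; gcongr; exact hd k
    have h3 : ∑' k : ℤ, (b k - b' k) * (τ k * Complex.exp (k * c * Complex.I)) = 0 := by
      simp only [sub_mul]
      rw [(hsd b hbK).tsum_sub (hsd b' hbK'), h1, h2, sub_zero]
    have h5 : ∀ k : ℤ, k ∉ Set.range (fun n : ℕ => (n : ℤ)) →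
        (b k - b' k) * (τ k * Complex.exp (k * c * Complex.I)) = 0 := by
      intro k hk
      have hk0 : k < 0 := by
        by_contra hcon
        exact hk ⟨k.toNat, by simp only; omega⟩
      rw [hbb k hk0, sub_self, zero_mul]
    have hinj : Function.Injective (fun n : ℕ => (n : ℤ)) := fun x y h => Int.ofNat_inj.1 h
    rw [← hinj.tsum_eq (Function.support_subset_iff'.2 h5)] at h3
    rw [← h3]
    apply tsum_congr
    intro n
    rw [Int.cast_natCast, mul_assoc]
  have hfin : (b ((0:ℕ):ℤ) - b' ((0:ℕ):ℤ)) * τ ((0:ℕ):ℤ) = 0 :=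
    aux_unique (fun n : ℕ => (b n - b' n) * τ n) hm (α + δ) (β - δ) (by linarith) huniq
  rw [Nat.cast_zero] at hfin
  exact sub_eq_zero.1 ((mul_eq_zero.1 hfin).resolve_right hτ0)

theorem aux_generic (μ : Measure (ℤ → ℂ)) [IsProbabilityMeasure μ] (herg : Ergodic leftShift μ) :
    ∀ᵐ a ∂μ, ∀ b ∈ μ.support, MapClusterPt b atTop (fun N : ℕ => leftShift^[N] a) := by
  have hU : ∀ U ∈ TopologicalSpace.countableBasis (ℤ → ℂ), μ U ≠ 0 →
      ∀ᵐ a ∂μ, ∃ᶠ N : ℕ in atTop, leftShift^[N] a ∈ U := by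
    intro U hU hμ
    have hUm : MeasurableSet U := (TopologicalSpace.isOpen_of_mem_countableBasis hU).measurableSet
    have hcons := herg.toMeasurePreserving.conservative.ae_mem_imp_frequently_image_mem hUm.nullMeasurableSet
    set V : Set (ℤ → ℂ) := {a | ∃ᶠ N : ℕ in atTop, leftShift^[N] a ∈ U} with hV
    have hVm : MeasurableSet V := by
      have : V = ⋂ n : ℕ, ⋃ m : ℕ, ⋃ (_ : n ≤ m), leftShift^[m] ⁻¹' U := by
        ext x; simp [hV, frequently_atTop]
      rw [this]
      refine MeasurableSet.iInter fun n => MeasurableSet.iUnion fun m => MeasurableSet.iUnion fun _ => ?_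
      exact (herg.measurable.iterate m) hUm
    have hVi : leftShift ⁻¹' V = V := by
      ext x
      simp only [hV, mem_preimage, mem_ofPred_eq, ← Function.iterate_succ_apply]
      simp only [frequently_atTop]
      constructor
      · intro h n
        obtain ⟨m, hm, h⟩ := h n
        exact ⟨m + 1, by omega, h⟩
      · intro h n
        obtain ⟨m, hm, h⟩ := h (n + 1)
        obtain ⟨k, rfl⟩ : ∃ k, m = k + 1 := ⟨m - 1, by omega⟩
        exact ⟨k, by omega, h⟩
    rcases herg.toPreErgodic.ae_mem_or_ae_notMem hVm hVi with h | h
    · exact h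
    · exfalso
      apply hμ
      rw [measure_eq_zero_iff_ae_notMem]
      filter_upwards [h, hcons] with x h1 h2 h3
      exact h1 (h2 h3)
  have hall : ∀ᵐ a ∂μ, ∀ U ∈ TopologicalSpace.countableBasis (ℤ → ℂ), μ U ≠ 0 →
      ∃ᶠ N : ℕ in atTop, leftShift^[N] a ∈ U := by
    rw [ae_ball_iff (TopologicalSpace.countable_countableBasis _)]
    intro U hU'
    by_cases h : μ U = 0
    · simp [h]
    · filter_upwards [hU U hU' h] with a ha _ using ha
  filter_upwards [hall] with a ha b hb
  rw [mapClusterPt_iff_frequently]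
  intro s hs
  obtain ⟨U, hU, hbU, hUs⟩ := (TopologicalSpace.isBasis_countableBasis (ℤ → ℂ)).mem_nhds_iff.1 hs
  have hpos := (Measure.mem_support_iff_forall b).1 hb U
    ((TopologicalSpace.isOpen_of_mem_countableBasis hU).mem_nhds hbU)
  exact (ha U hU hpos.ne').mono fun N h => hUs h

theorem stmt4 (μ : Measure (ℤ → ℂ)) [IsProbabilityMeasure μ]
    (herg : Ergodic leftShift μ)
    (K : ℝ) (hK : ∀ᵐ a ∂μ, ∀ n : ℤ, ‖a n‖ ≤ K)
    (hnondet : ¬ ∃ g : ({n : ℤ // n < 0} → ℂ) → ℂ, Measurable g ∧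
      ∀ᵐ a ∂μ, a 0 = g (fun n => a n.1)) :
    ∀ᵐ a ∂μ, StrongNaturalBoundary (fun z => ∑' m : ℕ, a m * z ^ m) := by
  filter_upwards [hK, aux_generic μ herg] with a ha hgen
  rintro α β hαβ ⟨M, hM⟩
  apply hnondet
  set S : Set (ℤ → ℂ) := μ.support ∩ Set.univ.pi (fun _ => closedBall (0:ℂ) K) with hS
  have hScomp : IsCompact S :=
    (isCompact_univ_pi fun _ => isCompact_closedBall (0:ℂ) K).inter_left Measure.isClosed_support
  have hSK : ∀ b ∈ S, ∀ n, ‖b n‖ ≤ K := by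
    intro b hb n
    simpa using hb.2 n (mem_univ n)
  set pr : (ℤ → ℂ) → ({n : ℤ // n < 0} → ℂ) := fun b n => b n.1 with hpr
  have hprc : Continuous pr := by fun_prop
  have hdet : ∀ b ∈ S, ∀ b' ∈ S, pr b = pr b' → b 0 = b' 0 := by
    intro b hb b' hb' h
    refine aux_det a K ha α β (M * (2 * Real.pi)) hαβ ?_ b b' (hSK b hb) (hSK b' hb') (hgen b hb.1)
      (hgen b' hb'.1) (fun n hn => congrFun h ⟨n, hn⟩)
    intro r hr hr1
    have := hM r hr hr1
    rwa [div_le_iff₀ Real.two_pi_pos] at this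
  classical
  set g : ({n : ℤ // n < 0} → ℂ) → ℂ := fun y => if h : ∃ b ∈ S, pr b = y then h.choose 0 else 0 with hg
  have hgS : ∀ b ∈ S, g (pr b) = b 0 := by
    intro b hb
    have hex : ∃ b' ∈ S, pr b' = pr b := ⟨b, hb, rfl⟩
    simp only [hg]
    rw [dif_pos hex]
    exact hdet _ hex.choose_spec.1 _ hb hex.choose_spec.2
  have hgn : ∀ y, y ∉ pr '' S → g y = 0 := by
    intro y hy
    simp only [hg]
    rw [dif_neg]
    exact hy
  refine ⟨g, ?_, ?_⟩
  · apply measurable_of_isClosed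
    intro C hC
    have h1 : MeasurableSet (pr '' (S ∩ (fun b : ℤ → ℂ => b 0) ⁻¹' C)) :=
      ((hScomp.inter_right (hC.preimage (continuous_apply 0))).image hprc).isClosed.measurableSet
    have h2 : MeasurableSet (pr '' S) := (hScomp.image hprc).isClosed.measurableSet
    have h3 : g ⁻¹' C = pr '' (S ∩ (fun b : ℤ → ℂ => b 0) ⁻¹' C) ∪ ((pr '' S)ᶜ ∩ {_y | (0:ℂ) ∈ C}) := by
      ext y
      by_cases hy : y ∈ pr '' S
      · obtain ⟨b, hb, rfl⟩ := hy
        have hmem : pr b ∈ pr '' S := ⟨b, hb, rfl⟩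
        simp only [mem_preimage, hgS b hb, mem_union, mem_inter_iff, mem_compl_iff, hmem, not_true_eq_false,
          false_and, or_false]
        constructor
        · intro h; exact ⟨b, ⟨hb, h⟩, rfl⟩
        · rintro ⟨b', ⟨hb', h⟩, he⟩
          rw [hdet b hb b' hb' he.symm]; exact h
      · have h5 : y ∉ pr '' (S ∩ (fun b : ℤ → ℂ => b 0) ⁻¹' C) := fun h => hy (image_mono inter_subset_left h)
        simp only [mem_preimage, hgn y hy, mem_union, mem_inter_iff, mem_compl_iff, hy, h5, not_false_eq_true,
          true_and, false_or, mem_ofPred_eq]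
    rw [h3]
    exact h1.union (h2.compl.inter (MeasurableSet.const _))
  · filter_upwards [hK, Measure.support_mem_ae (μ := μ)] with b hb hbs
    exact (hgS b ⟨hbs, fun n _ => by simpa using hb n⟩).symm
end

section
/- Let f : ∂𝔻 → ℂ be a bounded function on the unit circle that is continuous except at finitely many points, and assume that at one of these discontinuity points the two one-sided limits of f along the circle exist and are unequal. Then for every irrational number q and every θ ∈ ℝ, the power series Σ_{n=0}^∞ f(e^{2πi(qn+θ)}) z^n defines an analytic function on the open unit disc 𝔻 that has a strong natural boundary on ∂𝔻. -/
open Filter Metric Set MeasureTheory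

open scoped Topology ContDiff CompactlySupported

lemma ultra_bdd_lim {E : Type*} [NormedAddCommGroup E] [ProperSpace E] (U : Ultrafilter ℕ) (x : ℕ → E) (B : ℝ)
    (h : ∀ m, ‖x m‖ ≤ B) : ∃ y, Tendsto x U (𝓝 y) := by
  have hc : IsCompact (closedBall (0 : E) B) := isCompact_closedBall _ _
  obtain ⟨y, -, hy⟩ := hc.ultrafilter_le_nhds (U.map x) (by
    rw [le_principal_iff]
    show ∀ᶠ m in (U : Filter ℕ), x m ∈ closedBall (0 : E) B
    exact Eventually.of_forall (fun m => by simpa using h m))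
  exact ⟨y, hy⟩

lemma exists_limit_measure (α β : ℝ) (U : Ultrafilter ℕ) (u : ℕ → ℝ → ℝ)
    (hc : ∀ m, Continuous (u m)) (h0 : ∀ m x, 0 ≤ u m x) (K : ℝ)
    (hK : ∀ m, ∫ x in Ioc α β, u m x ≤ K) :
    ∃ μ : Measure ℝ, IsFiniteMeasure μ ∧ ∀ ψ : ℝ → ℝ, Continuous ψ → HasCompactSupport ψ →
      tsupport ψ ⊆ Ioo α β →
      Tendsto (fun m => ∫ x, ψ x * u m x) U (𝓝 (∫ x, ψ x ∂μ)) := by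
  have hint : ∀ (ψ : ℝ → ℝ), Continuous ψ → ∀ m, IntegrableOn (fun x => ψ x * u m x) (Ioc α β) :=
    fun ψ hψ m => ((hψ.mul (hc m)).integrableOn_Icc).mono_set Ioc_subset_Icc_self
  have hex : ∀ ψ : C_c(ℝ, ℝ), ∃ y, Tendsto (fun m => ∫ x in Ioc α β, ψ x * u m x) U (𝓝 y) := by
    intro ψ
    obtain ⟨B, hB⟩ := ψ.hasCompactSupport.exists_bound_of_continuous ψ.continuous
    have hB0 : 0 ≤ B := (norm_nonneg _).trans (hB 0)
    refine ultra_bdd_lim U _ (B * K) (fun m => ?_)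
    calc _ ≤ ∫ x in Ioc α β, ‖ψ x * u m x‖ := norm_integral_le_integral_norm _
      _ ≤ ∫ x in Ioc α β, B * u m x := by
        refine integral_mono (hint ψ ψ.continuous m).norm ?_ ?_
        · exact hint (fun _ => B) continuous_const m
        · intro x
          simp only [norm_mul, Real.norm_of_nonneg (h0 m x)]
          exact mul_le_mul_of_nonneg_right (hB x) (h0 m x)
      _ = B * ∫ x in Ioc α β, u m x := integral_const_mul _ _
      _ ≤ B * K := by gcongr; exact hK m
  choose Λ hΛ using hex
  let Λl : C_c(ℝ, ℝ) →ₗ[ℝ] ℝ :=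
    { toFun := Λ
      map_add' := fun ψ χ => by
        refine tendsto_nhds_unique (hΛ (ψ + χ)) ?_
        refine ((hΛ ψ).add (hΛ χ)).congr (fun m => ?_)
        rw [← integral_add (hint ψ ψ.continuous m) (hint χ χ.continuous m)]
        simp [add_mul]
      map_smul' := fun c ψ => by
        refine tendsto_nhds_unique (hΛ (c • ψ)) ?_
        refine ((hΛ ψ).const_mul c).congr (fun m => ?_)
        rw [← integral_const_mul]
        simp [mul_assoc] }
  let Λp : C_c(ℝ, ℝ) →ₚ[ℝ] ℝ := PositiveLinearMap.mk₀ Λl (fun ψ hψ => by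
    refine ge_of_tendsto (hΛ ψ) (Eventually.of_forall fun m => ?_)
    exact integral_nonneg (fun x => mul_nonneg (hψ x) (h0 m x)))
  refine ⟨(RealRMK.rieszMeasure Λp).restrict (Icc α β), ?_, ?_⟩
  · constructor
    rw [Measure.restrict_apply_univ]
    exact isCompact_Icc.measure_lt_top
  · intro ψ h1 h2 h3
    have hz : ∀ x, x ∉ Ioo α β → ψ x = 0 := fun x hx =>
      image_eq_zero_of_notMem_tsupport (fun h => hx (h3 h))
    have e1 : ∫ x, ψ x ∂((RealRMK.rieszMeasure Λp).restrict (Icc α β)) = Λ ⟨⟨ψ, h1⟩, h2⟩ := by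
      rw [setIntegral_eq_integral_of_forall_compl_eq_zero
        (fun x hx => hz x (fun h => hx (Ioo_subset_Icc_self h)))]
      exact RealRMK.integral_rieszMeasure Λp ⟨⟨ψ, h1⟩, h2⟩
    rw [e1]
    refine (hΛ ⟨⟨ψ, h1⟩, h2⟩).congr (fun m => ?_)
    exact setIntegral_eq_integral_of_forall_compl_eq_zero
        (fun x hx => by
          show ψ x * u m x = 0
          rw [hz x (fun h => hx (Ioo_subset_Ioc_self h)), zero_mul])

lemma exists_limit_measure' (α β : ℝ) (U : Ultrafilter ℕ) (u : ℕ → ℝ → ℝ)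
    (hc : ∀ m, Continuous (u m)) (h0 : ∀ m x, 0 ≤ u m x) (K : ℝ)
    (hK : ∀ m, ∫ x in Ioc α β, u m x ≤ K) :
    ∃ μ : Measure ℝ, IsFiniteMeasure μ ∧ ∀ ψ : ℝ → ℂ, Continuous ψ → HasCompactSupport ψ →
      tsupport ψ ⊆ Ioo α β →
      Tendsto (fun m => ∫ x, ψ x * (u m x : ℂ)) U (𝓝 (∫ x, ψ x ∂μ)) := by
  obtain ⟨μ, hμ, H⟩ := exists_limit_measure α β U u hc h0 K hK
  refine ⟨μ, hμ, fun ψ h1 h2 h3 => ?_⟩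
  have cre : HasCompactSupport (fun x => (ψ x).re) := h2.comp_left (g := Complex.re) rfl
  have cim : HasCompactSupport (fun x => (ψ x).im) := h2.comp_left (g := Complex.im) rfl
  have Hre := H (fun x => (ψ x).re) (by fun_prop) cre
    ((closure_mono (Function.support_comp_subset (g := Complex.re) rfl ψ)).trans h3)
  have Him := H (fun x => (ψ x).im) (by fun_prop) cim
    ((closure_mono (Function.support_comp_subset (g := Complex.im) rfl ψ)).trans h3)
  have key : ∀ (ν : Measure ℝ) [IsFiniteMeasureOnCompacts ν] (w : ℝ → ℝ), Continuous w →
      ∫ x, ψ x * (w x : ℂ) ∂ν = ((∫ x, (ψ x).re * w x ∂ν : ℝ) : ℂ) +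
        ((∫ x, (ψ x).im * w x ∂ν : ℝ) : ℂ) * Complex.I := by
    intro ν _ w hw
    have hi : Integrable (fun x => ψ x * (w x : ℂ)) ν :=
      (by fun_prop : Continuous (fun x => ψ x * (w x : ℂ))).integrable_of_hasCompactSupport
        (h2.mul_right)
    rw [← integral_re_add_im hi]
    simp
  have e1 := key μ (fun _ => 1) continuous_const
  simp only [Complex.ofReal_one, mul_one] at e1
  rw [e1]
  simp_rw [key volume _ (hc _)]
  exact ((Complex.continuous_ofReal.tendsto _).comp Hre).add
    (((Complex.continuous_ofReal.tendsto _).comp Him).mul_const _)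

lemma integral_comb4 {ν : Measure ℝ} {a b c d : ℝ → ℂ} (ha : Integrable a ν) (hb : Integrable b ν)
    (hc : Integrable c ν) (hd : Integrable d ν) :
    (∫ x, a x ∂ν - ∫ x, b x ∂ν) + (∫ x, c x ∂ν - ∫ x, d x ∂ν) * Complex.I =
      ∫ x, (a x - b x + (c x - d x) * Complex.I) ∂ν := by
  have h1 : Integrable (fun x => a x - b x) ν := ha.sub hb
  have h2 : Integrable (fun x => (c x - d x) * Complex.I) ν := (hc.sub hd).mul_const _
  rw [integral_add h1 h2, integral_sub ha hb, integral_mul_const, integral_sub hc hd]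

lemma exists_limit_density (α β : ℝ) (U : Ultrafilter ℕ) (F : ℕ → ℝ → ℂ)
    (hc : ∀ m, Continuous (F m)) (K : ℝ)
    (hK : ∀ m, ∫ x in Ioc α β, ‖F m x‖ ≤ K) :
    ∃ (μ : Measure ℝ) (h : ℝ → ℂ), IsFiniteMeasure μ ∧ Measurable h ∧ Integrable h μ ∧
      ∀ ψ : ℝ → ℂ, Continuous ψ → HasCompactSupport ψ →
      tsupport ψ ⊆ Ioo α β →
      Tendsto (fun m => ∫ x, ψ x * F m x) U (𝓝 (∫ x, ψ x * h x ∂μ)) := by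
  have hb : ∀ (g : ℂ → ℝ), Continuous g → (∀ z, g z ≤ ‖z‖) →
      ∃ μ : Measure ℝ, IsFiniteMeasure μ ∧ ∀ ψ : ℝ → ℂ, Continuous ψ → HasCompactSupport ψ →
      tsupport ψ ⊆ Ioo α β →
      Tendsto (fun m => ∫ x, ψ x * ((max (g (F m x)) 0 : ℝ) : ℂ)) U (𝓝 (∫ x, ψ x ∂μ)) := by
    intro g hg hgn
    refine exists_limit_measure' α β U (fun m x => max (g (F m x)) 0) (fun m => ?_)
      (fun m x => le_max_right _ _) K (fun m => le_trans ?_ (hK m))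
    · have := hc m
      fun_prop
    · have := hc m
      have i1 : IntegrableOn (fun x => max (g (F m x)) 0) (Ioc α β) :=
        ((by fun_prop : Continuous (fun x => max (g (F m x)) 0)).integrableOn_Icc).mono_set
          Ioc_subset_Icc_self
      have i2 : IntegrableOn (fun x => ‖F m x‖) (Ioc α β) :=
        ((by fun_prop : Continuous (fun x => ‖F m x‖)).integrableOn_Icc).mono_set
          Ioc_subset_Icc_self
      exact integral_mono i1 i2 (fun x => max_le (hgn _) (norm_nonneg _))
  obtain ⟨μ1, f1, H1⟩ := hb Complex.re Complex.continuous_re Complex.re_le_norm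
  obtain ⟨μ2, f2, H2⟩ := hb (fun z => -z.re) (by fun_prop)
    (fun z => (neg_le_abs _).trans (Complex.abs_re_le_norm z))
  obtain ⟨μ3, f3, H3⟩ := hb Complex.im Complex.continuous_im Complex.im_le_norm
  obtain ⟨μ4, f4, H4⟩ := hb (fun z => -z.im) (by fun_prop)
    (fun z => (neg_le_abs _).trans (Complex.abs_im_le_norm z))
  set μ := μ1 + μ2 + μ3 + μ4 with hμ
  have fμ : IsFiniteMeasure μ := by rw [hμ]; infer_instance
  have a1 : μ1 ≪ μ := by
    refine Measure.absolutelyContinuous_of_le ?_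
    rw [hμ, add_assoc, add_assoc]; exact Measure.le_add_right le_rfl
  have a2 : μ2 ≪ μ := by
    refine Measure.absolutelyContinuous_of_le ?_
    rw [hμ, add_assoc]; exact Measure.le_add_right (Measure.le_add_left le_rfl)
  have a3 : μ3 ≪ μ := by
    refine Measure.absolutelyContinuous_of_le ?_
    rw [hμ]; exact Measure.le_add_right (Measure.le_add_left le_rfl)
  have a4 : μ4 ≪ μ := by
    refine Measure.absolutelyContinuous_of_le ?_
    rw [hμ]; exact (Measure.le_add_left le_rfl)
  let d : Measure ℝ → ℝ → ℂ := fun ν x => (((ν.rnDeriv μ x).toReal : ℝ) : ℂ)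
  have dm : ∀ ν, Measurable (d ν) := fun ν =>
    Complex.measurable_ofReal.comp (Measure.measurable_rnDeriv ν μ).ennreal_toReal
  have di : ∀ (ν : Measure ℝ) [IsFiniteMeasure ν], Integrable (d ν) μ := fun ν _ =>
    (Measure.integrable_toReal_rnDeriv).ofReal
  have dψ : ∀ (ν : Measure ℝ) [IsFiniteMeasure ν], ν ≪ μ → ∀ ψ : ℝ → ℂ, ∫ x, ψ x * d ν x ∂μ = ∫ x, ψ x ∂ν := by
    intro ν _ hν ψ
    have : ν.HaveLebesgueDecomposition μ := Measure.haveLebesgueDecomposition_of_sigmaFinite ν μ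
    rw [← integral_rnDeriv_smul hν]
    simp [d, mul_comm]
  refine ⟨μ, fun x => d μ1 x - d μ2 x + (d μ3 x - d μ4 x) * Complex.I, inferInstance, ?_, ?_, ?_⟩
  · have := dm μ1; have := dm μ2; have := dm μ3; have := dm μ4
    fun_prop
  · exact ((di μ1).sub (di μ2)).add (((di μ3).sub (di μ4)).mul_const _)
  · intro ψ h1 h2 h3
    have T := ((H1 ψ h1 h2 h3).sub (H2 ψ h1 h2 h3)).add
      (((H3 ψ h1 h2 h3).sub (H4 ψ h1 h2 h3)).mul_const Complex.I)
    obtain ⟨B, hB⟩ := h2.exists_bound_of_continuous h1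
    have dpi : ∀ (ν : Measure ℝ) [IsFiniteMeasure ν], Integrable (fun x => ψ x * d ν x) μ := fun ν _ =>
      (di ν).bdd_mul h1.aestronglyMeasurable (Eventually.of_forall hB)
    convert T using 2
    · rename_i m
      have := hc m
      have ii : ∀ g : ℂ → ℝ, Continuous g →
          Integrable (fun x => ψ x * ((max (g (F m x)) 0 : ℝ) : ℂ)) := fun g hg =>
        (by fun_prop : Continuous (fun x => ψ x * ((max (g (F m x)) 0 : ℝ) : ℂ))).integrable_of_hasCompactSupport
          (h2.mul_right)
      have i1 := ii Complex.re Complex.continuous_re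
      have i2 := ii (fun z => -z.re) (by fun_prop)
      have i3 := ii Complex.im Complex.continuous_im
      have i4 := ii (fun z => -z.im) (by fun_prop)
      rw [integral_comb4 i1 i2 i3 i4]
      congr 1
      ext x
      have k : ∀ t : ℝ, max t 0 - max (-t) 0 = t := fun t => by
        rcases le_total t 0 with h | h
        · rw [max_eq_right h, max_eq_left (by linarith)]; ring
        · rw [max_eq_left h, max_eq_right (by linarith)]; ring
      rw [← mul_sub, ← mul_sub, ← Complex.ofReal_sub, ← Complex.ofReal_sub, k, k, mul_assoc,
        ← mul_add, Complex.re_add_im]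
    · rw [← dψ μ1 a1 ψ, ← dψ μ2 a2 ψ, ← dψ μ3 a3 ψ, ← dψ μ4 a4 ψ,
        integral_comb4 (dpi μ1) (dpi μ2) (dpi μ3) (dpi μ4)]
      congr 1
      ext x
      ring

lemma norm_exp_int (k : ℤ) (x : ℝ) : ‖Complex.exp ((k : ℂ) * x * Complex.I)‖ = 1 := by
  have : (k : ℂ) * x * Complex.I = ((k * x : ℝ) : ℂ) * Complex.I := by push_cast; ring
  rw [this, Complex.norm_exp_ofReal_mul_I]

lemma rajchman_s5 (μ : Measure ℝ) [IsFiniteMeasure μ] (h : ℝ → ℂ) (hm : Measurable h)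
    (hi : Integrable h μ) (φ : ℝ → ℝ) (hφ : Continuous φ) (hφc : HasCompactSupport φ)
    (H : ∀ χ : ℝ → ℂ, ContDiff ℝ ∞ χ → HasCompactSupport χ →
      Tendsto (fun N : ℕ => ∫ x, φ x * χ x * Complex.exp (((N : ℤ) : ℂ) * x * Complex.I) * h x ∂μ)
        atTop (𝓝 0)) :
    Tendsto (fun N : ℕ => ∫ x, φ x * Complex.exp (((-N : ℤ) : ℂ) * x * Complex.I) * h x ∂μ)
        atTop (𝓝 0) := by
  set ρ := μ.withDensity (fun x => ‖h x‖ₑ) with hρ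
  have : IsFiniteMeasure ρ := isFiniteMeasure_withDensity hi.2.ne
  let g : ℝ → ℂ := fun x => starRingEnd ℂ (h x) / h x
  have gm : Measurable g := by
    have : Measurable (fun x => starRingEnd ℂ (h x)) := Complex.continuous_conj.measurable.comp hm
    exact this.div hm
  have gb : ∀ x, ‖g x‖ ≤ 1 := fun x => by
    simp only [g, norm_div, RCLike.norm_conj]
    exact div_self_le_one _
  have gL : MemLp g 1 ρ := MemLp.of_bound gm.aestronglyMeasurable 1 (Eventually.of_forall gb)
  obtain ⟨B, hB⟩ := hφc.exists_bound_of_continuous hφ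
  have hB0 : 0 ≤ B := (norm_nonneg _).trans (hB 0)
  rw [Metric.tendsto_atTop]
  intro ε hε
  set δ := ε / (2 * (B + 1)) with hδ
  have hδ0 : 0 < δ := by positivity
  obtain ⟨χ, hχ1, hχ2, hχ3⟩ := gL.exist_eLpNorm_sub_le (by simp) le_rfl hδ0
  obtain ⟨Cχ, hCχ⟩ := hχ1.exists_bound_of_continuous hχ2.continuous
  obtain ⟨N₀, hN₀⟩ := (Metric.tendsto_atTop.1 (H χ hχ2 hχ1)) (ε / 2) (by positivity)
  refine ⟨N₀, fun N hN => ?_⟩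
  have h1 := hN₀ N hN
  rw [dist_zero_right] at h1 ⊢
  have hχm : Measurable χ := hχ2.continuous.measurable
  have hlin : ∫⁻ x, ‖g x - χ x‖ₑ * ‖h x‖ₑ ∂μ ≤ ENNReal.ofReal δ := by
    rw [eLpNorm_one_eq_lintegral_enorm, hρ, lintegral_withDensity_eq_lintegral_mul _ hm.enorm
      ((gm.sub hχm).enorm)] at hχ3
    refine le_trans (le_of_eq ?_) hχ3
    congr 1
    ext x
    simp [mul_comm]
  set e : ℝ → ℂ := fun x => Complex.exp (((N : ℤ) : ℂ) * x * Complex.I) with he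
  have hec : Continuous e := by fun_prop
  have hen : ∀ x, ‖e x‖ = 1 := fun x => norm_exp_int N x
  have hee : ∀ x, ‖e x‖ₑ = 1 := fun x => by rw [← ofReal_norm, hen]; simp
  have hconj : ‖∫ x, φ x * Complex.exp (((-N : ℤ) : ℂ) * x * Complex.I) * h x ∂μ‖ =
      ‖∫ x, φ x * g x * e x * h x ∂μ‖ := by
    rw [← RCLike.norm_conj, ← integral_conj]
    congr 2
    ext x
    have hg : g x * h x = starRingEnd ℂ (h x) := by
      by_cases h0 : h x = 0
      · simp [h0]
      · simp only [g]; field_simp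
    have : starRingEnd ℂ (Complex.exp (((-N : ℤ) : ℂ) * x * Complex.I)) = e x := by
      rw [← Complex.exp_conj, he]
      simp
    rw [map_mul, map_mul, this, Complex.conj_ofReal, ← hg]
    ring
  rw [hconj]
  have ib : ∀ v : ℝ → ℂ, Measurable v → ∀ c : ℝ, (∀ x, ‖v x‖ ≤ c) →
      Integrable (fun x => φ x * v x * e x * h x) μ := by
    intro v hv c hc
    refine hi.bdd_mul (c := B * c) ?_ (Eventually.of_forall fun x => ?_)
    · have := hφ.measurable
      have := hec.measurable
      exact Measurable.aestronglyMeasurable (by fun_prop)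
    · rw [norm_mul, norm_mul, hen, mul_one, Complex.norm_real]
      exact mul_le_mul (hB x) (hc x) (norm_nonneg _) hB0
  have i1 := ib g gm 1 gb
  have i2 := ib χ hχm Cχ hCχ
  have hdiff : ‖∫ x, φ x * g x * e x * h x ∂μ - ∫ x, φ x * χ x * e x * h x ∂μ‖ ≤ B * δ := by
    rw [← integral_sub i1 i2]
    have : ‖∫ x, (φ x * g x * e x * h x - φ x * χ x * e x * h x) ∂μ‖ₑ ≤ ENNReal.ofReal (B * δ) := by
      refine (enorm_integral_le_lintegral_enorm _).trans ?_
      calc _ ≤ ∫⁻ x, ENNReal.ofReal B * (‖g x - χ x‖ₑ * ‖h x‖ₑ) ∂μ := by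
            refine lintegral_mono (fun x => ?_)
            have : (φ x * g x * e x * h x - φ x * χ x * e x * h x : ℂ) =
              φ x * ((g x - χ x) * h x) * e x := by ring
            rw [this, enorm_mul, hee, mul_one, enorm_mul, enorm_mul]
            gcongr
            rw [← ofReal_norm, Complex.norm_real]
            exact ENNReal.ofReal_le_ofReal (hB x)
        _ = ENNReal.ofReal B * ∫⁻ x, (‖g x - χ x‖ₑ * ‖h x‖ₑ) ∂μ :=
            lintegral_const_mul _ ((gm.sub hχm).enorm.mul hm.enorm)
        _ ≤ ENNReal.ofReal B * ENNReal.ofReal δ := by gcongr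
        _ = _ := (ENNReal.ofReal_mul hB0).symm
    rw [← ofReal_norm] at this
    exact (ENNReal.ofReal_le_ofReal_iff (by positivity)).1 this
  have hBδ : B * δ < ε / 2 := by
    rw [hδ, mul_div_assoc', div_lt_div_iff₀ (by positivity) (by positivity)]
    nlinarith
  calc _ = ‖(∫ x, φ x * g x * e x * h x ∂μ - ∫ x, φ x * χ x * e x * h x ∂μ) +
        ∫ x, φ x * χ x * e x * h x ∂μ‖ := by rw [sub_add_cancel]
    _ ≤ _ := norm_add_le _ _
    _ < ε / 2 + ε / 2 := by linarith
    _ = ε := by ring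

/-- Fourier integral at integers. -/
noncomputable def ftz (ψ : ℝ → ℂ) (k : ℤ) : ℂ :=
  ∫ x : ℝ, ψ x * Complex.exp ((k : ℂ) * x * Complex.I)

lemma ftz_summable (ψ : ℝ → ℂ) (h1 : ContDiff ℝ ∞ ψ) (h2 : HasCompactSupport ψ) :
    Summable (fun k : ℤ => ‖ftz ψ k‖) := by
  let s := h2.toSchwartzMap h1
  obtain ⟨C, hC0, hC⟩ := (FourierTransform.fourier s).decay 2 0
  have key : ∀ k : ℤ, ftz ψ k = FourierTransform.fourier s (-k / (2 * Real.pi)) := by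
    intro k
    rw [SchwartzMap.fourier_coe, Real.fourier_real_eq_integral_exp_smul]
    unfold ftz
    congr 1
    ext x
    rw [smul_eq_mul, mul_comm]
    congr 2
    have : (Real.pi : ℂ) ≠ 0 := by exact_mod_cast Real.pi_ne_zero
    push_cast
    field_simp
  have hb : Summable (fun k : ℤ => (C * (2 * Real.pi) ^ 2) * (1 / (k : ℝ) ^ 2)) :=
    (Real.summable_one_div_int_pow.2 (by norm_num)).mul_left _
  refine Summable.of_norm_bounded_eventually hb ?_
  have : ∀ᶠ k : ℤ in cofinite, k ≠ 0 :=
    (Set.finite_singleton (0 : ℤ)).compl_mem_cofinite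
  filter_upwards [this] with k hk
  have h3 := hC (-k / (2 * Real.pi))
  rw [norm_iteratedFDeriv_zero, ← key] at h3
  rw [norm_norm]
  have hk' : (0 : ℝ) < (k : ℝ) ^ 2 := by positivity
  rw [Real.norm_eq_abs, sq_abs, div_pow, neg_sq] at h3
  rw [mul_one_div, le_div_iff₀ hk']
  rw [div_mul_eq_mul_div, div_le_iff₀ (by positivity)] at h3
  linarith

lemma ps_continuous (a : ℕ → ℂ) (C : ℝ) (ha : ∀ n, ‖a n‖ ≤ C) (r : ℝ) (h0 : 0 < r) (h1 : r < 1) :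
    Continuous (fun x : ℝ => ∑' n : ℕ, a n * (r * Complex.exp (x * Complex.I)) ^ n) := by
  refine continuous_tsum (u := fun n => C * r ^ n) (fun n => by fun_prop)
    ((summable_geometric_of_lt_one h0.le h1).mul_left C) (fun n x => ?_)
  rw [norm_mul, norm_pow, norm_mul, Complex.norm_exp_ofReal_mul_I, mul_one, Complex.norm_real,
    Real.norm_of_nonneg h0.le]
  gcongr
  exact ha n

lemma ps_integral (a : ℕ → ℂ) (C : ℝ) (ha : ∀ n, ‖a n‖ ≤ C) (r : ℝ) (h0 : 0 < r) (h1 : r < 1)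
    (ψ : ℝ → ℂ) (hψ : Continuous ψ) (hc : HasCompactSupport ψ) :
    ∫ x, ψ x * ∑' n : ℕ, a n * (r * Complex.exp (x * Complex.I)) ^ n =
      ∑' n : ℕ, a n * r ^ n * ftz ψ n := by
  have hC0 : 0 ≤ C := (norm_nonneg _).trans (ha 0)
  have hi : Integrable ψ := hψ.integrable_of_hasCompactSupport hc
  have nn : ∀ (n : ℕ) (x : ℝ), ‖ψ x * (a n * (r * Complex.exp (x * Complex.I)) ^ n)‖
      ≤ (C * r ^ n) * ‖ψ x‖ := by
    intro n x
    rw [norm_mul, norm_mul, norm_pow, norm_mul, Complex.norm_exp_ofReal_mul_I, mul_one,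
      Complex.norm_real, Real.norm_of_nonneg h0.le, mul_comm]
    gcongr
    exact ha n
  have ii : ∀ n : ℕ, Integrable (fun x => ψ x * (a n * (r * Complex.exp (x * Complex.I)) ^ n)) := by
    intro n
    exact (by fun_prop : Continuous (fun x : ℝ => ψ x * (a n * (r * Complex.exp (x * Complex.I)) ^ n))).integrable_of_hasCompactSupport hc.mul_right
  have hs := hasSum_integral_of_summable_integral_norm ii (by
    refine Summable.of_nonneg_of_le (fun n => integral_nonneg fun x => norm_nonneg _) (fun n => ?_)
      (((summable_geometric_of_lt_one h0.le h1).mul_left C).mul_right (∫ x, ‖ψ x‖))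
    rw [← integral_const_mul]
    exact integral_mono (ii n).norm (hi.norm.const_mul _) (nn n))
  simp_rw [tsum_mul_left] at hs
  rw [← hs.tsum_eq]
  congr 1
  ext n
  unfold ftz
  rw [← integral_const_mul]
  congr 1
  ext x
  rw [mul_pow, ← Complex.exp_nat_mul]
  push_cast
  ring_nf

lemma ps_tendsto (a : ℕ → ℂ) (C : ℝ) (ha : ∀ n, ‖a n‖ ≤ C) (r : ℕ → ℝ) (h0 : ∀ m, 0 < r m)
    (h1 : ∀ m, r m < 1) (hr : Tendsto r atTop (𝓝 1))
    (ψ : ℝ → ℂ) (hψ : ContDiff ℝ ∞ ψ) (hc : HasCompactSupport ψ) :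
    Tendsto (fun m => ∫ x, ψ x * ∑' n : ℕ, a n * (r m * Complex.exp (x * Complex.I)) ^ n) atTop
      (𝓝 (∑' n : ℕ, a n * ftz ψ n)) := by
  simp_rw [ps_integral a C ha _ (h0 _) (h1 _) ψ hψ.continuous hc]
  have hC0 : 0 ≤ C := (norm_nonneg _).trans (ha 0)
  have hs : Summable (fun n : ℕ => C * ‖ftz ψ n‖) :=
    ((ftz_summable ψ hψ hc).comp_injective Nat.cast_injective).mul_left C
  refine tendsto_tsum_of_dominated_convergence hs (fun n => ?_) (Eventually.of_forall fun m n => ?_)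
  · have : Tendsto (fun m => ((r m : ℝ) : ℂ) ^ n) atTop (𝓝 (1 ^ n)) := by
      have := (Complex.continuous_ofReal.tendsto 1).comp hr
      rw [Complex.ofReal_one] at this
      exact this.pow n
    simpa using (this.const_mul (a n)).mul_const (ftz ψ n)
  · rw [norm_mul, norm_mul, norm_pow, Complex.norm_real, Real.norm_of_nonneg (h0 m).le]
    have : r m ^ n ≤ 1 := pow_le_one₀ (h0 m).le (h1 m).le
    have h2 : ‖a n‖ * r m ^ n ≤ C * 1 := mul_le_mul (ha n) this (pow_nonneg (h0 m).le n) hC0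
    rw [mul_one] at h2
    gcongr

lemma ftz_mul_exp (ψ : ℝ → ℂ) (N k : ℤ) :
    ftz (fun x => ψ x * Complex.exp ((N : ℂ) * x * Complex.I)) k = ftz ψ (k + N) := by
  unfold ftz
  congr 1
  ext x
  rw [mul_assoc, ← Complex.exp_add]
  push_cast
  ring_nf

lemma local_RL (a : ℕ → ℂ) (C : ℝ) (ha : ∀ n, ‖a n‖ ≤ C) (α β M : ℝ)
    (hM : ∀ r : ℝ, 0 < r → r < 1 →
      ∫ x in Ioc α β, ‖∑' n : ℕ, a n * (r * Complex.exp (x * Complex.I)) ^ n‖ ≤ M)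
    (φ : ℝ → ℝ) (hφ : ContDiff ℝ ∞ φ) (hφc : HasCompactSupport φ) (hφs : tsupport φ ⊆ Ioo α β) :
    Tendsto (fun N : ℕ => ∑' n : ℕ, a n * ftz (fun x => (φ x : ℂ)) ((n : ℤ) - N)) atTop (𝓝 0) := by
  have hC0 : 0 ≤ C := (norm_nonneg _).trans (ha 0)
  let r : ℕ → ℝ := fun m => 1 - 1 / ((m : ℝ) + 2)
  have r0 : ∀ m, 0 < r m := fun m => by
    have : (1 : ℝ) / ((m : ℝ) + 2) < 1 := by
      rw [div_lt_one (by positivity)]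
      have : (0 : ℝ) ≤ m := Nat.cast_nonneg m
      linarith
    simp only [r]; linarith
  have r1 : ∀ m, r m < 1 := fun m => by
    have : 0 < (1 : ℝ) / ((m : ℝ) + 2) := by positivity
    simp only [r]; linarith
  have rt : Tendsto r atTop (𝓝 1) := by
    have : Tendsto (fun m : ℕ => (1 : ℝ) / ((m : ℝ) + 2)) atTop (𝓝 0) :=
      tendsto_const_nhds.div_atTop (tendsto_atTop_add_const_right _ _ tendsto_natCast_atTop_atTop)
    have h2 := this.const_sub 1
    rw [sub_zero] at h2
    exact h2
  let F : ℕ → ℝ → ℂ := fun m x => ∑' n : ℕ, a n * (r m * Complex.exp (x * Complex.I)) ^ n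
  obtain ⟨μ, h, hμ, hm, hi, H⟩ := exists_limit_density α β (hyperfilter ℕ) F
    (fun m => ps_continuous a C ha (r m) (r0 m) (r1 m)) M (fun m => hM (r m) (r0 m) (r1 m))
  have T : ∀ ψ : ℝ → ℂ, ContDiff ℝ ∞ ψ → HasCompactSupport ψ → tsupport ψ ⊆ Ioo α β →
      ∫ x, ψ x * h x ∂μ = ∑' n : ℕ, a n * ftz ψ n := fun ψ h1 h2 h3 =>
    tendsto_nhds_unique (H ψ h1.continuous h2 h3)
      ((ps_tendsto a C ha r r0 r1 rt ψ h1 h2).mono_left Nat.hyperfilter_le_atTop)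
  have hφ' : ContDiff ℝ ∞ (fun x => (φ x : ℂ)) := Complex.ofRealCLM.contDiff.comp hφ
  have hφc' : HasCompactSupport (fun x => (φ x : ℂ)) := hφc.comp_left (g := Complex.ofReal) rfl
  have hφs' : tsupport (fun x => (φ x : ℂ)) ⊆ Ioo α β :=
    (closure_mono (Function.support_comp_subset (g := Complex.ofReal) rfl φ)).trans hφs
  have he : ∀ N : ℤ, ContDiff ℝ ∞ (fun x : ℝ => Complex.exp ((N : ℂ) * x * Complex.I)) := by
    intro N
    have : ContDiff ℝ ∞ (fun x : ℝ => (x : ℂ)) := Complex.ofRealCLM.contDiff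
    exact ((contDiff_const.mul this).mul contDiff_const).cexp
  have T2 : ∀ ψ : ℝ → ℂ, ContDiff ℝ ∞ ψ → HasCompactSupport ψ → tsupport ψ ⊆ Ioo α β → ∀ N : ℤ,
      ∫ x, ψ x * Complex.exp ((N : ℂ) * x * Complex.I) * h x ∂μ =
        ∑' n : ℕ, a n * ftz ψ (n + N) := by
    intro ψ h1 h2 h3 N
    have := T (fun x => ψ x * Complex.exp ((N : ℂ) * x * Complex.I)) (h1.mul (he N)) h2.mul_right
      ((tsupport_mul_subset_left).trans h3)
    simp_rw [ftz_mul_exp] at this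
    exact this
  have R := rajchman_s5 μ h hm hi φ hφ.continuous hφc (by
    intro χ hχ hχc
    have hs3 : tsupport (fun x => (φ x : ℂ) * χ x) ⊆ Ioo α β :=
      (tsupport_mul_subset_left).trans hφs'
    simp_rw [T2 _ (hφ'.mul hχ) hφc'.mul_right hs3]
    have hs := ftz_summable _ (hφ'.mul hχ) hφc'.mul_right
    set G := fun x => (φ x : ℂ) * χ x with hG
    have hsn : Summable (fun n : ℕ => C * ‖ftz G n‖) :=
      (hs.comp_injective Nat.cast_injective).mul_left C
    have ht := tendsto_sum_nat_add (fun n : ℕ => C * ‖ftz G n‖)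
    refine squeeze_zero_norm (fun N => ?_) ht
    refine tsum_of_norm_bounded ((summable_nat_add_iff N).2 hsn).hasSum (fun n => ?_)
    rw [norm_mul]
    push_cast
    gcongr
    exact ha n)
  refine R.congr (fun N => ?_)
  rw [T2 _ hφ' hφc' hφs']
  simp only [sub_eq_add_neg]

/-- Extension by zero to the integers. -/
noncomputable def extz (a : ℕ → ℂ) (m : ℤ) : ℂ := if 0 ≤ m then a m.toNat else 0

lemma tsum_shift (a : ℕ → ℂ) (g : ℤ → ℂ) (N : ℤ) :
    ∑' n : ℕ, a n * g ((n : ℤ) - N) = ∑' k : ℤ, extz a (k + N) * g k := by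
  have e1 : ∑' k : ℤ, extz a (k + N) * g k = ∑' m : ℤ, extz a m * g (m - N) := by
    rw [← (Equiv.addRight N).tsum_eq (fun m : ℤ => extz a m * g (m - N))]
    simp
  rw [e1, ← (Nat.cast_injective (R := ℤ)).tsum_eq (f := fun m : ℤ => extz a m * g (m - N))]
  · simp [extz]
  · intro m hm
    by_contra hcon
    apply hm
    have : ¬ (0 ≤ m) := fun h => hcon ⟨m.toNat, by simp [h]⟩
    simp [extz, this]

lemma trig_zero (α β : ℝ) (hab : α < β) (S : Finset ℤ) (c : ℤ → ℂ)
    (H : ∀ φ : ℝ → ℝ, ContDiff ℝ ∞ φ → HasCompactSupport φ → tsupport φ ⊆ Ioo α β →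
      ∑ k ∈ S, c k * ftz (fun x => (φ x : ℂ)) k = 0) : ∀ k ∈ S, c k = 0 := by
  let p : ℝ → ℂ := fun x => ∑ k ∈ S, c k * Complex.exp ((k : ℂ) * x * Complex.I)
  have pc : Continuous p := by fun_prop
  have h1 : ∀ᵐ x, x ∈ Ioo α β → p x = 0 := by
    refine isOpen_Ioo.ae_eq_zero_of_integral_contDiff_smul_eq_zero
      (pc.locallyIntegrable.locallyIntegrableOn _) (fun φ h1 h2 h3 => ?_)
    rw [← H φ h1 h2 h3]
    unfold ftz
    simp_rw [← integral_const_mul]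
    have := h1.continuous
    rw [← integral_finsetSum]
    · congr 1
      ext x
      simp only [p, Complex.real_smul, Finset.mul_sum]
      exact Finset.sum_congr rfl (fun k _ => by ring)
    · intro k _
      refine Integrable.const_mul ?_ _
      refine Continuous.integrable_of_hasCompactSupport (by fun_prop) ?_
      exact HasCompactSupport.mul_right (h2.comp_left (g := Complex.ofReal) rfl)
  have h2 : EqOn p (fun _ => 0) (Ioo α β) := by
    refine Measure.eqOn_open_of_ae_eq (μ := volume) ?_ isOpen_Ioo pc.continuousOn continuousOn_const
    exact (ae_restrict_iff' measurableSet_Ioo).2 h1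
  have pa : AnalyticOnNhd ℝ p univ := by
    intro x _
    have : ∀ k ∈ S, AnalyticAt ℝ (fun x : ℝ => c k * Complex.exp ((k : ℂ) * x * Complex.I)) x := by
      intro k _
      have h3 : AnalyticAt ℝ (fun x : ℝ => (x : ℂ)) x := Complex.ofRealCLM.analyticAt x
      have h4 : AnalyticAt ℂ (fun z : ℂ => c k * Complex.exp ((k : ℂ) * z * Complex.I)) (x : ℂ) := by
        fun_prop
      exact (h4.restrictScalars (𝕜 := ℝ)).comp h3
    exact Finset.analyticAt_fun_sum _ this
  have h3 : p = fun _ => 0 := by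
    obtain ⟨x, hx⟩ := nonempty_Ioo.2 hab
    refine pa.eq_of_eventuallyEq (z₀ := x) (fun x _ => analyticAt_const) ?_
    exact eventually_of_mem (isOpen_Ioo.mem_nhds hx) h2
  intro m hm
  have h4 : ∫ x in (0 : ℝ)..(2 * Real.pi), p x * Complex.exp (((-m : ℤ) : ℂ) * x * Complex.I) = 0 := by
    simp [h3]
  have h5 : ∀ k : ℤ, ∫ x in (0 : ℝ)..(2 * Real.pi), c k * Complex.exp (((k - m : ℤ) : ℂ) * x * Complex.I)
      = if k = m then c k * (2 * Real.pi) else 0 := by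
    intro k
    rw [intervalIntegral.integral_const_mul]
    split_ifs with hk
    · simp [hk]
    · have hne : ((k - m : ℤ) : ℂ) * Complex.I ≠ 0 := by
        refine mul_ne_zero ?_ Complex.I_ne_zero
        exact_mod_cast sub_ne_zero.2 hk
      have : ∀ x : ℝ, ((k - m : ℤ) : ℂ) * x * Complex.I = (((k - m : ℤ) : ℂ) * Complex.I) * x :=
        fun x => by ring
      simp_rw [this]
      rw [integral_exp_mul_complex hne]
      have h6 : ((k - m : ℤ) : ℂ) * Complex.I * ((2 * Real.pi : ℝ) : ℂ) =
        ((k - m : ℤ) : ℂ) * (2 * Real.pi * Complex.I) := by push_cast; ring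
      rw [h6, Complex.exp_int_mul_two_pi_mul_I]
      simp
  have h7 : ∀ x : ℝ, p x * Complex.exp (((-m : ℤ) : ℂ) * x * Complex.I) =
      ∑ k ∈ S, c k * Complex.exp (((k - m : ℤ) : ℂ) * x * Complex.I) := by
    intro x
    simp only [p, Finset.sum_mul]
    refine Finset.sum_congr rfl (fun k _ => ?_)
    rw [mul_assoc, ← Complex.exp_add]
    push_cast
    ring_nf
  simp_rw [h7] at h4
  rw [intervalIntegral.integral_finsetSum] at h4
  · simp_rw [h5] at h4
    rw [Finset.sum_ite_eq' S m] at h4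
    simp only [hm, if_true] at h4
    have : (2 * Real.pi : ℂ) ≠ 0 := by exact_mod_cast Real.two_pi_pos.ne'
    exact (mul_eq_zero.1 h4).resolve_right this
  · intro k _
    exact Continuous.intervalIntegrable (by fun_prop) _ _

lemma orbit_hit (q : ℝ) (hq : Irrational q) (θ u v : ℝ) (huv : u < v) (N : ℕ) :
    ∃ n : ℕ, N ≤ n ∧ ∃ m : ℤ, q * n + θ - m ∈ Ioo u v := by
  have hd : DenseRange (· • (q : AddCircle (1 : ℝ)) : ℤ → AddCircle (1 : ℝ)) :=
    AddCircle.denseRange_zsmul_coe_iff.2 (by simpa using hq)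
  let y : AddCircle (1 : ℝ) := (((u + v) / 2 - θ : ℝ) : AddCircle (1 : ℝ))
  have hy : MapClusterPt y atTop (fun n : ℕ => n • (q : AddCircle (1 : ℝ))) :=
    ((mapClusterPt_atTop_nsmul_tfae y (q : AddCircle (1 : ℝ))).out 0 3).2 (hd y)
  have hopen : IsOpen ((fun t : ℝ => (t : AddCircle (1 : ℝ))) '' Ioo (u - θ) (v - θ)) :=
    QuotientAddGroup.isOpenMap_coe _ isOpen_Ioo
  have hmem : y ∈ ((fun t : ℝ => (t : AddCircle (1 : ℝ))) '' Ioo (u - θ) (v - θ)) :=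
    ⟨(u + v) / 2 - θ, ⟨by linarith, by linarith⟩, rfl⟩
  have hf := hy.frequently (hopen.mem_nhds hmem)
  obtain ⟨n, hn, t, ht, hte⟩ := (frequently_atTop.1 hf) N
  refine ⟨n, hn, ?_⟩
  have h0 : ((n * q - t : ℝ) : AddCircle (1 : ℝ)) = 0 := by
    rw [AddCircle.coe_sub]
    have : ((n * q : ℝ) : AddCircle (1 : ℝ)) = n • (q : AddCircle (1 : ℝ)) := by
      rw [← AddCircle.coe_nsmul, nsmul_eq_mul]
    rw [this, ← hte, sub_self]
  obtain ⟨m, hm⟩ := (AddCircle.coe_eq_zero_iff 1).1 h0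
  refine ⟨m, ?_⟩
  rw [zsmul_eq_mul, mul_one] at hm
  have : q * n + θ - m = t + θ := by rw [hm]; ring
  rw [this]
  exact ⟨by linarith [ht.1], by linarith [ht.2]⟩

lemma exists_seq_right (q : ℝ) (hq : Irrational q) (θ p : ℝ) :
    ∃ (n : ℕ → ℕ) (x : ℕ → ℝ), Tendsto n atTop atTop ∧ Tendsto x atTop (𝓝 0) ∧ (∀ j, 0 < x j) ∧
      ∀ j, ∃ m : ℤ, q * n j + θ = p + x j + m := by
  choose n hn m hm using fun j : ℕ => orbit_hit q hq θ p (p + 1 / ((j : ℝ) + 1))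
    (by have : 0 < 1 / ((j : ℝ) + 1) := by positivity
        linarith) j
  refine ⟨n, fun j => q * n j + θ - m j - p, tendsto_atTop_mono hn tendsto_id, ?_, ?_, ?_⟩
  · exact squeeze_zero (fun j => by linarith [(hm j).1]) (fun j => by linarith [(hm j).2])
      tendsto_one_div_add_atTop_nhds_zero_nat
  · intro j
    linarith [(hm j).1]
  · intro j
    exact ⟨m j, by ring⟩

lemma exists_seq_left (q : ℝ) (hq : Irrational q) (θ p : ℝ) :
    ∃ (n : ℕ → ℕ) (x : ℕ → ℝ), Tendsto n atTop atTop ∧ Tendsto x atTop (𝓝 0) ∧ (∀ j, x j < 0) ∧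
      ∀ j, ∃ m : ℤ, q * n j + θ = p + x j + m := by
  obtain ⟨n, x, h1, h2, h3, h4⟩ := exists_seq_right (-q) hq.neg (-θ) (-p)
  refine ⟨n, fun j => -x j, h1, by simpa using h2.neg, fun j => by simpa using h3 j, fun j => ?_⟩
  obtain ⟨m, hm⟩ := h4 j
  exact ⟨-m, by push_cast; linarith⟩

lemma extz_eq (f : ℂ → ℂ) (q θ θ₀ x : ℝ) (n : ℕ) (m k : ℤ) (hk : 0 ≤ k + n)
    (h : q * n + θ = θ₀ / (2 * Real.pi) + x + m) :
    extz (fun n : ℕ => f (Complex.exp (2 * Real.pi * Complex.I * (q * n + θ)))) (k + n) =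
      f (Complex.exp (((θ₀ + 2 * Real.pi * q * k + 2 * Real.pi * x : ℝ) : ℂ) * Complex.I)) := by
  unfold extz
  rw [if_pos hk]
  refine congrArg f ?_
  rw [Complex.exp_eq_exp_iff_exists_int]
  refine ⟨m, ?_⟩
  have h1 : (((k + n).toNat : ℕ) : ℂ) = (k : ℂ) + n := by
    have : (((k + n).toNat : ℤ) : ℂ) = ((k + n : ℤ) : ℂ) := by rw [Int.toNat_of_nonneg hk]
    push_cast at this
    exact this
  have h2 : (q : ℂ) * n + θ = θ₀ / (2 * Real.pi) + x + m := by exact_mod_cast h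
  have hpi : (Real.pi : ℂ) ≠ 0 := by exact_mod_cast Real.pi_ne_zero
  have h3 : (θ₀ : ℂ) = 2 * Real.pi * (θ₀ / (2 * Real.pi)) := by field_simp
  rw [h1]
  push_cast
  rw [show (q : ℂ) * (k + n) + θ = q * k + (q * n + θ) by ring, h2]
  conv_rhs => rw [h3]
  ring

lemma exp_inj_orbit (q : ℝ) (hq : Irrational q) (θ₀ : ℝ) :
    Function.Injective (fun k : ℤ =>
      Complex.exp (((θ₀ + 2 * Real.pi * q * k : ℝ) : ℂ) * Complex.I)) := by
  intro k l hkl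
  obtain ⟨n, hn⟩ := Complex.exp_eq_exp_iff_exists_int.1 hkl
  have h1 : (((θ₀ + 2 * Real.pi * q * k : ℝ) : ℂ)) * Complex.I =
      ((θ₀ + 2 * Real.pi * q * l + n * (2 * Real.pi) : ℝ) : ℂ) * Complex.I := by
    rw [hn]; push_cast; ring
  have h2 := mul_right_cancel₀ Complex.I_ne_zero h1
  have h3 : θ₀ + 2 * Real.pi * q * k = θ₀ + 2 * Real.pi * q * l + n * (2 * Real.pi) := by
    exact_mod_cast h2
  have h4 : q * ((k - l : ℤ) : ℝ) = n := by
    have : (2 * Real.pi) * (q * ((k - l : ℤ) : ℝ)) = (2 * Real.pi) * n := by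
      push_cast; linarith
    exact mul_left_cancel₀ Real.two_pi_pos.ne' this
  by_contra hne
  have h5 : k - l ≠ 0 := sub_ne_zero.2 hne
  exact (hq.mul_intCast h5).ne_int n h4

theorem stmt5 (f : ℂ → ℂ) (C : ℝ)
    (hbd : ∀ z ∈ Metric.sphere (0 : ℂ) 1, ‖f z‖ ≤ C)
    (D : Finset ℂ) (hD : (D : Set ℂ) ⊆ Metric.sphere (0 : ℂ) 1)
    (hcont : ∀ z ∈ Metric.sphere (0 : ℂ) 1 \ (D : Set ℂ),
      ContinuousWithinAt f (Metric.sphere (0 : ℂ) 1) z)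
    (θ₀ : ℝ) (hθ₀ : Complex.exp (θ₀ * Complex.I) ∈ D)
    (L₁ L₂ : ℂ)
    (hL₁ : Tendsto (fun θ : ℝ => f (Complex.exp (θ * Complex.I))) (nhdsWithin θ₀ (Set.Ioi θ₀)) (nhds L₁))
    (hL₂ : Tendsto (fun θ : ℝ => f (Complex.exp (θ * Complex.I))) (nhdsWithin θ₀ (Set.Iio θ₀)) (nhds L₂))
    (hne : L₁ ≠ L₂) :
    ∀ q : ℝ, Irrational q → ∀ θ : ℝ,
      StrongNaturalBoundary (fun z =>
        ∑' n : ℕ, f (Complex.exp (2 * Real.pi * Complex.I * (q * n + θ))) * z ^ n) := by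
  intro q hq θ α β hab
  rintro ⟨M, hM⟩
  set a : ℕ → ℂ := fun n => f (Complex.exp (2 * Real.pi * Complex.I * (q * n + θ))) with ha_def
  have hsph : ∀ x : ℝ, Complex.exp (x * Complex.I) ∈ Metric.sphere (0 : ℂ) 1 := fun x => by
    simp [Complex.norm_exp_ofReal_mul_I]
  have ha : ∀ n, ‖a n‖ ≤ C := fun n => by
    refine hbd _ ?_
    have := hsph (2 * Real.pi * (q * n + θ))
    convert this using 2
    push_cast
    ring
  have hC0 : 0 ≤ C := (norm_nonneg _).trans (ha 0)
  have hAb : ∀ m, ‖extz a m‖ ≤ C := fun m => by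
    unfold extz
    split_ifs
    · exact ha _
    · simpa using hC0
  have hM' : ∀ r : ℝ, 0 < r → r < 1 →
      ∫ x in Ioc α β, ‖∑' n : ℕ, a n * (r * Complex.exp (x * Complex.I)) ^ n‖ ≤
        M * (2 * Real.pi) := by
    intro r h0 h1
    have := hM r h0 h1
    rw [div_le_iff₀ Real.two_pi_pos, intervalIntegral.integral_of_le hab.le] at this
    exact this
  have RL := local_RL a C ha α β _ hM'
  obtain ⟨n₁, x₁, hn₁, hx₁, hp₁, he₁⟩ := exists_seq_right q hq θ (θ₀ / (2 * Real.pi))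
  obtain ⟨n₂, x₂, hn₂, hx₂, hp₂, he₂⟩ := exists_seq_left q hq θ (θ₀ / (2 * Real.pi))
  have ev : ∀ (n : ℕ → ℕ) (x : ℕ → ℝ), Tendsto n atTop atTop →
      (∀ j, ∃ m : ℤ, q * n j + θ = θ₀ / (2 * Real.pi) + x j + m) → ∀ k : ℤ, ∀ᶠ j in atTop,
      f (Complex.exp (((θ₀ + 2 * Real.pi * q * k + 2 * Real.pi * x j : ℝ) : ℂ) * Complex.I)) =
        extz a (k + n j) := by
    intro n x hn he k
    filter_upwards [hn.eventually_ge_atTop (-k).toNat] with j hj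
    obtain ⟨m, hm⟩ := he j
    exact (extz_eq f q θ θ₀ (x j) (n j) m k (by omega) hm).symm
  have good : ∀ (n : ℕ → ℕ) (x : ℕ → ℝ), Tendsto n atTop atTop → Tendsto x atTop (𝓝 0) →
      (∀ j, ∃ m : ℤ, q * n j + θ = θ₀ / (2 * Real.pi) + x j + m) → ∀ k : ℤ,
      Complex.exp (((θ₀ + 2 * Real.pi * q * k : ℝ) : ℂ) * Complex.I) ∉ D →
      Tendsto (fun j => extz a (k + n j)) atTop
        (𝓝 (f (Complex.exp (((θ₀ + 2 * Real.pi * q * k : ℝ) : ℂ) * Complex.I)))) := by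
    intro n x hn hx he k hk
    refine Tendsto.congr' (ev n x hn he k) ?_
    have hc := hcont _ ⟨hsph (θ₀ + 2 * Real.pi * q * k), hk⟩
    refine Tendsto.comp (g := f) hc (tendsto_nhdsWithin_iff.2 ⟨?_, Eventually.of_forall fun j => hsph _⟩)
    have h1 : Tendsto (fun j => θ₀ + 2 * Real.pi * q * k + 2 * Real.pi * x j) atTop
        (𝓝 (θ₀ + 2 * Real.pi * q * k)) := by
      simpa using (hx.const_mul (2 * Real.pi)).const_add (θ₀ + 2 * Real.pi * q * k)
    have h2 : Continuous (fun t : ℝ => Complex.exp ((t : ℂ) * Complex.I)) := by fun_prop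
    exact (h2.tendsto _).comp h1
  have hmove : ∀ x : ℕ → ℝ, Tendsto x atTop (𝓝 0) →
      Tendsto (fun j => θ₀ + 2 * Real.pi * q * (0 : ℤ) + 2 * Real.pi * x j) atTop (𝓝 θ₀) := by
    intro x hx
    simpa using (hx.const_mul (2 * Real.pi)).const_add θ₀
  have z₁ : Tendsto (fun j => extz a (0 + n₁ j)) atTop (𝓝 L₁) := by
    refine Tendsto.congr' (ev n₁ x₁ hn₁ he₁ 0) ?_
    refine Tendsto.comp (g := fun θ : ℝ => f (Complex.exp (θ * Complex.I))) hL₁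
      (tendsto_nhdsWithin_iff.2 ⟨hmove x₁ hx₁, Eventually.of_forall fun j => ?_⟩)
    have := mul_pos Real.two_pi_pos (hp₁ j)
    simpa using this
  have z₂ : Tendsto (fun j => extz a (0 + n₂ j)) atTop (𝓝 L₂) := by
    refine Tendsto.congr' (ev n₂ x₂ hn₂ he₂ 0) ?_
    refine Tendsto.comp (g := fun θ : ℝ => f (Complex.exp (θ * Complex.I))) hL₂
      (tendsto_nhdsWithin_iff.2 ⟨hmove x₂ hx₂, Eventually.of_forall fun j => ?_⟩)
    have := mul_neg_of_pos_of_neg Real.two_pi_pos (hp₂ j)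
    simpa using this
  have hle : ((hyperfilter ℕ : Ultrafilter ℕ) : Filter ℕ) ≤ atTop := Nat.hyperfilter_le_atTop
  have db : ∀ (k : ℤ) (j : ℕ), ‖extz a (k + n₁ j) - extz a (k + n₂ j)‖ ≤ 2 * C := fun k j =>
    (norm_sub_le _ _).trans (by linarith [hAb (k + n₁ j), hAb (k + n₂ j)])
  choose c hc using fun k : ℤ => ultra_bdd_lim (hyperfilter ℕ)
    (fun j => extz a (k + n₁ j) - extz a (k + n₂ j)) (2 * C) (db k)
  have hfin : {k : ℤ | Complex.exp (((θ₀ + 2 * Real.pi * q * k : ℝ) : ℂ) * Complex.I) ∈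
      (D : Set ℂ)}.Finite :=
    D.finite_toSet.preimage (exp_inj_orbit q hq θ₀).injOn
  have hc0 : c 0 = L₁ - L₂ := tendsto_nhds_unique (hc 0) ((z₁.sub z₂).mono_left hle)
  have hcS : ∀ k, k ∉ hfin.toFinset → c k = 0 := by
    intro k hk
    have hk' : Complex.exp (((θ₀ + 2 * Real.pi * q * k : ℝ) : ℂ) * Complex.I) ∉ D := by
      intro h
      exact hk (by simpa using h)
    have := ((good n₁ x₁ hn₁ hx₁ he₁ k hk').sub (good n₂ x₂ hn₂ hx₂ he₂ k hk')).mono_left hle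
    rw [sub_self] at this
    exact tendsto_nhds_unique (hc k) this
  have h0S : (0 : ℤ) ∈ hfin.toFinset := by
    simpa using hθ₀
  refine hne (sub_eq_zero.1 ?_)
  rw [← hc0]
  refine trig_zero α β hab hfin.toFinset c (fun φ h1 h2 h3 => ?_) 0 h0S
  set g : ℤ → ℂ := ftz (fun x => (φ x : ℂ)) with hg
  have hgs : Summable (fun k : ℤ => ‖g k‖) :=
    ftz_summable _ (Complex.ofRealCLM.contDiff.comp h1) (h2.comp_left (g := Complex.ofReal) rfl)
  have R := RL φ h1 h2 h3
  replace R : Tendsto (fun N : ℕ => ∑' k : ℤ, extz a (k + N) * g k) atTop (𝓝 0) :=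
    R.congr (fun N => tsum_shift a g N)
  have hsum : ∀ N : ℤ, Summable (fun k : ℤ => extz a (k + N) * g k) := fun N =>
    Summable.of_norm_bounded (hgs.mul_left C) (fun k => by
      rw [norm_mul]
      gcongr
      exact hAb _)
  have R2 : Tendsto (fun j => ∑' k : ℤ, (extz a (k + n₁ j) - extz a (k + n₂ j)) * g k)
      (hyperfilter ℕ : Filter ℕ) (𝓝 0) := by
    have := ((R.comp hn₁).sub (R.comp hn₂)).mono_left hle
    rw [sub_zero] at this
    refine this.congr (fun j => ?_)
    simp only [Function.comp]
    rw [← (hsum _).tsum_sub (hsum _)]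
    simp only [sub_mul]
  have R3 : Tendsto (fun j => ∑' k : ℤ, (extz a (k + n₁ j) - extz a (k + n₂ j)) * g k)
      (hyperfilter ℕ : Filter ℕ) (𝓝 (∑' k : ℤ, c k * g k)) := by
    refine tendsto_tsum_of_dominated_convergence (hgs.mul_left (2 * C))
      (fun k => (hc k).mul_const _) (Eventually.of_forall fun j k => ?_)
    rw [norm_mul]
    gcongr
    exact db k j
  have := tendsto_nhds_unique R3 R2
  rw [tsum_eq_sum (s := hfin.toFinset) (fun k hk => by rw [hcS k hk, zero_mul])] at this
  exact this
end

section
/- Let Ω ⊂ ℂ be a compact set containing at least two points, and let Ω^ℕ be the countable product of copies of Ω with the product topology. Then the set { (a_n)_{n≥0} ∈ Ω^ℕ : the function f(z) = Σ_{n=0}^∞ a_n z^n has a natural boundary on ∂𝔻 } is a dense G_δ subset of Ω^ℕ. -/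
open Filter Metric Set MeasureTheory

/-- The power series with coefficients `a`. -/
noncomputable def pser (a : ℕ → ℂ) (z : ℂ) : ℂ := ∑' n : ℕ, a n * z ^ n

lemma pser_summable {a : ℕ → ℂ} {C : ℝ} (h : ∀ n, ‖a n‖ ≤ C) {z : ℂ} (hz : ‖z‖ < 1) :
    Summable (fun n => a n * z ^ n) := by
  refine Summable.of_norm_bounded (g := fun n => C * ‖z‖ ^ n) ?_ ?_
  · exact (summable_geometric_of_lt_one (norm_nonneg _) hz).mul_left C
  · intro n
    rw [norm_mul, norm_pow]
    exact mul_le_mul_of_nonneg_right (h n) (by positivity)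

lemma pser_diff {a : ℕ → ℂ} {C : ℝ} (h : ∀ n, ‖a n‖ ≤ C) :
    DifferentiableOn ℂ (pser a) (ball 0 1) := by
  have hC : 0 ≤ C := (norm_nonneg _).trans (h 0)
  intro z hz
  rw [mem_ball_zero_iff] at hz
  obtain ⟨ρ, h1, h2⟩ := exists_between hz
  have hρ : 0 ≤ ρ := (norm_nonneg _).trans h1.le
  have : DifferentiableOn ℂ (pser a) (ball 0 ρ) := by
    refine Complex.differentiableOn_tsum_of_summable_norm (u := fun n => C * ρ ^ n)
      ((summable_geometric_of_lt_one hρ h2).mul_left C) ?_ isOpen_ball ?_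
    · intro n
      fun_prop
    · intro n w hw
      rw [mem_ball_zero_iff] at hw
      rw [norm_mul, norm_pow]
      gcongr
      exact h n
  exact (this.differentiableAt (isOpen_ball.mem_nhds (by simpa using h1))).differentiableWithinAt

lemma pser_tendsto {Ω : Set ℂ} {C : ℝ} (hC : ∀ x ∈ Ω, ‖x‖ ≤ C) (a : ℕ → Ω) :
    TendstoLocallyUniformlyOn (fun (b : ℕ → Ω) => pser (fun n => (b n : ℂ)))
      (pser (fun n => (a n : ℂ))) (nhds a) (ball 0 1) := by
  rw [tendstoLocallyUniformlyOn_iff_forall_tendsto]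
  intro z hz
  have hC0 : 0 ≤ C := (norm_nonneg _).trans (hC _ (a 0).2)
  rw [mem_ball_zero_iff] at hz
  obtain ⟨ρ, h1, h2⟩ := exists_between hz
  have hρ : 0 ≤ ρ := (norm_nonneg _).trans h1.le
  have hc : ContinuousOn (fun y : (ℕ → Ω) × ℂ => pser (fun n => (y.1 n : ℂ)) y.2)
      (univ ×ˢ ball 0 ρ) := by
    unfold pser
    refine continuousOn_tsum (u := fun n => C * ρ ^ n) ?_
      ((summable_geometric_of_lt_one hρ h2).mul_left C) ?_
    · intro n
      fun_prop
    · rintro n ⟨b, w⟩ ⟨-, hw⟩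
      simp only [mem_ball_zero_iff] at hw
      rw [norm_mul, norm_pow]
      gcongr
      exact hC _ (b n).2
  have hat : ContinuousAt (fun y : (ℕ → Ω) × ℂ => pser (fun n => (y.1 n : ℂ)) y.2) (a, z) := by
    refine hc.continuousAt ((isOpen_univ.prod isOpen_ball).mem_nhds ?_)
    simpa using h1
  have hle : nhds a ×ˢ nhdsWithin z (ball 0 1) ≤ nhds (a, z) := by
    rw [nhds_prod_eq]
    exact Filter.prod_mono le_rfl nhdsWithin_le_nhds
  have hfst : Tendsto (fun y : (ℕ → Ω) × ℂ => ((a, y.2) : (ℕ → Ω) × ℂ)) (nhds (a, z))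
      (nhds (a, z)) := by
    have : Continuous (fun y : (ℕ → Ω) × ℂ => ((a, y.2) : (ℕ → Ω) × ℂ)) := by fun_prop
    exact this.tendsto (a, z)
  have h3 := ((hat.tendsto.comp hfst).prodMk_nhds hat.tendsto).mono_left hle
  exact h3.mono_right (nhds_le_uniformity _)

lemma iter_diff {f : ℂ → ℂ} (hf : DifferentiableOn ℂ f (ball 0 1)) (k : ℕ) :
    DifferentiableOn ℂ (iteratedDeriv k f) (ball 0 1) := by
  induction k with
  | zero => simpa using hf
  | succ k ih =>
    rw [iteratedDeriv_succ]
    exact ih.deriv isOpen_ball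

lemma pser_iter_cont {Ω : Set ℂ} {C : ℝ} (hC : ∀ x ∈ Ω, ‖x‖ ≤ C) (k : ℕ) {p : ℂ}
    (hp : ‖p‖ < 1) :
    Continuous (fun b : ℕ → Ω => iteratedDeriv k (pser (fun n => (b n : ℂ))) p) := by
  rw [continuous_iff_continuousAt]
  intro a
  have : TendstoLocallyUniformlyOn
      (fun (b : ℕ → Ω) => iteratedDeriv k (pser (fun n => (b n : ℂ))))
      (iteratedDeriv k (pser (fun n => (a n : ℂ)))) (nhds a) (ball 0 1) := by
    induction k with
    | zero => simpa using pser_tendsto hC a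
    | succ k ih =>
      simp only [iteratedDeriv_succ]
      exact ih.deriv (Eventually.of_forall fun b =>
        iter_diff (pser_diff fun n => hC _ (b n).2) k) isOpen_ball
  exact this.tendsto_at (by simpa using hp)

/-- Taylor coefficient bound set. -/
def Fset (Ω : Set ℂ) (p : ℂ) (r M : ℝ) : Set (ℕ → Ω) :=
  {a | ∀ k : ℕ, ‖iteratedDeriv k (pser (fun n => (a n : ℂ))) p‖ * r ^ k ≤ M * k.factorial}

lemma Fset_closed {Ω : Set ℂ} {C : ℝ} (hC : ∀ x ∈ Ω, ‖x‖ ≤ C) {p : ℂ} (hp : ‖p‖ < 1)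
    (r M : ℝ) : IsClosed (Fset Ω p r M) := by
  unfold Fset
  rw [setOf_forall]
  refine isClosed_iInter fun k => ?_
  exact isClosed_le ((pser_iter_cont hC k hp).norm.mul continuous_const) continuous_const

lemma term_bound {c : ℂ} {k : ℕ} {r M s : ℝ} (hr : 0 < r)
    (h : ‖c‖ * r ^ k ≤ M * k.factorial) {w : ℂ} (hw : ‖w‖ ≤ s) :
    ‖(k.factorial : ℂ)⁻¹ • w ^ k • c‖ ≤ M * (s / r) ^ k := by
  have hk : (0 : ℝ) < k.factorial := by exact_mod_cast k.factorial_pos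
  rw [norm_smul, norm_smul, norm_inv, norm_pow, Complex.norm_natCast, div_pow, inv_mul_eq_div,
    div_le_iff₀ hk, mul_div_assoc', div_mul_eq_mul_div, le_div_iff₀ (by positivity)]
  have h1 : ‖w‖ ^ k ≤ s ^ k := by gcongr
  have h2 : 0 ≤ ‖c‖ * r ^ k := by positivity
  calc ‖w‖ ^ k * ‖c‖ * r ^ k = ‖w‖ ^ k * (‖c‖ * r ^ k) := by ring
    _ ≤ s ^ k * (M * k.factorial) := mul_le_mul h1 h h2 (h1.trans' (by positivity))
    _ = _ := by ring

lemma Fset_interior {Ω : Set ℂ} {C : ℝ} (hC : ∀ x ∈ Ω, ‖x‖ ≤ C)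
    (htwo : ∃ x ∈ Ω, ∃ y ∈ Ω, x ≠ y) {p : ℂ} (hp : ‖p‖ < 1)
    {r : ℝ} (hr : 1 - ‖p‖ < r) (M : ℝ) : interior (Fset Ω p r M) = ∅ := by
  classical
  obtain ⟨x, hx, y, hy, hxy⟩ := htwo
  have hr0 : 0 < r := by linarith
  rw [eq_empty_iff_forall_notMem]
  intro a ha
  obtain ⟨I, u, hu, hsub⟩ := isOpen_pi_iff.1 isOpen_interior a ha
  let a' : ℕ → Ω := fun n => if n ∈ I then a n else ⟨x, hx⟩
  have ha' : a' ∈ Fset Ω p r M := by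
    refine interior_subset (hsub fun n hn => ?_)
    have hn' : n ∈ I := hn
    simp only [a', hn', if_true]
    exact (hu n hn').2
  have hb : ∀ m ∉ I, Function.update a' m ⟨y, hy⟩ ∈ Fset Ω p r M := by
    intro m hm
    refine interior_subset (hsub fun n hn => ?_)
    have hn' : n ∈ I := hn
    have : n ≠ m := fun h => hm (h ▸ hn')
    simp only [a', Function.update_of_ne this, hn', if_true]
    exact (hu n hn').2
  have hmon : ∀ m ∉ I, ∀ k : ℕ,
      ‖iteratedDeriv k (fun z : ℂ => (y - x) * z ^ m) p‖ * r ^ k ≤ (2 * M) * k.factorial := by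
    intro m hm k
    set b := Function.update a' m ⟨y, hy⟩ with hbdef
    have hpb : p ∈ ball (0 : ℂ) 1 := by simpa using hp
    have e : EqOn (fun z : ℂ => (y - x) * z ^ m)
        (pser (fun n => (b n : ℂ)) - pser (fun n => (a' n : ℂ))) (ball 0 1) := by
      intro z hz
      rw [mem_ball_zero_iff] at hz
      simp only [Pi.sub_apply, pser]
      rw [← (pser_summable (fun n => hC _ (b n).2) hz).tsum_sub
        (pser_summable (fun n => hC _ (a' n).2) hz), tsum_eq_single m]
      · simp [b, a', hm, sub_mul]
      · intro n hn
        simp [b, Function.update_of_ne hn]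
    rw [e.iteratedDeriv_of_isOpen isOpen_ball k hpb]
    have hcd : ∀ c : ℕ → Ω, ContDiffAt ℂ k (pser (fun n => (c n : ℂ))) p := fun c =>
      ((pser_diff fun n => hC _ (c n).2).analyticAt (isOpen_ball.mem_nhds hpb)).contDiffAt
    rw [iteratedDeriv_sub (hcd b) (hcd a')]
    have h1 := hb m hm k
    have h2 := ha' k
    have h3 := mul_le_mul_of_nonneg_right (norm_sub_le
      (iteratedDeriv k (pser (fun n => (b n : ℂ))) p)
      (iteratedDeriv k (pser (fun n => (a' n : ℂ))) p)) (pow_nonneg hr0.le k)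
    nlinarith
  obtain ⟨s, hs1, hs2⟩ := exists_between hr
  have hs0 : 0 < s := by linarith
  obtain ⟨d, hd, hw⟩ : ∃ d : ℂ, ‖d‖ = s ∧ ‖p + d‖ = ‖p‖ + s := by
    by_cases hp0 : p = 0
    · exact ⟨s, by simp [abs_of_pos hs0], by simp [hp0, abs_of_pos hs0]⟩
    · have hpn : 0 < ‖p‖ := norm_pos_iff.2 hp0
      refine ⟨((s / ‖p‖ : ℝ) : ℂ) * p, ?_, ?_⟩
      · rw [norm_mul, Complex.norm_real, Real.norm_of_nonneg (by positivity)]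
        field_simp
      · have : p + ((s / ‖p‖ : ℝ) : ℂ) * p = ((1 + s / ‖p‖ : ℝ) : ℂ) * p := by
          push_cast; ring
        rw [this, norm_mul, Complex.norm_real, Real.norm_of_nonneg (by positivity)]
        field_simp
  have hgeo : Summable (fun k : ℕ => 2 * M * (s / r) ^ k) :=
    (summable_geometric_of_lt_one (by positivity) ((div_lt_one hr0).2 hs2)).mul_left _
  have hbd : ∀ m ∉ I, ‖y - x‖ * (‖p‖ + s) ^ m ≤ ∑' k : ℕ, 2 * M * (s / r) ^ k := by
    intro m hm
    have hsum := Complex.hasSum_taylorSeries_of_entire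
      (f := fun z : ℂ => (y - x) * z ^ m) (by fun_prop) p (p + d)
    have := hsum.tsum_eq ▸ tsum_of_norm_bounded hgeo.hasSum (fun k =>
      term_bound (w := p + d - p) (s := s) hr0 (hmon m hm k) (by simp [hd]))
    simpa [norm_mul, norm_pow, hw] using this
  have hyx : 0 < ‖y - x‖ := norm_pos_iff.2 (sub_ne_zero.2 hxy.symm)
  have htop : Tendsto (fun m : ℕ => ‖y - x‖ * (‖p‖ + s) ^ m) atTop atTop :=
    (tendsto_pow_atTop_atTop_of_one_lt (by linarith)).const_mul_atTop hyx
  have hev : ∀ᶠ m : ℕ in atTop, m ∉ I := by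
    have := I.finite_toSet.compl_mem_cofinite
    rw [Nat.cofinite_eq_atTop] at this
    exact this
  obtain ⟨m, hm1, hm2⟩ := ((htop.eventually_gt_atTop _).and hev).exists
  exact absurd (hbd m hm2) (not_le.2 hm1)

lemma Fset_ext {Ω : Set ℂ} {C : ℝ} (hC : ∀ x ∈ Ω, ‖x‖ ≤ C) {p : ℂ} (hp : ‖p‖ < 1)
    {r : ℝ} (hr : 1 - ‖p‖ < r) {M : ℝ} {a : ℕ → Ω} (ha : a ∈ Fset Ω p r M) :
    ¬ NaturalBoundary (pser (fun n => (a n : ℂ))) := by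
  classical
  have hr0 : 0 < r := by linarith
  set f := pser (fun n => (a n : ℂ)) with hf
  have hfd : DifferentiableOn ℂ f (ball 0 1) := pser_diff fun n => hC _ (a n).2
  obtain ⟨s, hs1, hs2⟩ := exists_between hr
  have hs0 : 0 < s := by linarith
  let h : ℂ → ℂ := fun z => ∑' k : ℕ, (k.factorial : ℂ)⁻¹ • (z - p) ^ k • iteratedDeriv k f p
  have hhd : DifferentiableOn ℂ h (ball p s) := by
    refine Complex.differentiableOn_tsum_of_summable_norm (u := fun k => M * (s / r) ^ k)
      ((summable_geometric_of_lt_one (by positivity) ((div_lt_one hr0).2 hs2)).mul_left _)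
      ?_ isOpen_ball ?_
    · intro k
      simp only [smul_eq_mul]
      fun_prop
    · intro k w hw
      exact term_bound hr0 (ha k) (mem_ball_iff_norm.1 hw).le
  have heq0 : EqOn f h (ball p (1 - ‖p‖)) := by
    intro z hz
    have hsub : ball p (1 - ‖p‖) ⊆ ball 0 1 := ball_subset_ball' (by simp)
    exact (Complex.taylorSeries_eq_on_ball (hfd.mono hsub) hz).symm
  have hopen : IsOpen (ball (0 : ℂ) 1 ∩ ball p s) := isOpen_ball.inter isOpen_ball
  have heq : EqOn f h (ball 0 1 ∩ ball p s) := by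
    refine AnalyticOnNhd.eqOn_of_preconnected_of_eventuallyEq (z₀ := p)
      ((hfd.mono inter_subset_left).analyticOnNhd hopen)
      ((hhd.mono inter_subset_right).analyticOnNhd hopen)
      ((convex_ball _ _).inter (convex_ball _ _)).isPreconnected
      ⟨by simpa using hp, by simpa using hs0⟩ ?_
    exact heq0.eventuallyEq_of_mem (ball_mem_nhds p (by linarith))
  obtain ⟨z₀, hz1, hz2⟩ : ∃ z₀ : ℂ, ‖z₀‖ = 1 ∧ ‖z₀ - p‖ = 1 - ‖p‖ := by
    by_cases hp0 : p = 0
    · exact ⟨1, by simp, by simp [hp0]⟩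
    · have hpn : 0 < ‖p‖ := norm_pos_iff.2 hp0
      refine ⟨((‖p‖⁻¹ : ℝ) : ℂ) * p, ?_, ?_⟩
      · rw [norm_mul, Complex.norm_real, Real.norm_of_nonneg (by positivity)]
        field_simp
      · have : ((‖p‖⁻¹ : ℝ) : ℂ) * p - p = ((‖p‖⁻¹ - 1 : ℝ) : ℂ) * p := by
          push_cast; ring
        have h1 : 1 ≤ ‖p‖⁻¹ := (one_le_inv₀ hpn).2 hp.le
        rw [this, norm_mul, Complex.norm_real, Real.norm_of_nonneg (by linarith)]
        field_simp
  unfold NaturalBoundary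
  rw [not_not]
  refine ⟨z₀, hz1, s - (1 - ‖p‖), by linarith,
    fun z => if z ∈ ball (0 : ℂ) 1 then f z else h z, ?_, fun z hz => by simp only [hz, if_true]⟩
  have hsub : ball z₀ (s - (1 - ‖p‖)) ⊆ ball p s :=
    ball_subset_ball' (by rw [dist_eq_norm, hz2]; linarith)
  rw [differentiableOn_union_iff_of_isOpen isOpen_ball isOpen_ball]
  constructor
  · exact hfd.congr fun z hz => by simp only [hz, if_true]
  · refine (hhd.mono hsub).congr fun z hz => ?_
    by_cases hz' : z ∈ ball (0 : ℂ) 1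
    · simp only [hz', if_true]
      exact heq ⟨hz', hsub hz⟩
    · simp only [hz', if_false]

lemma exists_Fset {Ω : Set ℂ} {a : ℕ → Ω} {D : Set ℂ} (hD : Dense D)
    (h : ¬ NaturalBoundary (pser (fun n => (a n : ℂ)))) :
    ∃ p ∈ D, ‖p‖ < 1 ∧ ∃ k : ℕ, 1 - ‖p‖ < 1 / ((k : ℝ) + 1) ∧
      ∃ M : ℕ, a ∈ Fset Ω p (1 / ((k : ℝ) + 1)) M := by
  unfold NaturalBoundary at h
  rw [not_not] at h
  obtain ⟨z₀, hz, δ, hδ, g, hg, hgf⟩ := h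
  obtain ⟨k, hk⟩ := exists_nat_one_div_lt (half_pos hδ)
  set r : ℝ := 1 / ((k : ℝ) + 1) with hr
  have hr0 : 0 < r := by positivity
  have hne : (ball (0 : ℂ) 1 ∩ ball z₀ r).Nonempty := by
    have : z₀ ∈ closure (ball (0 : ℂ) 1) := by
      rw [closure_ball _ one_ne_zero]; simp [hz]
    rw [inter_comm]
    exact mem_closure_iff.1 this _ isOpen_ball (mem_ball_self hr0)
  obtain ⟨p, ⟨hp1, hp2⟩, hpD⟩ := hD.inter_open_nonempty _ (isOpen_ball.inter isOpen_ball) hne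
  have hp : ‖p‖ < 1 := by simpa using hp1
  have hp2' := mem_ball_iff_norm.1 hp2
  refine ⟨p, hpD, hp, k, ?_, ?_⟩
  · have := norm_sub_norm_le z₀ p
    rw [norm_sub_rev] at this
    linarith
  have hsub : closedBall p r ⊆ ball z₀ δ :=
    closedBall_subset_ball' (by rw [dist_eq_norm]; linarith)
  have hgd : DifferentiableOn ℂ g (closedBall p r) := hg.mono (hsub.trans subset_union_right)
  obtain ⟨B, hB⟩ := (isCompact_closedBall p r).exists_bound_of_continuousOn hgd.continuousOn
  obtain ⟨M, hM⟩ := exists_nat_ge B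
  refine ⟨M, fun j => ?_⟩
  have e : EqOn (pser (fun n => (a n : ℂ))) g (ball 0 1) := fun z hz => (hgf z hz).symm
  rw [e.iteratedDeriv_of_isOpen isOpen_ball j hp1]
  have := Complex.norm_iteratedDeriv_le_of_forall_mem_sphere_norm_le j hr0
    (hgd.diffContOnCl_ball subset_rfl)
    (fun z hz => (hB z (sphere_subset_closedBall hz)).trans hM)
  rw [le_div_iff₀ (by positivity)] at this
  linarith

theorem stmt6 (Ω : Set ℂ) (hΩ : IsCompact Ω)
    (htwo : ∃ x ∈ Ω, ∃ y ∈ Ω, x ≠ y) :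
    Dense {a : ℕ → Ω | NaturalBoundary (fun z => ∑' n : ℕ, (a n : ℂ) * z ^ n)} ∧
    IsGδ {a : ℕ → Ω | NaturalBoundary (fun z => ∑' n : ℕ, (a n : ℂ) * z ^ n)} := by
  obtain ⟨C, hC⟩ := hΩ.isBounded.exists_norm_le
  have : CompactSpace Ω := isCompact_iff_compactSpace.1 hΩ
  obtain ⟨D, hDc, hD⟩ := TopologicalSpace.exists_countable_dense ℂ
  have : Countable D := hDc.to_subtype
  let ι := {q : D × ℕ × ℕ // ‖(q.1 : ℂ)‖ < 1 ∧ 1 - ‖(q.1 : ℂ)‖ < 1 / ((q.2.1 : ℝ) + 1)}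
  let G : ι → Set (ℕ → Ω) := fun q => (Fset Ω q.1.1 (1 / ((q.1.2.1 : ℝ) + 1)) (q.1.2.2 : ℝ))ᶜ
  have hG : {a : ℕ → Ω | NaturalBoundary (fun z => ∑' n : ℕ, (a n : ℂ) * z ^ n)} = ⋂ q, G q := by
    ext a
    simp only [mem_setOf_eq, mem_iInter]
    change NaturalBoundary (pser (fun n => (a n : ℂ))) ↔ _
    constructor
    · intro h q hq
      exact Fset_ext hC q.2.1 q.2.2 hq h
    · intro h
      by_contra hn
      obtain ⟨p, hpD, hp, k, hk, M, hM⟩ := exists_Fset hD hn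
      exact h ⟨(⟨p, hpD⟩, k, M), hp, hk⟩ hM
  have ho : ∀ q, IsOpen (G q) := fun q => (Fset_closed hC q.2.1 _ _).isOpen_compl
  have hd : ∀ q, Dense (G q) := fun q =>
    interior_eq_empty_iff_dense_compl.1 (Fset_interior hC htwo q.2.1 q.2.2 _)
  rw [hG]
  exact ⟨dense_iInter_of_isOpen ho hd, IsGδ.iInter_of_isOpen ho⟩
end

section
/- Fix a nonempty open arc I of the unit circle, let Ω_I = ℂ \ (∂𝔻 \ I), and fix A ∈ (0,∞). Let R be the set of two-sided sequences b : ℤ → ℂ with sup_{n∈ℤ} |b_n| ≤ A that are reflectionless on I; for b ∈ R, let f_b denote the (unique) function analytic on Ω_I that equals Σ_{n=0}^∞ b_n z^n on 𝔻. Then for every compact set K ⊂ Ω_I, sup_{b∈R} sup_{z∈K} |f_b(z)| < ∞. -/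
open Filter Metric Set MeasureTheory

lemma fPlus_bound (b : ℤ → ℂ) (A : ℝ) (hb : ∀ n : ℤ, ‖b n‖ ≤ A) (z : ℂ) (hz : ‖z‖ < 1) :
    ‖fPlus b z‖ * (1 - ‖z‖) ≤ A := by
  have h1 : HasSum (fun n : ℕ => A * ‖z‖ ^ n) (A * (1 - ‖z‖)⁻¹) :=
    (hasSum_geometric_of_lt_one (norm_nonneg z) hz).mul_left A
  have h2 : ‖fPlus b z‖ ≤ A * (1 - ‖z‖)⁻¹ := by
    unfold fPlus
    refine tsum_of_norm_bounded h1 (fun n => ?_)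
    rw [norm_mul, norm_pow]
    exact mul_le_mul_of_nonneg_right (hb _) (by positivity)
  have h3 : 0 < 1 - ‖z‖ := by linarith
  rwa [← div_eq_mul_inv, le_div_iff₀ h3] at h2

lemma fMinus_bound (b : ℤ → ℂ) (A : ℝ) (hb : ∀ n : ℤ, ‖b n‖ ≤ A) (z : ℂ) (hz : 1 < ‖z‖) :
    ‖fMinus b z‖ * (‖z‖ - 1) ≤ A := by
  have hz0 : 0 < ‖z‖ := by linarith
  have h1 : HasSum (fun n : ℕ => (A * ‖z‖⁻¹) * ‖z‖⁻¹ ^ n) ((A * ‖z‖⁻¹) * (1 - ‖z‖⁻¹)⁻¹) :=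
    (hasSum_geometric_of_lt_one (by positivity) (inv_lt_one_of_one_lt₀ hz)).mul_left _
  have h2 : ‖fMinus b z‖ ≤ (A * ‖z‖⁻¹) * (1 - ‖z‖⁻¹)⁻¹ := by
    unfold fMinus
    refine tsum_of_norm_bounded h1 (fun n => ?_)
    rw [norm_mul, norm_zpow]
    have : ‖z‖ ^ (-(n : ℤ) - 1) = ‖z‖⁻¹ * ‖z‖⁻¹ ^ n := by
      rw [zpow_sub₀ hz0.ne', zpow_neg, zpow_natCast, zpow_one, inv_pow]
      field_simp
    rw [this, mul_assoc]
    exact mul_le_mul_of_nonneg_right (hb _) (by positivity)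
  have h3 : 0 < ‖z‖ - 1 := by linarith
  have h4 : (A * ‖z‖⁻¹) * (1 - ‖z‖⁻¹)⁻¹ = A / (‖z‖ - 1) := by
    have : 1 - ‖z‖⁻¹ = (‖z‖ - 1) / ‖z‖ := by field_simp
    rw [this]
    field_simp
  rwa [h4, le_div_iff₀ h3] at h2

lemma arc_mem_nhds (α β : ℝ) (z₀ : ℂ) (hz : z₀ ∈ arc α β) :
    ∀ᶠ w in nhds z₀, ‖w‖ = 1 → w ∈ arc α β := by
  obtain ⟨θ, hθ, rfl⟩ := hz
  set z₀ := Complex.exp (θ * Complex.I) with hz₀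
  have hne : z₀ ≠ 0 := Complex.exp_ne_zero _
  have hc : ContinuousAt (fun w : ℂ => θ + Complex.arg (w / z₀)) z₀ := by
    refine continuousAt_const.add ?_
    refine ContinuousAt.comp (g := Complex.arg) (f := fun w : ℂ => w / z₀) ?_ (by fun_prop)
    rw [div_self hne]
    exact Complex.continuousAt_arg (by simp)
  have hv : θ + Complex.arg (z₀ / z₀) = θ := by rw [div_self hne]; simp
  have hmem : Set.Ioo α β ∈ nhds (θ + Complex.arg (z₀ / z₀)) := by
    rw [hv]; exact isOpen_Ioo.mem_nhds hθ
  filter_upwards [hc hmem] with w hw hw1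
  refine ⟨_, hw, ?_⟩
  have hn : ‖w / z₀‖ = 1 := by
    rw [norm_div, hw1, hz₀, Complex.norm_exp_ofReal_mul_I]; simp
  have := Complex.norm_mul_exp_arg_mul_I (w / z₀)
  rw [hn] at this
  push_cast
  rw [add_mul, Complex.exp_add, ← hz₀]
  have h5 : Complex.exp (Complex.arg (w / z₀) * Complex.I) = w / z₀ := by simpa using this
  rw [h5]
  field_simp

lemma poly_norm (u : ℂ) (hu : ‖u‖ = 1) (ρ : ℝ) (hρ : 0 < ρ) :
    ‖u ^ 2 + ρ * u + 1‖ = |‖1 + ρ * u‖ ^ 2 - 1| / ρ := by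
  have h1 : u * (starRingEnd ℂ) u = 1 := by
    rw [Complex.mul_conj, Complex.normSq_eq_norm_sq, hu]; simp
  have h2 : u ^ 2 + ρ * u + 1 = u * ((ρ + 2 * u.re : ℝ) : ℂ) := by
    have : ((2 * u.re : ℝ) : ℂ) = u + (starRingEnd ℂ) u := by
      rw [Complex.add_conj]
    push_cast at this ⊢
    rw [this]
    linear_combination -h1
  have h3 : ‖1 + ρ * u‖ ^ 2 - 1 = ρ * (ρ + 2 * u.re) := by
    have : ‖u‖ ^ 2 = 1 := by rw [hu]; norm_num
    rw [← Complex.normSq_eq_norm_sq, Complex.normSq_apply] at this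
    rw [← Complex.normSq_eq_norm_sq, Complex.normSq_apply]
    simp
    linear_combination ρ ^ 2 * this
  rw [h2, h3, norm_mul, hu, Complex.norm_real, abs_mul, abs_of_pos hρ, Real.norm_eq_abs]
  field_simp

lemma local_bound (A : ℝ) (hA : 0 < A) (z₀ : ℂ) (hz₀ : ‖z₀‖ = 1) (ρ : ℝ) (hρ : 0 < ρ) (hρ1 : ρ ≤ 1)
    (g : ℂ → ℂ) (hg : DifferentiableOn ℂ g (closedBall z₀ ρ))
    (hb : ∀ z : ℂ, ‖z‖ ≠ 1 → ‖g z‖ * |‖z‖ - 1| ≤ A) (z : ℂ) (hz : z ∈ closedBall z₀ (ρ / 4)) :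
    ‖g z‖ ≤ 6 * A / ρ := by
  have hne : z₀ ≠ 0 := by rintro rfl; simp at hz₀
  have hρc : (ρ : ℂ) ≠ 0 := by exact_mod_cast hρ.ne'
  set P : ℂ → ℂ := fun w => ((w - z₀) / (z₀ * ρ)) ^ 2 + ρ * ((w - z₀) / (z₀ * ρ)) + 1 with hP
  have hPd : Differentiable ℂ P := by
    intro w; simp only [hP]; fun_prop
  have hu : ∀ w, ‖(w - z₀) / (z₀ * ρ)‖ = dist w z₀ / ρ := by
    intro w
    rw [norm_div, norm_mul, hz₀, Complex.norm_real, Real.norm_eq_abs, abs_of_pos hρ, one_mul,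
      dist_eq_norm]
  have hd : DiffContOnCl ℂ (fun w => g w * P w) (ball z₀ ρ) := by
    apply DifferentiableOn.diffContOnCl
    rw [closure_ball z₀ hρ.ne']
    exact hg.mul hPd.differentiableOn
  have hbd : ∀ w ∈ frontier (ball z₀ ρ), ‖g w * P w‖ ≤ 3 * A / ρ := by
    intro w hw
    rw [frontier_ball z₀ hρ.ne', mem_sphere] at hw
    have h1 : ‖(w - z₀) / (z₀ * ρ)‖ = 1 := by rw [hu, hw, div_self hρ.ne']
    have h2 := poly_norm _ h1 ρ hρ
    have h3 : (1 : ℂ) + ρ * ((w - z₀) / (z₀ * ρ)) = w / z₀ := by field_simp; ring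
    rw [h3, norm_div, hz₀, div_one] at h2
    have h4 : ‖P w‖ = |‖w‖ ^ 2 - 1| / ρ := h2
    have h5 : ‖w‖ ≤ 2 := by
      have : ‖w‖ ≤ ‖w - z₀‖ + ‖z₀‖ := by simpa using norm_add_le (w - z₀) z₀
      rw [← dist_eq_norm, hw, hz₀] at this
      linarith
    rw [norm_mul, h4, ← mul_div_assoc]
    refine div_le_div_of_nonneg_right ?_ hρ.le
    by_cases hw1 : ‖w‖ = 1
    · rw [hw1]; simp; exact hA.le
    · have h6 := hb w hw1
      have h7 : |‖w‖ ^ 2 - 1| = |‖w‖ - 1| * (‖w‖ + 1) := by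
        rw [show ‖w‖ ^ 2 - 1 = (‖w‖ - 1) * (‖w‖ + 1) by ring, abs_mul,
          abs_of_nonneg (by positivity : 0 ≤ ‖w‖ + 1)]
      rw [h7, ← mul_assoc]
      calc _ ≤ A * (‖w‖ + 1) := mul_le_mul_of_nonneg_right h6 (by positivity)
        _ ≤ 3 * A := by nlinarith
  have hzc : z ∈ closure (ball z₀ ρ) := by
    rw [closure_ball z₀ hρ.ne']
    exact closedBall_subset_closedBall (by linarith) hz
  have hmax := Complex.norm_le_of_forall_mem_frontier_norm_le isBounded_ball hd hbd hzc
  have hul : ‖(z - z₀) / (z₀ * ρ)‖ ≤ 1 / 4 := by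
    rw [hu, div_le_iff₀ hρ]
    have := mem_closedBall.1 hz
    linarith
  have hPl : 1 / 2 ≤ ‖P z‖ := by
    set u := (z - z₀) / (z₀ * ρ) with hudef
    have h1 : ‖P z - 1‖ ≤ 1 / 2 := by
      have : P z - 1 = u ^ 2 + ρ * u := by simp [hP, hudef]
      rw [this]
      refine (norm_add_le _ _).trans ?_
      rw [norm_pow, norm_mul, Complex.norm_real, Real.norm_eq_abs, abs_of_pos hρ]
      nlinarith [norm_nonneg u]
    have h2 : ‖(1 : ℂ)‖ ≤ ‖P z‖ + ‖P z - 1‖ := by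
      simpa using norm_sub_le (P z) (P z - 1)
    rw [norm_one] at h2
    linarith
  have hmax' : ‖g z‖ * ‖P z‖ ≤ 3 * A / ρ := by simpa using hmax
  have : 6 * A / ρ = 2 * (3 * A / ρ) := by ring
  rw [this]
  nlinarith [norm_nonneg (g z)]

theorem stmt8 (α β : ℝ) (hαβ : α < β) (A : ℝ) (hA : 0 < A)
    (K : Set ℂ) (hK : IsCompact K)
    (hKsub : K ⊆ (Metric.sphere (0 : ℂ) 1 \ arc α β)ᶜ) :
    ∃ M : ℝ, ∀ b : ℤ → ℂ, (∀ n : ℤ, ‖b n‖ ≤ A) →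
      ∀ g : ℂ → ℂ,
        DifferentiableOn ℂ g ((Metric.sphere (0 : ℂ) 1 \ arc α β)ᶜ) →
        (∀ z ∈ Metric.ball (0 : ℂ) 1, g z = fPlus b z) →
        (∀ z : ℂ, 1 < ‖z‖ → g z = - fMinus b z) →
        ∀ z ∈ K, ‖g z‖ ≤ M := by
  have key : ∀ b : ℤ → ℂ, (∀ n : ℤ, ‖b n‖ ≤ A) → ∀ g : ℂ → ℂ,
      (∀ z ∈ Metric.ball (0 : ℂ) 1, g z = fPlus b z) →
      (∀ z : ℂ, 1 < ‖z‖ → g z = - fMinus b z) →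
      ∀ z : ℂ, ‖z‖ ≠ 1 → ‖g z‖ * |‖z‖ - 1| ≤ A := by
    intro b hb g h1 h2 z hz
    rcases lt_or_gt_of_ne hz with h | h
    · rw [h1 z (by simpa using h), abs_of_neg (by linarith), neg_sub]
      exact fPlus_bound b A hb z h
    · rw [h2 z h, abs_of_pos (by linarith), norm_neg]
      exact fMinus_bound b A hb z h
  refine hK.induction_on (p := fun s => ∃ M : ℝ, ∀ b : ℤ → ℂ, (∀ n : ℤ, ‖b n‖ ≤ A) →
      ∀ g : ℂ → ℂ,
        DifferentiableOn ℂ g ((Metric.sphere (0 : ℂ) 1 \ arc α β)ᶜ) →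
        (∀ z ∈ Metric.ball (0 : ℂ) 1, g z = fPlus b z) →
        (∀ z : ℂ, 1 < ‖z‖ → g z = - fMinus b z) →
        ∀ z ∈ s, ‖g z‖ ≤ M) ?_ ?_ ?_ ?_
  · exact ⟨0, by simp⟩
  · rintro s t hst ⟨M, hM⟩
    exact ⟨M, fun b hb g h0 h1 h2 z hz => hM b hb g h0 h1 h2 z (hst hz)⟩
  · rintro s t ⟨M, hM⟩ ⟨N, hN⟩
    refine ⟨max M N, fun b hb g h0 h1 h2 z hz => ?_⟩
    rcases hz with hz | hz
    · exact (hM b hb g h0 h1 h2 z hz).trans (le_max_left _ _)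
    · exact (hN b hb g h0 h1 h2 z hz).trans (le_max_right _ _)
  · intro z₀ hz₀
    by_cases h1 : ‖z₀‖ = 1
    · have harc : z₀ ∈ arc α β := by
        by_contra hcon
        exact hKsub hz₀ ⟨by simpa using h1, hcon⟩
      obtain ⟨ε, hε, hball⟩ := Metric.eventually_nhds_iff.1 (arc_mem_nhds α β z₀ harc)
      set ρ := min (ε / 2) 1 with hρdef
      have hρ : 0 < ρ := lt_min (by linarith) one_pos
      have hsub : closedBall z₀ ρ ⊆ (Metric.sphere (0 : ℂ) 1 \ arc α β)ᶜ := by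
        rintro w hw ⟨hw1, hw2⟩
        refine hw2 (hball ?_ (by simpa using hw1))
        have := mem_closedBall.1 hw
        have h3 : ρ ≤ ε / 2 := min_le_left _ _
        linarith
      refine ⟨closedBall z₀ (ρ / 4), mem_nhdsWithin_of_mem_nhds
        (closedBall_mem_nhds _ (by linarith)), 6 * A / ρ, ?_⟩
      intro b hb g h0 hp hm z hz
      exact local_bound A hA z₀ h1 ρ hρ (min_le_right _ _) g (h0.mono hsub)
        (key b hb g hp hm) z hz
    · have hpos : 0 < |‖z₀‖ - 1| := abs_pos.2 (sub_ne_zero.2 h1)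
      have hc : ContinuousAt (fun w : ℂ => |‖w‖ - 1|) z₀ := by fun_prop
      have hev := hc.eventually (lt_mem_nhds (half_lt_self hpos))
      refine ⟨_, mem_nhdsWithin_of_mem_nhds hev, A / (|‖z₀‖ - 1| / 2), ?_⟩
      intro b hb g h0 hp hm z hz
      have hz' : |‖z₀‖ - 1| / 2 < |‖z‖ - 1| := hz
      have hzne : ‖z‖ ≠ 1 := by
        intro h; rw [h] at hz'; simp at hz'; linarith
      rw [le_div_iff₀ (by linarith)]
      exact (mul_le_mul_of_nonneg_left hz'.le (norm_nonneg _)).trans (key b hb g hp hm z hzne)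
end
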